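/- Let N ≥ 1 be an integer, p > 1, s ∈ (0,1) with sp > p-1, and let K be a kernel with constants λ, Λ. Let u : ℝ^N × ℝ → ℝ be a continuous local weak solution of ∂_t u + L_K u = 0 in B_2 × (-2, 0] satisfying sup_{B_2 × (-2,0]} |u| + Tail_∞(u; 0, 2, (-2, 0]) ≤ 1. Let 1 ≤ ϱ₁ < ϱ₂ ≤ 3/2 and κ ∈ [0,1), and suppose A_κ := sup_{t ∈ (-1,0]} [u(·,t)]_{C^{0,κ}(B_{ϱ₂})} < ∞. Then for every γ with 0 < γ < min{1, κ + 1/(p-1)} there exists a constant L_γ > 0, depending only on N, s, p, λ, Λ, κ, γ, ϱ₁, ϱ₂ and A_κ, such that sup_{t ∈ (-1,0]} [u(·,t)]_{C^{0,γ}(B_{ϱ₁})} ≤ L_γ. -/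

import Mathlib

open MeasureTheory Set Metric Filter
open scoped ENNReal NNReal Topology Classical

noncomputable section

abbrev Euc (N : ℕ) := EuclideanSpace ℝ (Fin N)

/-- `J_p(t) = |t|^{p-2} t`. -/
def Jp (p t : ℝ) : ℝ := |t| ^ (p - 2) * t

/-- A symmetric kernel comparable to the fractional `p`-Laplace kernel. -/
def IsKernel (N : ℕ) (p s lam Lam : ℝ) (K : Euc N → ℝ) : Prop :=
  Measurable K ∧
  (∀ z : Euc N, z ≠ 0 → 0 < K z) ∧
  (∀ z : Euc N, z ≠ 0 → K (-z) = K z) ∧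
  (∀ z : Euc N, z ≠ 0 →
    lam * ‖z‖ ^ (-((N : ℝ) + s * p)) ≤ K z ∧ K z ≤ Lam * ‖z‖ ^ (-((N : ℝ) + s * p)))

/-- Local weak solution of `∂ₜ u + L_K u = 0` in `Ω × I`. -/
def IsLocalWeakSolution (N : ℕ) (p s : ℝ) (K : Euc N → ℝ)
    (Ω : Set (Euc N)) (I : Set ℝ) (u : Euc N → ℝ → ℝ) : Prop :=
  (∀ J : Set ℝ, IsCompact J → J ⊆ interior I →
    ∀ U : Set (Euc N), IsOpen U → IsCompact (closure U) → closure U ⊆ Ω →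
      (∫⁻ t in J, ∫⁻ x in U, ∫⁻ y in U,
          ENNReal.ofReal (|u x t - u y t| ^ p * ‖x - y‖ ^ (-((N : ℝ) + s * p)))) < ⊤ ∧
      (∫⁻ t in J, ∫⁻ x in U, ENNReal.ofReal (|u x t| ^ p)) < ⊤ ∧
      essSup (fun t => ∫⁻ x, ENNReal.ofReal (|u x t| ^ (p - 1) / (1 + ‖x‖ ^ ((N : ℝ) + s * p))))
        (volume.restrict J) < ⊤ ∧
      (∀ t₀ ∈ I, Tendsto (fun t => ∫ x in U, (u x t - u x t₀) ^ 2)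
          (nhdsWithin t₀ I) (nhds 0))) ∧
  (∀ φ : Euc N × ℝ → ℝ, ContDiff ℝ (⊤ : ℕ∞) φ → HasCompactSupport φ →
    tsupport φ ⊆ Ω ×ˢ interior I →
    -(∫ t in I, ∫ x in Ω, u x t * deriv (fun τ => φ (x, τ)) t) +
      (1 / 2) * ∫ t in I, ∫ x, ∫ y,
        Jp p (u x t - u y t) * (φ (x, t) - φ (y, t)) * K (x - y) = 0)

/-- Essential supremum of `|u|` over a space-time set. -/
def supAbs (N : ℕ) (u : Euc N → ℝ → ℝ) (Q : Set (Euc N × ℝ)) : ℝ≥0∞ :=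
  essSup (fun q : Euc N × ℝ => ENNReal.ofReal |u q.1 q.2|) (volume.restrict Q)

/-- The nonlocal tail `Tail(w; x₀, r)`. -/
def tailFn (N : ℕ) (p s : ℝ) (w : Euc N → ℝ) (x₀ : Euc N) (r : ℝ) : ℝ :=
  (r ^ (s * p) *
    ∫ x in (ball x₀ r)ᶜ, |w x| ^ (p - 1) * ‖x - x₀‖ ^ (-((N : ℝ) + s * p))) ^ (1 / (p - 1))

/-- The parabolic tail `Tail_∞(u; x₀, r, J)`. -/
def tailSup (N : ℕ) (p s : ℝ) (u : Euc N → ℝ → ℝ) (x₀ : Euc N) (r : ℝ) (J : Set ℝ) : ℝ≥0∞ :=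
  essSup (fun t => ENNReal.ofReal (tailFn N p s (fun x => u x t) x₀ r)) (volume.restrict J)

/-- `M_R = ‖u‖_{L^∞(Q_{2R,2R^{sp}}(x₀,t₀))} + Tail_∞(u; x₀, R, (t₀-2R^{sp},t₀]) + 1`. -/
def MR (N : ℕ) (p s : ℝ) (u : Euc N → ℝ → ℝ) (x₀ : Euc N) (R t₀ : ℝ) : ℝ≥0∞ :=
  supAbs N u (ball x₀ (2 * R) ×ˢ Ioc (t₀ - 2 * R ^ (s * p)) t₀)
    + tailSup N p s u x₀ R (Ioc (t₀ - 2 * R ^ (s * p)) t₀) + 1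

/-- `φ ∈ C²ₓ ∩ C¹ₜ(U × I)` with derivative data `Dφ, D2φ, φt`. -/
def C2xC1t (N : ℕ) (U : Set (Euc N)) (I : Set ℝ) (φ : Euc N → ℝ → ℝ)
    (Dφ : Euc N → ℝ → (Euc N →L[ℝ] ℝ)) (D2φ : Euc N → ℝ → (Euc N →L[ℝ] Euc N →L[ℝ] ℝ))
    (φt : Euc N → ℝ → ℝ) : Prop :=
  ContinuousOn (fun q : Euc N × ℝ => φ q.1 q.2) (U ×ˢ I) ∧
  (∀ x ∈ U, ∀ t ∈ I, HasFDerivAt (fun y => φ y t) (Dφ x t) x) ∧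
  ContinuousOn (fun q : Euc N × ℝ => Dφ q.1 q.2) (U ×ˢ I) ∧
  (∀ x ∈ U, ∀ t ∈ I, HasFDerivAt (fun y => Dφ y t) (D2φ x t) x) ∧
  ContinuousOn (fun q : Euc N × ℝ => D2φ q.1 q.2) (U ×ˢ I) ∧
  (∀ x ∈ U, ∀ t ∈ I, HasDerivWithinAt (fun τ => φ x τ) (φt x t) I t) ∧
  ContinuousOn (fun q : Euc N × ℝ => φt q.1 q.2) (U ×ˢ I)

/-- The truncated integral over the annulus `δ < |x - y| < ρ`. -/
def pvIntegral (N : ℕ) (p ρ : ℝ) (K : Euc N → ℝ) (w : Euc N → ℝ) (x : Euc N) (δ : ℝ) : ℝ :=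
  ∫ y in {y : Euc N | δ < dist y x ∧ dist y x < ρ}, Jp p (w x - w y) * K (x - y)

/-- Existence of the principal value `L_K^{B_ρ} w (x) = l`. -/
def HasPV (N : ℕ) (p ρ : ℝ) (K : Euc N → ℝ) (w : Euc N → ℝ) (x : Euc N) (l : ℝ) : Prop :=
  Tendsto (fun δ => pvIntegral N p ρ K w x δ) (nhdsWithin 0 (Ioi 0)) (nhds l)

/-- Weak supersolution of `∂ₜ w + L_K^{B_ρ} w = f` in `U × I`. -/
def IsTruncSuper (N : ℕ) (p ρ : ℝ) (K : Euc N → ℝ) (U : Set (Euc N)) (I : Set ℝ)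
    (f w : Euc N → ℝ → ℝ) : Prop :=
  ∀ φ : Euc N × ℝ → ℝ, ContDiff ℝ (⊤ : ℕ∞) φ → HasCompactSupport φ →
    tsupport φ ⊆ U ×ˢ interior I → (∀ q, 0 ≤ φ q) →
    ∫ t in I, ∫ x in U, f x t * φ (x, t) ≤
      -(∫ t in I, ∫ x in U, w x t * deriv (fun τ => φ (x, τ)) t) +
        (1 / 2) * ∫ t in I, ∫ q in {q : Euc N × Euc N | dist q.1 q.2 < ρ},
          Jp p (w q.1 t - w q.2 t) * (φ (q.1, t) - φ (q.2, t)) * K (q.1 - q.2)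

/-- Weak subsolution of `∂ₜ w + L_K^{B_ρ} w = f` in `U × I`. -/
def IsTruncSub (N : ℕ) (p ρ : ℝ) (K : Euc N → ℝ) (U : Set (Euc N)) (I : Set ℝ)
    (f w : Euc N → ℝ → ℝ) : Prop :=
  ∀ φ : Euc N × ℝ → ℝ, ContDiff ℝ (⊤ : ℕ∞) φ → HasCompactSupport φ →
    tsupport φ ⊆ U ×ˢ interior I → (∀ q, 0 ≤ φ q) →
    -(∫ t in I, ∫ x in U, w x t * deriv (fun τ => φ (x, τ)) t) +
        (1 / 2) * ∫ t in I, ∫ q in {q : Euc N × Euc N | dist q.1 q.2 < ρ},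
          Jp p (w q.1 t - w q.2 t) * (φ (q.1, t) - φ (q.2, t)) * K (q.1 - q.2) ≤
      ∫ t in I, ∫ x in U, f x t * φ (x, t)

lemma Jp_abs {p : ℝ} (hp : 1 < p) (t : ℝ) : |Jp p t| = |t| ^ (p - 1) := by
  unfold Jp
  rcases eq_or_ne t 0 with rfl | ht
  · simp [Real.zero_rpow (by linarith : p - 1 ≠ 0)]
  · have h : 0 < |t| := abs_pos.2 ht
    rw [abs_mul, abs_of_nonneg (Real.rpow_nonneg (abs_nonneg t) _),
      show p - 1 = (p - 2) + 1 by ring, Real.rpow_add_one h.ne']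

lemma Jp_neg (p t : ℝ) : Jp p (-t) = - Jp p t := by
  unfold Jp; rw [abs_neg]; ring

lemma Jp_of_nonneg {p : ℝ} (hp : 1 < p) {t : ℝ} (ht : 0 ≤ t) : Jp p t = t ^ (p - 1) := by
  have h := Jp_abs hp t
  rw [abs_of_nonneg ht, abs_of_nonneg] at h
  · exact h
  · unfold Jp; positivity

lemma Jp_mono {p : ℝ} (hp : 1 < p) : Monotone (Jp p) := by
  intro a b hab
  have hq : 0 ≤ p - 1 := by linarith
  rcases le_total 0 a with ha | ha
  · rw [Jp_of_nonneg hp ha, Jp_of_nonneg hp (ha.trans hab)]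
    exact Real.rpow_le_rpow ha hab hq
  · have e : Jp p a = - (-a) ^ (p - 1) := by
      rw [← Jp_of_nonneg hp (by linarith : 0 ≤ -a), Jp_neg, neg_neg]
    rcases le_total 0 b with hb | hb
    · rw [e, Jp_of_nonneg hp hb]
      have := Real.rpow_nonneg (by linarith : 0 ≤ -a) (p - 1)
      have := Real.rpow_nonneg hb (p - 1)
      linarith
    · have e' : Jp p b = - (-b) ^ (p - 1) := by
        rw [← Jp_of_nonneg hp (by linarith : 0 ≤ -b), Jp_neg, neg_neg]
      rw [e, e']
      have := Real.rpow_le_rpow (by linarith : 0 ≤ -b) (by linarith : -b ≤ -a) hq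
      linarith

lemma Jp_zero (p : ℝ) : Jp p 0 = 0 := by simp [Jp]

lemma Jp_measurable (p : ℝ) : Measurable (Jp p) := by
  unfold Jp; fun_prop

/-- `p ≤ 2`: Hölder bound. -/
lemma Jp_sub_le_of_le_two {p : ℝ} (hp : 1 < p) (hp2 : p ≤ 2) {a b : ℝ} (hab : b ≤ a) :
    Jp p a - Jp p b ≤ 2 * (a - b) ^ (p - 1) := by
  have hq : 0 < p - 1 := by linarith
  have hq1 : p - 1 ≤ 1 := by linarith
  have key : ∀ x y : ℝ, 0 ≤ y → y ≤ x → x ^ (p - 1) - y ^ (p - 1) ≤ (x - y) ^ (p - 1) := by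
    intro x y hy hyx
    have := Real.rpow_add_le_add_rpow (a := x - y) (b := y) (by linarith) hy hq.le hq1
    rw [sub_add_cancel] at this
    linarith
  have hn := Real.rpow_nonneg (by linarith : 0 ≤ a - b) (p - 1)
  have en : ∀ c : ℝ, c ≤ 0 → Jp p c = - (-c) ^ (p - 1) := by
    intro c hc
    rw [← Jp_of_nonneg hp (by linarith : 0 ≤ -c), Jp_neg, neg_neg]
  rcases le_total 0 b with hb | hb
  · rw [Jp_of_nonneg hp hb, Jp_of_nonneg hp (hb.trans hab)]
    linarith [key a b hb hab]
  · rcases le_total 0 a with ha | ha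
    · rw [en b hb, Jp_of_nonneg hp ha]
      have h1 := Real.rpow_le_rpow ha (by linarith : a ≤ a - b) hq.le
      have h2 := Real.rpow_le_rpow (by linarith : 0 ≤ -b) (by linarith : -b ≤ a - b) hq.le
      linarith
    · rw [en b hb, en a ha]
      have h1 := key (-b) (-a) (by linarith) (by linarith)
      rw [show -b - -a = a - b by ring] at h1
      linarith

lemma rpow_mvt {q x y : ℝ} (hx : 0 < y) (hxy : y < x) :
    ∃ ξ ∈ Ioo y x, x ^ q - y ^ q = q * ξ ^ (q - 1) * (x - y) := by
  obtain ⟨ξ, hξ, h⟩ := exists_hasDerivAt_eq_slope (fun t : ℝ => t ^ q) (fun t => q * t ^ (q - 1)) hxy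
    (fun t ht => (Real.continuousAt_rpow_const _ _ (Or.inl (by linarith [ht.1]))).continuousWithinAt)
    (fun t ht => Real.hasDerivAt_rpow_const (Or.inl (by linarith [ht.1])))
  refine ⟨ξ, hξ, ?_⟩
  rw [h, div_mul_cancel₀]
  linarith

/-- `p ≥ 2`: local Lipschitz bound. -/
lemma Jp_sub_le_of_two_le {p : ℝ} (hp2 : 2 ≤ p) {a b X : ℝ} (hab : b ≤ a)
    (ha : |a| ≤ X) (hb : |b| ≤ X) :
    Jp p a - Jp p b ≤ 2 * (p - 1) * X ^ (p - 2) * (a - b) := by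
  have hp : 1 < p := by linarith
  have hq : 0 < p - 1 := by linarith
  have hX : 0 ≤ X := (abs_nonneg a).trans ha
  have key : ∀ x y : ℝ, 0 ≤ y → y ≤ x → x ≤ X →
      x ^ (p - 1) - y ^ (p - 1) ≤ (p - 1) * X ^ (p - 2) * (x - y) := by
    intro x y hy hyx hxX
    rcases hy.eq_or_lt with rfl | hy
    · rw [Real.zero_rpow hq.ne', sub_zero, sub_zero]
      rcases hyx.eq_or_lt with rfl | hx
      · simp [Real.zero_rpow hq.ne']
      · rw [show p - 1 = (p - 2) + 1 by ring, Real.rpow_add_one hx.ne']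
        have := Real.rpow_le_rpow hx.le hxX (by linarith : 0 ≤ p - 2)
        have h2 := Real.rpow_nonneg hX (p - 2)
        have : x ^ (p - 2) ≤ (p - 2 + 1) * X ^ (p - 2) := by nlinarith
        exact mul_le_mul_of_nonneg_right this hx.le
    · rcases hyx.eq_or_lt with rfl | hx
      · simp
      · obtain ⟨ξ, hξ, h⟩ := rpow_mvt (q := p - 1) hy hx
        rw [h, show p - 1 - 1 = p - 2 by ring]
        have := Real.rpow_le_rpow (by linarith [hξ.1] : 0 ≤ ξ) (by linarith [hξ.2] : ξ ≤ X)
          (by linarith : 0 ≤ p - 2)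
        gcongr
  have en : ∀ c : ℝ, c ≤ 0 → Jp p c = - (-c) ^ (p - 1) := by
    intro c hc
    rw [← Jp_of_nonneg hp (by linarith : 0 ≤ -c), Jp_neg, neg_neg]
  have hXp : 0 ≤ (p - 1) * X ^ (p - 2) := by positivity
  have z0 : (0:ℝ) ^ (p - 1) = 0 := Real.zero_rpow hq.ne'
  rcases le_total 0 b with hb0 | hb0
  · rw [Jp_of_nonneg hp hb0, Jp_of_nonneg hp (hb0.trans hab)]
    have := key a b hb0 hab ((le_abs_self a).trans ha)
    nlinarith
  · rcases le_total 0 a with ha0 | ha0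
    · rw [en b hb0, Jp_of_nonneg hp ha0]
      have h1 := key a 0 le_rfl ha0 ((le_abs_self a).trans ha)
      have h2 := key (-b) 0 le_rfl (by linarith) ((neg_le_abs b).trans hb)
      rw [z0] at h1 h2
      nlinarith
    · rw [en b hb0, en a ha0]
      have h1 := key (-b) (-a) (by linarith) (by linarith) ((neg_le_abs b).trans hb)
      nlinarith

/-- two-sided control `|b| ≤ |h|/2`. -/
lemma Jp_sym_two_sided {p : ℝ} (hp : 1 < p) {h b : ℝ} (hh : 0 < h) (hb : 0 ≤ b) (hbh : b ≤ h / 2) :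
    2 * (p - 1) * (2:ℝ) ^ (-|p - 2|) * h ^ (p - 2) * b ≤ Jp p (h + b) - Jp p (h - b) ∧
    Jp p (h + b) - Jp p (h - b) ≤ 2 * (p - 1) * (2:ℝ) ^ |p - 2| * h ^ (p - 2) * b := by
  rcases hb.eq_or_lt with rfl | hb
  · simp
  rw [Jp_of_nonneg hp (by linarith), Jp_of_nonneg hp (by linarith : 0 ≤ h - b)]
  obtain ⟨ξ, hξ, he⟩ := rpow_mvt (q := p - 1) (by linarith : 0 < h - b) (by linarith : h - b < h + b)
  have hξ0 : 0 < ξ := by linarith [hξ.1]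
  have h1 : 1 / 2 ≤ ξ / h := by rw [div_le_div_iff₀ (by norm_num) hh]; linarith [hξ.1]
  have h2 : ξ / h ≤ 2 := by rw [div_le_iff₀ hh]; linarith [hξ.2]
  have hr : 0 < ξ / h := by positivity
  have hlog : |Real.log (ξ / h)| ≤ Real.log 2 := by
    rw [abs_le]; constructor
    · rw [← Real.log_inv]; exact Real.log_le_log (by norm_num) (by linarith)
    · exact Real.log_le_log hr h2
  have hl : |(p - 2) * Real.log (ξ / h)| ≤ |p - 2| * Real.log 2 := by
    rw [abs_mul]; gcongr
  have e1 : ξ ^ (p - 2) = (ξ / h) ^ (p - 2) * h ^ (p - 2) := by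
    rw [← Real.mul_rpow hr.le hh.le, div_mul_cancel₀ _ hh.ne']
  have lo : (2:ℝ) ^ (-|p - 2|) ≤ (ξ / h) ^ (p - 2) := by
    rw [Real.rpow_def_of_pos (by norm_num : (0:ℝ) < 2), Real.rpow_def_of_pos hr]
    apply Real.exp_le_exp.2
    have := (abs_le.1 hl).1
    nlinarith
  have hi : (ξ / h) ^ (p - 2) ≤ (2:ℝ) ^ (|p - 2|) := by
    rw [Real.rpow_def_of_pos (by norm_num : (0:ℝ) < 2), Real.rpow_def_of_pos hr]
    apply Real.exp_le_exp.2
    have := (abs_le.1 hl).2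
    nlinarith
  have hhp := Real.rpow_pos_of_pos hh (p - 2)
  rw [he, show p - 1 - 1 = p - 2 by ring, e1, show h + b - (h - b) = 2 * b by ring]
  have hp1 : 0 < p - 1 := by linarith
  constructor
  · calc _ = (p - 1) * ((2:ℝ) ^ (-|p - 2|) * h ^ (p - 2)) * (2 * b) := by ring
      _ ≤ _ := by gcongr
  · calc _ ≤ (p - 1) * ((2:ℝ) ^ (|p - 2|) * h ^ (p - 2)) * (2 * b) := by gcongr
      _ = _ := by ring

/-- upper bound of symmetrized difference: singular case `p ≤ 2` -/
lemma Jp_sym_le_of_le_two {p : ℝ} (hp : 1 < p) (hp2 : p ≤ 2) : ∃ C : ℝ, 0 < C ∧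
    ∀ h b : ℝ, h ≠ 0 → 0 ≤ b → Jp p (h + b) - Jp p (h - b) ≤ C * |h| ^ (p - 2) * b := by
  refine ⟨2 * (p - 1) * (2:ℝ) ^ |p - 2| + 8, by have := sub_pos.2 hp; positivity, ?_⟩
  have hp1 : 0 < p - 1 := by linarith
  have main : ∀ h b : ℝ, 0 < h → 0 ≤ b →
      Jp p (h + b) - Jp p (h - b) ≤ (2 * (p - 1) * (2:ℝ) ^ |p - 2| + 8) * h ^ (p - 2) * b := by
    intro h b hh hb
    have hhp := Real.rpow_pos_of_pos hh (p - 2)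
    rcases le_total b (h / 2) with hc | hc
    · refine (Jp_sym_two_sided hp hh hb hc).2.trans ?_
      gcongr
      linarith
    · have hb0 : 0 < b := by linarith
      refine (Jp_sub_le_of_le_two hp hp2 (by linarith)).trans ?_
      rw [show h + b - (h - b) = 2 * b by ring]
      have e : (2 * b) ^ (p - 1) = (2 * b) ^ (p - 2) * (2 * b) := by
        rw [← Real.rpow_add_one (by positivity)]; congr 1; ring
      have l : (2 * b) ^ (p - 2) ≤ h ^ (p - 2) :=
        Real.rpow_le_rpow_of_nonpos hh (by linarith) (by linarith)
      rw [e]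
      have : 0 ≤ 2 * (p - 1) * (2:ℝ) ^ |p - 2| := by positivity
      calc 2 * ((2 * b) ^ (p - 2) * (2 * b)) ≤ 2 * (h ^ (p - 2) * (2 * b)) := by gcongr
        _ = 4 * h ^ (p - 2) * b := by ring
        _ ≤ _ := by gcongr; linarith
  intro h b hh hb
  rcases lt_or_gt_of_ne hh with hn | hn
  · have := main (-h) b (by linarith) hb
    rw [show -h + b = -(h - b) by ring, show -h - b = -(h + b) by ring, Jp_neg, Jp_neg] at this
    rw [abs_of_neg hn]; linarith
  · rw [abs_of_pos hn]; exact main h b hn hb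

theorem lintegral_scale (N : ℕ) {ρ : ℝ} (hρ : 0 < ρ) (f : Euc N → ℝ≥0∞) :
    ∫⁻ z, f z = ENNReal.ofReal (ρ ^ N) * ∫⁻ z, f (ρ • z) := by
  have h1 := Measure.map_addHaar_smul (volume : Measure (Euc N)) hρ.ne'
  have hemb : MeasurableEmbedding (fun x : Euc N => ρ • x) :=
    (Homeomorph.smulOfNeZero ρ hρ.ne').measurableEmbedding
  have h2 := hemb.lintegral_map (μ := volume) f
  rw [h1, lintegral_smul_measure] at h2
  rw [← h2, finrank_euclideanSpace_fin, smul_eq_mul, ← mul_assoc, ← ENNReal.ofReal_mul (by positivity),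
    abs_of_pos (by positivity), mul_inv_cancel₀ (by positivity), ENNReal.ofReal_one, one_mul]

/-- scaling for homogeneous functions -/
theorem lintegral_homog (N : ℕ) {σ ρ : ℝ} (hρ : 0 < ρ) (f : Euc N → ℝ)
    (hf : ∀ z, f (ρ • z) = ρ ^ (σ - N) * f z) (S1 Sρ : Set (Euc N))
    (hS1 : MeasurableSet S1) (hSρ : MeasurableSet Sρ) (hS : ∀ z, ρ • z ∈ Sρ ↔ z ∈ S1) :
    ∫⁻ z in Sρ, ENNReal.ofReal (f z) =
      ENNReal.ofReal (ρ ^ σ) * ∫⁻ z in S1, ENNReal.ofReal (f z) := by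
  rw [← lintegral_indicator hSρ, ← lintegral_indicator hS1, lintegral_scale N hρ]
  have : ∀ z, Sρ.indicator (fun z => ENNReal.ofReal (f z)) (ρ • z)
      = ENNReal.ofReal (ρ ^ (σ - N)) * S1.indicator (fun z => ENNReal.ofReal (f z)) z := by
    intro z
    by_cases h : z ∈ S1
    · rw [indicator_of_mem h, indicator_of_mem ((hS z).2 h), hf, ENNReal.ofReal_mul (by positivity)]
    · rw [indicator_of_notMem h, indicator_of_notMem (fun h' => h ((hS z).1 h')), mul_zero]
  simp_rw [this]
  rw [lintegral_const_mul' _ _ ENNReal.ofReal_ne_top, ← mul_assoc,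
    ← ENNReal.ofReal_mul (by positivity)]
  congr 2
  rw [← Real.rpow_natCast, ← Real.rpow_add hρ]
  congr 1; ring

/-- B1 -/
theorem tail_power_bound (N : ℕ) (μ : ℝ) (hμ : 0 < μ) :
    ∃ C : ℝ, 0 < C ∧ ∀ ρ : ℝ, 0 < ρ →
      ∫⁻ z in {z : Euc N | ρ ≤ ‖z‖}, ENNReal.ofReal (‖z‖ ^ (-((N : ℝ) + μ)))
        ≤ ENNReal.ofReal (C * ρ ^ (-μ)) := by
  set I1 := ∫⁻ z in {z : Euc N | 1 ≤ ‖z‖}, ENNReal.ofReal (‖z‖ ^ (-((N : ℝ) + μ))) with hI1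
  have hfin : I1 < ⊤ := by
    have hi := integrable_one_add_norm (E := Euc N) (μ := volume) (r := (N : ℝ) + μ) (by
      rw [finrank_euclideanSpace_fin]; linarith)
    have h2 : I1 ≤ ∫⁻ z : Euc N, ENNReal.ofReal (2 ^ ((N : ℝ) + μ)) *
        ENNReal.ofReal ((1 + ‖z‖) ^ (-((N : ℝ) + μ))) := by
      rw [hI1]
      refine (setLIntegral_mono' (measurableSet_le measurable_const measurable_norm) ?_).trans
        (setLIntegral_le_lintegral _ _)
      intro z hz
      have hz : 1 ≤ ‖z‖ := hz
      rw [← ENNReal.ofReal_mul (by positivity)]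
      apply ENNReal.ofReal_le_ofReal
      have : (1 + ‖z‖) ≤ 2 * ‖z‖ := by linarith
      have h3 : (2 * ‖z‖) ^ (-((N : ℝ) + μ)) ≤ (1 + ‖z‖) ^ (-((N : ℝ) + μ)) :=
        Real.rpow_le_rpow_of_nonpos (by positivity) this (by
          have : (0:ℝ) ≤ N := Nat.cast_nonneg N
          linarith)
      rw [Real.mul_rpow (by norm_num) (by positivity)] at h3
      calc ‖z‖ ^ (-((N : ℝ) + μ)) = 2 ^ ((N : ℝ) + μ) * (2 ^ (-((N : ℝ) + μ)) * ‖z‖ ^ (-((N : ℝ) + μ))) := by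
            rw [← mul_assoc, ← Real.rpow_add (by norm_num), add_neg_cancel, Real.rpow_zero, one_mul]
        _ ≤ _ := by gcongr
    refine h2.trans_lt ?_
    rw [lintegral_const_mul' _ _ ENNReal.ofReal_ne_top]
    exact ENNReal.mul_lt_top ENNReal.ofReal_lt_top hi.lintegral_lt_top
  refine ⟨I1.toReal + 1, by positivity, fun ρ hρ => ?_⟩
  rw [lintegral_homog N (σ := -μ) hρ (fun z => ‖z‖ ^ (-((N : ℝ) + μ))) _ {z : Euc N | 1 ≤ ‖z‖} _
    (measurableSet_le measurable_const measurable_norm)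
    (measurableSet_le measurable_const measurable_norm), ← hI1]
  · rw [mul_comm (I1.toReal + 1), ENNReal.ofReal_mul (by positivity)]
    gcongr
    rw [← ENNReal.ofReal_toReal hfin.ne]
    exact ENNReal.ofReal_le_ofReal (by simp)
  · intro z
    simp only [mem_ofPred_eq, norm_smul, Real.norm_eq_abs, abs_of_pos hρ]
    constructor
    · intro h; by_contra h'; push Not at h'; nlinarith
    · intro h; nlinarith
  · intro z
    simp only [norm_smul, Real.norm_eq_abs, abs_of_pos hρ]
    rw [Real.mul_rpow hρ.le (norm_nonneg _)]
    congr 2; ring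

theorem integrable_indicator_rpow {c : ℝ} (hc : c < 1) :
    Integrable (fun x : ℝ => (Icc (-1 : ℝ) 1).indicator (fun x => |x| ^ (-c)) x) := by
  rw [integrable_indicator_iff measurableSet_Icc]
  have hr : IntegrableOn (fun x : ℝ => |x| ^ (-c)) (Ioc 0 1) := by
    have := (intervalIntegral.intervalIntegrable_rpow' (a := 0) (b := 1) (r := -c) (by linarith))
    rw [intervalIntegrable_iff_integrableOn_Ioc_of_le (by norm_num)] at this
    refine this.congr_fun (fun x hx => ?_) measurableSet_Ioc
    simp only [abs_of_pos hx.1]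
  have hl : IntegrableOn (fun x : ℝ => |x| ^ (-c)) (Ico (-1) 0) := by
    have := (hr.comp_neg)
    have h2 : -(Ioc (0:ℝ) 1) = Ico (-1) 0 := by simp
    rw [h2] at this
    simpa using this
  have h0 : IntegrableOn (fun x : ℝ => |x| ^ (-c)) {0} := by
    simp
  refine ((hl.union h0).union hr).mono_set ?_
  intro x hx
  rcases lt_trichotomy x 0 with h | h | h
  · exact Or.inl (Or.inl ⟨hx.1, h⟩)
  · exact Or.inl (Or.inr h)
  · exact Or.inr ⟨h, hx.2⟩

theorem coord_bound (N : ℕ) (i0 : Fin N) (σ β : ℝ) (hσ : 0 < σ) (hβ0 : 0 ≤ β) (hβ : β < 1) :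
    ∫⁻ z in {z : Euc N | ‖z‖ < 1}, ENNReal.ofReal (|z i0| ^ (-β) * ‖z‖ ^ (β + σ - N)) < ⊤ := by
  have hN1 : (1 : ℝ) ≤ N := by
    have := i0.pos
    exact_mod_cast this
  set t : ℝ := max 0 ((N - β - σ) / (N - β)) with ht
  have ht0 : 0 ≤ t := le_max_left _ _
  have ht1 : t < 1 := by
    rw [ht]; apply max_lt (by norm_num)
    rw [div_lt_one (by linarith)]; linarith
  have htN : (N : ℝ) - β - σ ≤ t * (N - β) := by
    have := le_max_right 0 ((N - β - σ) / (N - β))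
    rw [← ht, div_le_iff₀ (by linarith)] at this
    exact this
  set d : Fin N → ℝ := fun i => if i = i0 then t * (1 - β) else t with hd
  set c : Fin N → ℝ := fun i => d i + (if i = i0 then β else 0) with hc
  have hd0 : ∀ i, 0 ≤ d i := by
    intro i; simp only [hd]; split_ifs
    · exact mul_nonneg ht0 (by linarith)
    · exact ht0
  have hc1 : ∀ i, c i < 1 := by
    intro i; simp only [hc, hd]; split_ifs
    · nlinarith
    · linarith
  have hsum : ∑ i, d i = t * (N - β) := by
    have : ∀ i, d i = t - (if i = i0 then t * β else 0) := by
      intro i; simp only [hd]; split_ifs <;> ring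
    simp_rw [this]
    rw [Finset.sum_sub_distrib]
    simp
    ring
  have hIntg : Integrable (fun x : Fin N → ℝ => ∏ i, (Icc (-1 : ℝ) 1).indicator (fun x => |x| ^ (-(c i))) (x i)) := by
    exact Integrable.fintype_prod (fun i => integrable_indicator_rpow (hc1 i))
  have hmp := PiLp.volume_preserving_ofLp (Fin N)
  have hae : ∀ᵐ z : Euc N, ∀ i, z i ≠ 0 := by
    rw [ae_all_iff]
    intro i
    have := Measure.ae_eval_ne (fun _ : Fin N => (volume : Measure ℝ)) i 0
    exact hmp.quasiMeasurePreserving.ae this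
  have hle : ∫⁻ z in {z : Euc N | ‖z‖ < 1}, ENNReal.ofReal (|z i0| ^ (-β) * ‖z‖ ^ (β + σ - N))
      ≤ ∫⁻ z : Euc N, ENNReal.ofReal (∏ i, (Icc (-1 : ℝ) 1).indicator (fun x => |x| ^ (-(c i))) (z i)) := by
    rw [← lintegral_indicator (measurableSet_lt measurable_norm measurable_const)]
    apply lintegral_mono_ae
    filter_upwards [hae] with z hz
    by_cases h1 : ‖z‖ < 1
    · rw [indicator_of_mem (by exact h1)]
      apply ENNReal.ofReal_le_ofReal
      have hzi : ∀ i, |z i| ≤ ‖z‖ := fun i => PiLp.norm_apply_le z i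
      have hz0 : 0 < ‖z‖ := lt_of_lt_of_le (abs_pos.2 (hz i0)) (hzi i0)
      have : ∀ i, (Icc (-1 : ℝ) 1).indicator (fun x => |x| ^ (-(c i))) (z i) = |z i| ^ (-(c i)) := by
        intro i
        rw [indicator_of_mem]
        exact abs_le.1 ((hzi i).trans h1.le)
      simp_rw [this]
      have e1 : ∏ i, |z i| ^ (-(c i)) = |z i0| ^ (-β) * ∏ i, |z i| ^ (-(d i)) := by
        have : ∀ i, |z i| ^ (-(c i)) = (if i = i0 then |z i0| ^ (-β) else 1) * |z i| ^ (-(d i)) := by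
          intro i
          simp only [hc]
          split_ifs with h
          · subst h; rw [← Real.rpow_add (abs_pos.2 (hz i))]; congr 1; ring
          · simp
        simp_rw [this]
        rw [Finset.prod_mul_distrib]
        simp
      rw [e1]
      gcongr
      calc ‖z‖ ^ (β + σ - N) ≤ ‖z‖ ^ (-(∑ i, d i)) := by
            apply Real.rpow_le_rpow_of_exponent_ge hz0 h1.le
            rw [hsum]; linarith
        _ = ∏ i, ‖z‖ ^ (-(d i)) := by
            rw [← Finset.sum_neg_distrib, Real.rpow_sum_of_pos hz0]
        _ ≤ ∏ i, |z i| ^ (-(d i)) := by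
            apply Finset.prod_le_prod
            · intros; positivity
            · intro i _
              exact Real.rpow_le_rpow_of_nonpos (abs_pos.2 (hz i)) (hzi i) (by linarith [hd0 i])
    · rw [indicator_of_notMem (by exact h1)]
      exact zero_le
  refine hle.trans_lt ?_
  have hemb : MeasurableEmbedding (@WithLp.ofLp 2 (Fin N → ℝ)) :=
    (MeasurableEquiv.toLp 2 (Fin N → ℝ)).symm.measurableEmbedding
  rw [hmp.lintegral_comp_emb hemb (fun x : Fin N → ℝ => ENNReal.ofReal (∏ i, (Icc (-1 : ℝ) 1).indicator (fun x => |x| ^ (-(c i))) (x i)))]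
  exact hIntg.lintegral_lt_top

/-- B2 -/
theorem ball_power_bound (N : ℕ) (hN : 1 ≤ N) (σ β : ℝ) (hσ : 0 < σ) (hβ0 : 0 ≤ β) (hβ : β < 1) :
    ∃ C : ℝ, 0 < C ∧ ∀ ρ : ℝ, 0 < ρ → ∀ e : Euc N, ‖e‖ = 1 →
      ∫⁻ z in {z : Euc N | ‖z‖ < ρ},
        ENNReal.ofReal (|inner ℝ e z| ^ (-β) * ‖z‖ ^ (β + σ - N)) ≤ ENNReal.ofReal (C * ρ ^ σ) := by
  set i0 : Fin N := ⟨0, hN⟩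
  set I1 := ∫⁻ z in {z : Euc N | ‖z‖ < 1}, ENNReal.ofReal (|z i0| ^ (-β) * ‖z‖ ^ (β + σ - N)) with hI1
  have hfin : I1 < ⊤ := coord_bound N i0 σ β hσ hβ0 hβ
  refine ⟨I1.toReal + 1, by positivity, fun ρ hρ e he => ?_⟩
  have hm : ∀ r : ℝ, MeasurableSet {z : Euc N | ‖z‖ < r} :=
    fun r => measurableSet_lt measurable_norm measurable_const
  rw [lintegral_homog N (σ := σ) hρ (fun z : Euc N => |inner ℝ e z| ^ (-β) * ‖z‖ ^ (β + σ - N)) _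
    {z : Euc N | ‖z‖ < 1} _ (hm _) (hm _)]
  · have hrot : ∫⁻ z in {z : Euc N | ‖z‖ < 1},
        ENNReal.ofReal (|inner ℝ e z| ^ (-β) * ‖z‖ ^ (β + σ - N)) = I1 := by
      set w : Euc N := EuclideanSpace.single i0 1 with hw
      have hwn : ‖e‖ = ‖w‖ := by rw [he, hw]; simp
      set R := (ℝ ∙ (e - w))ᗮ.reflection
      have hR : R e = w := Submodule.reflection_sub hwn
      have hmp := R.measurePreserving
      have hemb : MeasurableEmbedding R := R.toHomeomorph.measurableEmbedding
      rw [hI1, ← lintegral_indicator (hm 1), ← lintegral_indicator (hm 1)]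
      symm
      rw [← hmp.lintegral_comp_emb hemb]
      symm
      apply lintegral_congr
      intro z
      have hin : inner ℝ e z = (R z) i0 := by
        rw [← R.inner_map_map e z, hR, hw, EuclideanSpace.inner_single_left]
        simp
      have hnm : ‖R z‖ = ‖z‖ := R.norm_map z
      by_cases h : ‖z‖ < 1
      · rw [indicator_of_mem (by exact h), indicator_of_mem (by simpa [hnm] using h), hin, hnm]
      · rw [indicator_of_notMem (by exact h), indicator_of_notMem (by simpa [hnm] using h)]
    rw [hrot, mul_comm (I1.toReal + 1), ENNReal.ofReal_mul (by positivity)]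
    gcongr
    rw [← ENNReal.ofReal_toReal hfin.ne]
    exact ENNReal.ofReal_le_ofReal (by simp)
  · intro z
    simp only [mem_ofPred_eq, norm_smul, Real.norm_eq_abs, abs_of_pos hρ]
    constructor
    · intro h; by_contra h'; push Not at h'; nlinarith
    · intro h; nlinarith
  · intro z
    simp only [norm_smul, Real.norm_eq_abs, abs_of_pos hρ, inner_smul_right, abs_mul]
    rw [Real.mul_rpow hρ.le (norm_nonneg _), Real.mul_rpow hρ.le (abs_nonneg _)]
    have : ρ ^ (σ - N) = ρ ^ (-β) * ρ ^ (β + σ - N) := by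
      rw [← Real.rpow_add hρ]; congr 1; ring
    rw [this]; ring

theorem one_add_rpow_le_quad {γ s : ℝ} (h0 : 0 < γ) (h1 : γ < 1) (hs : |s| ≤ 1 / 2) :
    (1 + s) ^ γ ≤ 1 + γ * s - γ * (1 - γ) / 8 * s ^ 2 := by
  set f : ℝ → ℝ := fun s => 1 + γ * s - γ * (1 - γ) / 8 * s ^ 2 - (1 + s) ^ γ with hf
  have hder : ∀ x : ℝ, -1 < x → HasDerivAt f (γ - γ * (1 - γ) / 4 * x - γ * (1 + x) ^ (γ - 1)) x := by
    intro x hx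
    have hx' : 1 + x ≠ 0 := by linarith
    have a1 : HasDerivAt (fun s : ℝ => (1 + s) ^ γ) (γ * (1 + x) ^ (γ - 1)) x := by
      have := ((hasDerivAt_id x).const_add 1).rpow_const (p := γ) (Or.inl hx')
      simpa using this
    have a2 : HasDerivAt (fun s : ℝ => 1 + γ * s - γ * (1 - γ) / 8 * s ^ 2) (γ - γ * (1 - γ) / 4 * x) x := by
      have b1 := ((hasDerivAt_id x).const_mul γ).const_add 1
      have b2 := ((hasDerivAt_id x).pow 2).const_mul (γ * (1 - γ) / 8)
      have := b1.sub b2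
      refine this.congr_deriv ?_
      simp
      ring
    exact a2.sub a1
  have hf0 : f 0 = 0 := by simp [hf]
  have key : 0 ≤ f s := by
    obtain ⟨hs1, hs2⟩ := abs_le.1 hs
    rcases le_total 0 s with h | h
    · have hmono : MonotoneOn f (Icc 0 (1/2)) := by
        apply monotoneOn_of_deriv_nonneg (convex_Icc _ _)
        · intro x hx; exact (hder x (by linarith [hx.1])).continuousAt.continuousWithinAt
        · intro x hx
          rw [interior_Icc] at hx
          exact (hder x (by linarith [hx.1])).differentiableAt.differentiableWithinAt
        · intro x hx
          rw [interior_Icc] at hx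
          rw [(hder x (by linarith [hx.1])).deriv]
          have hx0 := hx.1
          have hx2 := hx.2
          have hb : (1 + x) ^ (γ - 1) ≤ 1 - (1 - γ) * x / 4 := by
            have e : (1 + x) ^ (γ - 1) = (1 + (-(x / (1 + x)))) ^ (1 - γ) := by
              have : 1 + (-(x / (1 + x))) = (1 + x)⁻¹ := by field_simp; ring
              rw [this, Real.inv_rpow (by linarith), ← Real.rpow_neg (by linarith)]
              congr 1; ring
            rw [e]
            have hxx : x / (1 + x) ≤ 1 := by rw [div_le_one (by linarith)]; linarith
            refine (rpow_one_add_le_one_add_mul_self (by linarith) (by linarith) (by linarith)).trans ?_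
            have : x / 4 ≤ x / (1 + x) := by
              apply div_le_div_of_nonneg_left hx0.le (by linarith) (by linarith)
            nlinarith
          nlinarith
      have := hmono (by simp : (0:ℝ) ∈ Icc 0 (1/2)) ⟨h, hs2⟩ h
      linarith
    · have hmono : AntitoneOn f (Icc (-1/2) 0) := by
        apply antitoneOn_of_deriv_nonpos (convex_Icc _ _)
        · intro x hx; exact (hder x (by linarith [hx.1])).continuousAt.continuousWithinAt
        · intro x hx
          rw [interior_Icc] at hx
          exact (hder x (by linarith [hx.1])).differentiableAt.differentiableWithinAt
        · intro x hx
          rw [interior_Icc] at hx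
          rw [(hder x (by linarith [hx.1])).deriv]
          have hx0 := hx.1
          have hx2 := hx.2
          have hb : 1 - (1 - γ) * x / 4 ≤ (1 + x) ^ (γ - 1) := by
            have e : 1 - (1-γ) * x ≤ (1 + x) ^ (γ - 1) := by
              have h3 := rpow_one_add_le_one_add_mul_self (s := x) (p := 1 - γ) (by linarith) (by linarith) (by linarith)
              have h4 : 0 < (1 + x) ^ (1 - γ) := Real.rpow_pos_of_pos (by linarith) _
              have h5 : (1 + x) ^ (γ - 1) = ((1 + x) ^ (1 - γ))⁻¹ := by
                rw [← Real.rpow_neg (by linarith)]; congr 1; ring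
              rw [h5, le_inv_comm₀ (by nlinarith) h4]
              refine h3.trans ?_
              rw [le_inv_comm₀ (by nlinarith) (by nlinarith), le_inv_comm₀ (by nlinarith) (by nlinarith)]
              rw [← one_div, le_div_iff₀ (by nlinarith)]
              nlinarith [sq_nonneg ((1-γ)*x)]
            nlinarith
          nlinarith
      have := hmono (show s ∈ Icc (-1/2) 0 from ⟨by linarith, h⟩) (by norm_num) h
      linarith
  have := key
  simp only [hf] at this
  linarith

theorem integral_le_of_lintegral_ofReal {α : Type*} [MeasurableSpace α] {μ : Measure α} {f : α → ℝ}
    {c : ℝ} (hc : 0 ≤ c) (h : ∫⁻ x, ENNReal.ofReal (f x) ∂μ ≤ ENNReal.ofReal c) :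
    ∫ x, f x ∂μ ≤ c := by
  by_cases hi : Integrable f μ
  · rw [integral_eq_lintegral_pos_part_sub_lintegral_neg_part hi]
    have h1 : (∫⁻ x, ENNReal.ofReal (f x) ∂μ).toReal ≤ c := ENNReal.toReal_le_of_le_ofReal hc h
    have h2 : 0 ≤ (∫⁻ x, ENNReal.ofReal (-f x) ∂μ).toReal := ENNReal.toReal_nonneg
    linarith
  · rw [integral_undef hi]; exact hc

theorem setIntegral_neg_sym {N : ℕ} (D : Set (Euc N)) (hD : ∀ z, -z ∈ D ↔ z ∈ D) (g : Euc N → ℝ) :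
    ∫ z in D, g (-z) = ∫ z in D, g z := by
  have h := (Measure.measurePreserving_neg (volume : Measure (Euc N))).setIntegral_preimage_emb
    (MeasurableEquiv.neg (Euc N)).measurableEmbedding g D
  have e : (fun x : Euc N => -x) ⁻¹' D = D := by ext z; simp [hD]
  have e' : Neg.neg ⁻¹' D = D := e
  rw [← h, e']

theorem setIntegrable_neg_sym {N : ℕ} (D : Set (Euc N)) (hD : ∀ z, -z ∈ D ↔ z ∈ D) (g : Euc N → ℝ)
    (hg : IntegrableOn g D) : IntegrableOn (fun z => g (-z)) D := by
  have h := (Measure.measurePreserving_neg (volume : Measure (Euc N))).integrableOn_comp_preimage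
    (MeasurableEquiv.neg (Euc N)).measurableEmbedding (f := g) (s := D)
  have e' : Neg.neg ⁻¹' D = D := by ext z; simp [hD]
  rw [e'] at h
  exact h.2 hg

theorem ae_inner_ne_zero {N : ℕ} (q : Euc N) (hq : q ≠ 0) : ∀ᵐ z : Euc N, inner ℝ q z ≠ 0 := by
  have h := Measure.addHaar_submodule (volume : Measure (Euc N)) (ℝ ∙ q)ᗮ (by
    intro h
    have : q ∈ (ℝ ∙ q)ᗮ := by rw [h]; trivial
    rw [Submodule.mem_orthogonal_singleton_iff_inner_right] at this
    exact hq (inner_self_eq_zero.1 this))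
  rw [ae_iff]
  convert h using 2
  ext z
  simp [Submodule.mem_orthogonal_singleton_iff_inner_right]

/-- the annulus -/
def ann (N : ℕ) (a b : ℝ) : Set (Euc N) := {z | a ≤ ‖z‖ ∧ ‖z‖ < b}

theorem ann_meas (N : ℕ) (a b : ℝ) : MeasurableSet (ann N a b) :=
  (measurableSet_le measurable_const measurable_norm).inter
    (measurableSet_lt measurable_norm measurable_const)

theorem ann_neg (N : ℕ) (a b : ℝ) (z : Euc N) : -z ∈ ann N a b ↔ z ∈ ann N a b := by
  simp [ann]

theorem IsKernel.bdd {N : ℕ} {p s lam Lam : ℝ} {K : Euc N → ℝ} (hK : IsKernel N p s lam Lam K)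
    (hsp : 0 ≤ s * p) (hL : 0 ≤ Lam) {θ : ℝ} (hθ : 0 < θ) {z : Euc N} (hz : θ ≤ ‖z‖) :
    0 ≤ K z ∧ K z ≤ Lam * θ ^ (-((N : ℝ) + s * p)) := by
  have hz0 : z ≠ 0 := by rintro rfl; simp at hz; linarith
  refine ⟨(hK.2.1 z hz0).le, (hK.2.2.2 z hz0).2.trans ?_⟩
  gcongr ?_ * ?_
  apply Real.rpow_le_rpow_of_nonpos hθ hz
  have : (0:ℝ) ≤ N := Nat.cast_nonneg N
  linarith

theorem ann_finite (N : ℕ) (a b : ℝ) : volume (ann N a b) < ⊤ := by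
  refine (measure_mono ?_).trans_lt (measure_ball_lt_top (x := (0 : Euc N)) (r := b))
  intro z hz
  simpa using hz.2

/-- bounded measurable times the kernel is integrable on an annulus -/
theorem integrableOn_ann {N : ℕ} {p s lam Lam : ℝ} {K : Euc N → ℝ} (hK : IsKernel N p s lam Lam K)
    (hsp : 0 ≤ s * p) (hL : 0 ≤ Lam) {θ b : ℝ} (hθ : 0 < θ) {f : Euc N → ℝ} (hf : Measurable f)
    {C : ℝ} (hC : ∀ z ∈ ann N θ b, |f z| ≤ C) : IntegrableOn (fun z => f z * K z) (ann N θ b) := by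
  apply Measure.integrableOn_of_bounded (ann_finite N θ b).ne ((hf.mul hK.1).aestronglyMeasurable)
    (M := C * (Lam * θ ^ (-((N : ℝ) + s * p))))
  filter_upwards [ae_restrict_mem (ann_meas N θ b)] with z hz
  obtain ⟨h1, h2⟩ := hK.bdd hsp hL hθ hz.1
  rw [Real.norm_eq_abs, Pi.mul_apply, abs_mul, abs_of_nonneg h1]
  exact mul_le_mul (hC z hz) h2 h1 ((abs_nonneg _).trans (hC z hz))

theorem Jp_sym_pointwise (N : ℕ) {p : ℝ} (hp : 1 < p) :
    ∃ C : ℝ, 0 < C ∧ ∀ (q z : Euc N) (b : ℝ), q ≠ 0 → 0 ≤ b → b * ‖z‖ ≤ ‖q‖ → inner ℝ q z ≠ 0 →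
      Jp p (inner ℝ q z + b * ‖z‖ ^ 2) - Jp p (inner ℝ q z - b * ‖z‖ ^ 2) ≤
        C * ‖q‖ ^ (p - 2) * b *
          (|inner ℝ (‖q‖⁻¹ • q) z| ^ (-(max (2 - p) 0)) * ‖z‖ ^ (max (2 - p) 0 + p)) := by
  rcases le_total p 2 with h2 | h2
  · obtain ⟨C, hC, hb⟩ := Jp_sym_le_of_le_two hp h2
    refine ⟨C, hC, fun q z b hq hb0 _ hne => ?_⟩
    refine (hb _ _ hne (by positivity)).trans (le_of_eq ?_)
    have hqn : 0 < ‖q‖ := norm_pos_iff.2 hq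
    have hm : max (2 - p) 0 = 2 - p := max_eq_left (by linarith)
    rw [hm]
    have e1 : (2 - p + p : ℝ) = (2 : ℕ) := by norm_num
    rw [e1, Real.rpow_natCast]
    have e2 : inner ℝ q z = ‖q‖ * inner ℝ (‖q‖⁻¹ • q) z := by
      rw [real_inner_smul_left]; field_simp
    have e3 : |inner ℝ q z| ^ (p - 2) = ‖q‖ ^ (p - 2) * |inner ℝ (‖q‖⁻¹ • q) z| ^ (-(2 - p)) := by
      rw [e2, abs_mul, abs_of_pos hqn, Real.mul_rpow hqn.le (abs_nonneg _)]
      congr 2; ring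
    rw [e3]; ring
  · refine ⟨2 * (p - 1) * 2 ^ (p - 2) * 2, by
      have : 0 < p - 1 := by linarith
      positivity, fun q z b hq hb0 hbz hne => ?_⟩
    have hqn : 0 < ‖q‖ := norm_pos_iff.2 hq
    have hm : max (2 - p) 0 = 0 := max_eq_right (by linarith)
    rw [hm]
    simp only [neg_zero, Real.rpow_zero, zero_add, one_mul]
    have hin : |inner ℝ q z| ≤ ‖q‖ * ‖z‖ := abs_real_inner_le_norm q z
    have hbb : b * ‖z‖ ^ 2 ≤ ‖q‖ * ‖z‖ := by
      have := mul_le_mul_of_nonneg_right hbz (norm_nonneg z)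
      nlinarith
    have hb1 : 0 ≤ b * ‖z‖ ^ 2 := by positivity
    obtain ⟨h3, h4⟩ := abs_le.1 hin
    refine (Jp_sub_le_of_two_le h2 (X := 2 * (‖q‖ * ‖z‖)) (by linarith)
      (abs_le.2 ⟨by linarith, by linarith⟩) (abs_le.2 ⟨by linarith, by linarith⟩)).trans (le_of_eq ?_)
    have hz : 0 < ‖z‖ := by
      rcases eq_or_ne z 0 with rfl | h
      · simp at hne
      · exact norm_pos_iff.2 h
    rw [Real.mul_rpow (by norm_num) (by positivity), Real.mul_rpow hqn.le hz.le]
    have e : ‖z‖ ^ p = ‖z‖ ^ (p - 2) * ‖z‖ ^ 2 := by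
      rw [← Real.rpow_natCast, ← Real.rpow_add hz]; norm_num
    rw [e]; ring

theorem tiny_bound (N : ℕ) (hN : 1 ≤ N) {p s lam Lam : ℝ} (hp : 1 < p) (hs : s ∈ Ioo (0:ℝ) 1)
    (hLam : 0 < Lam) :
    ∃ C : ℝ, 0 < C ∧ ∀ (K : Euc N → ℝ), IsKernel N p s lam Lam K →
      ∀ (ψ : Euc N → ℝ) (x q : Euc N) (b θ₀ : ℝ), Continuous ψ → q ≠ 0 → 0 ≤ b → 0 < θ₀ →
        b * θ₀ ≤ ‖q‖ →
        (∀ z, ‖z‖ < θ₀ → ψ (x + z) - ψ x ≤ inner ℝ q z + b * ‖z‖ ^ 2) →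
        ∀ θ, 0 < θ →
          -(C * ‖q‖ ^ (p - 2) * b * θ₀ ^ (p - s * p)) ≤
            ∫ z in ann N θ θ₀, Jp p (ψ x - ψ (x + z)) * K z := by
  obtain ⟨C1, hC1, hpt⟩ := Jp_sym_pointwise N hp
  set β := max (2 - p) 0 with hβ
  have hsp : 0 < p - s * p := by nlinarith [hs.2]
  have hsp0 : 0 ≤ s * p := by nlinarith [hs.1]
  obtain ⟨C2, hC2, hB⟩ := ball_power_bound N hN (p - s * p) β hsp (le_max_right _ _)
    (max_lt (by linarith) (by norm_num))
  refine ⟨C1 * C2 * Lam, by positivity, ?_⟩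
  intro K hK ψ x q b θ₀ hψ hq hb hθ0 hbθ hinc θ hθ
  set D := ann N θ θ₀ with hD
  have hDm : MeasurableSet D := ann_meas N θ θ₀
  set g1 : Euc N → ℝ := fun z => Jp p (-(inner ℝ q z + b * ‖z‖ ^ 2)) * K z with hg1
  have hqn : 0 < ‖q‖ := norm_pos_iff.2 hq
  have hg1i : IntegrableOn g1 D := by
    refine integrableOn_ann hK hsp0 hLam.le hθ (C := (‖q‖ * θ₀ + b * θ₀ ^ 2) ^ (p - 1)) ?_ ?_
    · apply (Jp_measurable p).comp
      fun_prop
    · intro z hz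
      rw [Jp_abs hp, abs_neg]
      apply Real.rpow_le_rpow (abs_nonneg _) _ (by linarith)
      refine (abs_add_le _ _).trans ?_
      have h1 := abs_real_inner_le_norm q z
      have h2 : ‖z‖ ≤ θ₀ := hz.2.le
      rw [abs_of_nonneg (by positivity : 0 ≤ b * ‖z‖ ^ 2)]
      have h3 : ‖q‖ * ‖z‖ ≤ ‖q‖ * θ₀ := by gcongr
      have h4 : b * ‖z‖ ^ 2 ≤ b * θ₀ ^ 2 := by gcongr
      linarith
  have hfi : IntegrableOn (fun z => Jp p (ψ x - ψ (x + z)) * K z) D := by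
    have hc : Continuous fun z => ψ x - ψ (x + z) := by fun_prop
    obtain ⟨B, hB'⟩ := (isCompact_closedBall (0 : Euc N) θ₀).exists_bound_of_continuousOn hc.continuousOn
    refine integrableOn_ann hK hsp0 hLam.le hθ (C := B ^ (p - 1)) ?_ ?_
    · exact (Jp_measurable p).comp hc.measurable
    · intro z hz
      rw [Jp_abs hp]
      apply Real.rpow_le_rpow (abs_nonneg _) _ (by linarith)
      exact hB' z (by simpa using hz.2.le)
  have hmono : ∫ z in D, g1 z ≤ ∫ z in D, Jp p (ψ x - ψ (x + z)) * K z := by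
    apply setIntegral_mono_on hg1i hfi hDm
    intro z hz
    have := (hK.bdd hsp0 hLam.le hθ hz.1).1
    apply mul_le_mul_of_nonneg_right _ this
    apply Jp_mono hp
    have := hinc z hz.2
    linarith
  refine le_trans ?_ hmono
  have hsym := setIntegral_neg_sym D (ann_neg N θ θ₀) g1
  have hg1n := setIntegrable_neg_sym D (ann_neg N θ θ₀) g1 hg1i
  have hsum : 2 * ∫ z in D, g1 z = - ∫ z in D, -(g1 z + g1 (-z)) := by
    rw [integral_neg, integral_add hg1i hg1n, hsym]; ring
  have hup : ∫ z in D, -(g1 z + g1 (-z)) ≤ C1 * C2 * Lam * ‖q‖ ^ (p - 2) * b * θ₀ ^ (p - s * p) := by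
    apply integral_le_of_lintegral_ofReal (by positivity)
    have hun : ‖‖q‖⁻¹ • q‖ = 1 := by
      rw [norm_smul, norm_inv, norm_norm, inv_mul_cancel₀ hqn.ne']
    have h1 : ∫⁻ z in D, ENNReal.ofReal (-(g1 z + g1 (-z))) ≤
        ∫⁻ z in {z : Euc N | ‖z‖ < θ₀}, ENNReal.ofReal (C1 * ‖q‖ ^ (p - 2) * b * Lam) *
          ENNReal.ofReal (|inner ℝ (‖q‖⁻¹ • q) z| ^ (-β) * ‖z‖ ^ (β + (p - s * p) - N)) := by
      refine (lintegral_mono_ae ?_).trans (lintegral_mono_set (fun z hz => hz.2))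
      filter_upwards [ae_restrict_mem hDm, ae_restrict_of_ae (ae_inner_ne_zero q hq)] with z hz hne
      rw [← ENNReal.ofReal_mul (by positivity)]
      apply ENNReal.ofReal_le_ofReal
      have hz1 : θ ≤ ‖z‖ := hz.1
      have hz2 : ‖z‖ < θ₀ := hz.2
      have hzp : 0 < ‖z‖ := by linarith
      have hz0 : z ≠ 0 := norm_pos_iff.1 hzp
      have hKn : K (-z) = K z := hK.2.2.1 z hz0
      have hKp : 0 ≤ K z := (hK.2.1 z hz0).le
      have hKu := (hK.2.2.2 z hz0).2
      have e : -(g1 z + g1 (-z)) = (Jp p (inner ℝ q z + b * ‖z‖ ^ 2) - Jp p (inner ℝ q z - b * ‖z‖ ^ 2)) * K z := by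
        simp only [hg1, hKn, inner_neg_right, norm_neg]
        rw [Jp_neg]
        have : -(-inner ℝ q z + b * ‖z‖ ^ 2) = inner ℝ q z - b * ‖z‖ ^ 2 := by ring
        rw [this]; ring
      rw [e]
      have h3 := hpt q z b hq hb (by nlinarith) hne
      calc _ ≤ (C1 * ‖q‖ ^ (p - 2) * b *
          (|inner ℝ (‖q‖⁻¹ • q) z| ^ (-β) * ‖z‖ ^ (β + p))) * (Lam * ‖z‖ ^ (-((N : ℝ) + s * p))) := by
            apply mul_le_mul h3 hKu hKp (by positivity)
        _ = _ := by
            have : ‖z‖ ^ (β + (p - s * p) - N) = ‖z‖ ^ (β + p) * ‖z‖ ^ (-((N : ℝ) + s * p)) := by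
              rw [← Real.rpow_add hzp]; congr 1; ring
            rw [this]; ring
    refine h1.trans ?_
    rw [lintegral_const_mul' _ _ ENNReal.ofReal_ne_top]
    refine (mul_le_mul_right (hB θ₀ hθ0 _ hun) _).trans (le_of_eq ?_)
    rw [← ENNReal.ofReal_mul (by positivity)]
    congr 1; ring
  have hpos : 0 ≤ C1 * C2 * Lam * ‖q‖ ^ (p - 2) * b * θ₀ ^ (p - s * p) := by positivity
  linarith

set_option maxHeartbeats 1000000 in
theorem profile_inc {N : ℕ} {γ L : ℝ} (h0 : 0 < γ) (h1 : γ < 1) (hL : 0 ≤ L) (a z : Euc N) (ha : a ≠ 0)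
    (ε : ℝ) (hε : ε = 1 ∨ ε = -1)
    (hz : ‖z - (1 / 4 : ℝ) • a‖ ≤ (1 - γ) / 2048 * ‖a‖) :
    L * ‖a + ε • z‖ ^ γ - L * ‖a‖ ^ γ ≤ ε * (γ * (L * ‖a‖ ^ γ) * (inner ℝ a z / ‖a‖ ^ 2))
      - γ * (1 - γ) / 1024 * (L * ‖a‖ ^ γ) := by
  set A := ‖a‖ with hA
  have hA0 : 0 < A := norm_pos_iff.2 ha
  set ζ := z - (1 / 4 : ℝ) • a with hζ
  set n := ‖ζ‖ with hn
  have hn0 : 0 ≤ n := norm_nonneg _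
  have hzz : z = (1 / 4 : ℝ) • a + ζ := by rw [hζ]; abel
  have hinner : inner ℝ a z = A ^ 2 / 4 + inner ℝ a ζ := by
    rw [hzz, inner_add_right, real_inner_smul_right, real_inner_self_eq_norm_sq]; ring
  have hiζ : |inner ℝ a ζ| ≤ A * n := abs_real_inner_le_norm a ζ
  have hεabs : |ε| = 1 := by rcases hε with h | h <;> simp [h]
  set r := n / A with hr
  have hr0 : 0 ≤ r := by positivity
  have hr1 : r ≤ (1 - γ) / 2048 := by rw [hr, div_le_iff₀ hA0]; exact hz
  set s := ε / 4 + r with hs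
  have hnorm : ‖a + ε • z‖ ≤ A * (1 + s) := by
    have : a + ε • z = (1 + ε / 4) • a + ε • ζ := by
      rw [hzz, smul_add, smul_smul, add_smul, one_smul, ← add_assoc]; congr 3; ring
    rw [this]
    refine (norm_add_le _ _).trans ?_
    rw [norm_smul, norm_smul, Real.norm_eq_abs, Real.norm_eq_abs, hεabs,
      abs_of_nonneg (by rcases hε with h | h <;> rw [h] <;> norm_num)]
    have : n = A * r := by rw [hr]; field_simp
    rw [← hA, ← hn, this, hs]; apply le_of_eq; ring
  have hsab : |s| ≤ 1 / 2 := by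
    rw [abs_le, hs]
    rcases hε with h | h <;> rw [h] <;> constructor <;> linarith
  have hss : 1 / 64 ≤ s ^ 2 := by
    rcases hε with h | h
    · have : 1 / 4 ≤ s := by rw [hs, h]; linarith
      nlinarith
    · have : s ≤ -(1 / 8) := by rw [hs, h]; linarith
      nlinarith
  have hquad := one_add_rpow_le_quad h0 h1 hsab
  have hpow : ‖a + ε • z‖ ^ γ ≤ A ^ γ * (1 + γ * s - γ * (1 - γ) / 8 * s ^ 2) := by
    refine (Real.rpow_le_rpow (norm_nonneg _) hnorm h0.le).trans ?_
    rw [Real.mul_rpow hA0.le (by linarith [(abs_le.1 hsab).1])]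
    gcongr
  have hT : 0 ≤ L * A ^ γ := by positivity
  have hcoef : γ * s - γ * (1 - γ) / 8 * s ^ 2 ≤ ε * (γ * (inner ℝ a z / A ^ 2)) - γ * (1 - γ) / 1024 := by
    have e1 : ε * (γ * (inner ℝ a z / A ^ 2)) = γ * (ε / 4 + ε * (inner ℝ a ζ / A ^ 2)) := by
      rw [hinner]; field_simp
    have e2 : |ε * (inner ℝ a ζ / A ^ 2)| ≤ r := by
      rw [abs_mul, hεabs, one_mul, abs_div, abs_of_pos (by positivity : 0 < A ^ 2), hr,
        div_le_div_iff₀ (by positivity) hA0]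
      nlinarith
    have e3 := (abs_le.1 e2).1
    rw [e1]
    have e4 : γ * s ≤ γ * (ε / 4 + ε * (inner ℝ a ζ / A ^ 2)) + 2 * γ * r := by
      have := mul_le_mul_of_nonneg_left e3 h0.le
      rw [hs, mul_add, mul_add]; linarith
    have e5 : 2 * γ * r ≤ γ * (1 - γ) / 1024 := by
      have := mul_le_mul_of_nonneg_left hr1 (by linarith : 0 ≤ 2 * γ)
      linarith
    have e6 : γ * (1 - γ) / 512 ≤ γ * (1 - γ) / 8 * s ^ 2 := by
      have h7 : 0 < γ * (1 - γ) := mul_pos h0 (by linarith)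
      have := mul_le_mul_of_nonneg_left hss (by linarith : 0 ≤ γ * (1 - γ) / 8)
      linarith
    linarith
  calc L * ‖a + ε • z‖ ^ γ - L * A ^ γ ≤ L * (A ^ γ * (1 + γ * s - γ * (1 - γ) / 8 * s ^ 2)) - L * A ^ γ := by gcongr
    _ = (L * A ^ γ) * (γ * s - γ * (1 - γ) / 8 * s ^ 2) := by ring
    _ ≤ (L * A ^ γ) * (ε * (γ * (inner ℝ a z / A ^ 2)) - γ * (1 - γ) / 1024) := by gcongr
    _ = _ := by ring

set_option maxHeartbeats 1000000 in
theorem pair_gain {N : ℕ} {p γ : ℝ} (hp : 1 < p) (h0 : 0 < γ) (h1 : γ < 1) :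
    ∃ c : ℝ, 0 < c ∧ ∀ M M1 : ℝ, 0 ≤ M → 0 ≤ M1 → ∃ L0 : ℝ, 0 < L0 ∧ ∀ L, L0 ≤ L →
      ∀ a e0 z : Euc N, a ≠ 0 → ‖a‖ ≤ 1 → ‖e0‖ ≤ M1 →
        ‖z - (1 / 4 : ℝ) • a‖ ≤ (1 - γ) / 2048 * ‖a‖ →
        ∀ j1 j2 : ℝ,
        Jp p (-(L * ‖a + z‖ ^ γ - L * ‖a‖ ^ γ + inner ℝ e0 z + M * ‖z‖ ^ 2)) ≤ j1 →
        Jp p (-(L * ‖a - z‖ ^ γ - L * ‖a‖ ^ γ - inner ℝ e0 z + M * ‖z‖ ^ 2)) ≤ j2 →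
        c * (L * ‖a‖ ^ γ) ^ (p - 1) ≤ j1 + j2 := by
  set c3 := γ * (1 - γ) / 1024 with hc3
  have hc3p : 0 < c3 := by have := mul_pos h0 (by linarith : 0 < 1 - γ); positivity
  set k := min ((γ / 16) ^ (p - 2)) ((γ / 2) ^ (p - 2)) with hk
  have hkp : 0 < k := lt_min (by positivity) (by positivity)
  have hp1 : 0 < p - 1 := by linarith
  refine ⟨2 * (p - 1) * 2 ^ (-|p - 2|) * k * (c3 / 2), by positivity, ?_⟩
  intro M M1 hM hM1
  refine ⟨max 1 (max (8 * M1 / γ) (2 * M / c3)), by positivity, ?_⟩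
  intro L hL a e0 z ha ha1 he0 hz j1 j2 hj1 hj2
  have hL1 : 1 ≤ L := (le_max_left _ _).trans hL
  have hL2 : 8 * M1 / γ ≤ L := ((le_max_left _ _).trans (le_max_right _ _)).trans hL
  have hL3 : 2 * M / c3 ≤ L := ((le_max_right _ _).trans (le_max_right _ _)).trans hL
  rw [div_le_iff₀ h0] at hL2
  rw [div_le_iff₀ hc3p] at hL3
  have i1 := profile_inc h0 h1 (by linarith : 0 ≤ L) a z ha 1 (Or.inl rfl) hz
  have i2 := profile_inc h0 h1 (by linarith : 0 ≤ L) a z ha (-1) (Or.inr rfl) hz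
  rw [one_smul, one_mul] at i1
  rw [neg_one_smul, ← sub_eq_add_neg] at i2
  set A := ‖a‖ with hA
  have hA0 : 0 < A := norm_pos_iff.2 ha
  set P := A ^ γ with hP
  have hP0 : 0 < P := by positivity
  have hAP : A ≤ P := by
    have := Real.rpow_le_rpow_of_exponent_ge hA0 ha1 h1.le
    rwa [Real.rpow_one] at this
  set T := L * P with hT
  have hTp : 0 < T := by positivity
  have hzn : ‖z‖ ≤ A / 2 := by
    have : z = (z - (1 / 4 : ℝ) • a) + (1 / 4 : ℝ) • a := by abel
    rw [this]
    refine (norm_add_le _ _).trans ?_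
    rw [norm_smul]
    norm_num
    rw [← hA]
    nlinarith
  have hq : |inner ℝ a z / A ^ 2 - 1 / 4| ≤ 1 / 8 := by
    have : inner ℝ a z / A ^ 2 - 1 / 4 = inner ℝ a (z - (1 / 4 : ℝ) • a) / A ^ 2 := by
      rw [inner_sub_right, real_inner_smul_right, real_inner_self_eq_norm_sq]; rw [← hA]; field_simp
    rw [this, abs_div, abs_of_pos (by positivity : 0 < A ^ 2), div_le_iff₀ (by positivity)]
    refine (abs_real_inner_le_norm _ _).trans ?_
    rw [← hA]
    have := mul_le_mul_of_nonneg_left hz hA0.le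
    nlinarith [mul_pos hA0 hA0]
  obtain ⟨hq1, hq2⟩ := abs_le.1 hq
  have he : |inner ℝ e0 z| ≤ γ * T / 16 := by
    refine (abs_real_inner_le_norm _ _).trans ?_
    have h3 : ‖e0‖ * ‖z‖ ≤ M1 * (P / 2) := by
      apply mul_le_mul he0 (by linarith) (norm_nonneg _) hM1
    have h4 : M1 * (P / 2) ≤ γ * T / 16 := by
      have := mul_le_mul_of_nonneg_right hL2 hP0.le
      rw [hT]; linarith
    linarith
  obtain ⟨he1, he2⟩ := abs_le.1 he
  set Q := inner ℝ a z / A ^ 2 with hQ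
  set h := γ * T * Q + inner ℝ e0 z with hh
  have hγT : 0 < γ * T := by positivity
  have hQ1 := mul_le_mul_of_nonneg_left hq1 hγT.le
  have hQ2 := mul_le_mul_of_nonneg_left hq2 hγT.le
  have hlo : γ * T / 16 ≤ h := by rw [hh]; linarith
  have hhi : h ≤ γ * T / 2 := by rw [hh]; linarith
  have hhp : 0 < h := by linarith
  have hMz : M * ‖z‖ ^ 2 ≤ c3 / 2 * T := by
    have : ‖z‖ ^ 2 ≤ P := by nlinarith [norm_nonneg z]
    have h5 : M * ‖z‖ ^ 2 ≤ M * P := by gcongr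
    have h6 : M * P ≤ c3 / 2 * T := by
      have := mul_le_mul_of_nonneg_right hL3 hP0.le
      rw [hT]; linarith
    linarith
  set b := c3 / 2 * T with hb
  have hbp : 0 < b := by positivity
  have hbh : b ≤ h / 2 := by
    have h8 : c3 ≤ γ / 1024 := by rw [hc3]; nlinarith
    have := mul_le_mul_of_nonneg_right h8 hTp.le
    rw [hb]; linarith
  rw [← hc3] at i1 i2
  have g1 : Jp p (-(h - b)) ≤ j1 := by
    refine le_trans (Jp_mono hp ?_) hj1
    rw [hb, hh] ; rw [hb] at hMz; linarith
  have g2 : Jp p (h + b) ≤ j2 := by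
    refine le_trans (Jp_mono hp ?_) hj2
    rw [hb, hh] ; rw [hb] at hMz; linarith
  rw [Jp_neg] at g1
  have g3 := (Jp_sym_two_sided hp hhp hbp.le hbh).1
  have g4 : k * T ^ (p - 2) ≤ h ^ (p - 2) := by
    rcases le_total 2 p with h2 | h2
    · calc k * T ^ (p - 2) ≤ (γ / 16) ^ (p - 2) * T ^ (p - 2) := by gcongr; exact min_le_left _ _
        _ = (γ * T / 16) ^ (p - 2) := by rw [← Real.mul_rpow (by positivity) hTp.le]; congr 1; ring
        _ ≤ h ^ (p - 2) := Real.rpow_le_rpow (by positivity) hlo (by linarith)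
    · calc k * T ^ (p - 2) ≤ (γ / 2) ^ (p - 2) * T ^ (p - 2) := by gcongr; exact min_le_right _ _
        _ = (γ * T / 2) ^ (p - 2) := by rw [← Real.mul_rpow (by positivity) hTp.le]; congr 1; ring
        _ ≤ h ^ (p - 2) := Real.rpow_le_rpow_of_nonpos hhp hhi (by linarith)
  have e5 : T ^ (p - 1) = T ^ (p - 2) * T := by
    rw [← Real.rpow_add_one hTp.ne']; congr 1; ring
  calc 2 * (p - 1) * 2 ^ (-|p - 2|) * k * (c3 / 2) * T ^ (p - 1)
      = 2 * (p - 1) * 2 ^ (-|p - 2|) * (k * T ^ (p - 2)) * b := by rw [e5, hb]; ring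
    _ ≤ 2 * (p - 1) * 2 ^ (-|p - 2|) * h ^ (p - 2) * b := by gcongr
    _ ≤ _ := g3
    _ ≤ j1 + j2 := by linarith

set_option maxHeartbeats 1000000 in
theorem mid_bound (N : ℕ) {p s lam Lam γ : ℝ} (hp : 1 < p) (hsp : p - 1 < s * p)
    (hlam : 0 < lam) (hlL : lam ≤ Lam) (h0 : 0 < γ) (h1 : γ < 1) :
    ∃ c0 : ℝ, 0 < c0 ∧ ∀ δ : ℝ, 0 < δ → δ ≤ 1 / 8 → ∃ Cδ : ℝ, 0 < Cδ ∧ ∀ M M1 : ℝ, 0 ≤ M → 0 ≤ M1 →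
      ∃ L0 : ℝ, 0 < L0 ∧ ∀ L, L0 ≤ L → ∀ K : Euc N → ℝ, IsKernel N p s lam Lam K →
      ∀ a e0 : Euc N, a ≠ 0 → ‖a‖ ≤ 1 → ‖e0‖ ≤ M1 → ∀ d C2 : ℝ, ‖a‖ ≤ d → 0 ≤ C2 →
      ∀ jx jy : Euc N → ℝ,
        IntegrableOn (fun z => (jx z + jy z) * K z) (ann N (δ * ‖a‖) d) →
        (∀ z, ‖z‖ ≤ ‖a‖ / 2 →
          Jp p (-(L * ‖a + z‖ ^ γ - L * ‖a‖ ^ γ + inner ℝ e0 z + M * ‖z‖ ^ 2)) ≤ jx z) →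
        (∀ z, ‖z‖ ≤ ‖a‖ / 2 → Jp p (-(L * ‖a - z‖ ^ γ - L * ‖a‖ ^ γ)) ≤ jy z) →
        (∀ z ∈ ann N (δ * ‖a‖) d, -(C2 * ‖z‖ ^ (γ * (p - 1))) ≤ jx z + jy z) →
        (c0 * L ^ (p - 1) - Cδ * C2) * ‖a‖ ^ (γ * (p - 1) - s * p) ≤
          ∫ z in ann N (δ * ‖a‖) d, (jx z + jy z) * K z := by
  obtain ⟨c, hc, hgain⟩ := pair_gain (N := N) hp h0 h1
  set ρ0 := (1 - γ) / 2048 with hρ0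
  have hρ0p : 0 < ρ0 := by rw [hρ0]; have : 0 < 1 - γ := by linarith
                           positivity
  have hp1 : 0 < p - 1 := by linarith
  have hLam : 0 < Lam := hlam.trans_le hlL
  have hsp0 : 0 < s * p := by linarith
  set vB := (volume (ball (0 : Euc N) 1)).toReal with hvB
  have hvBp : 0 < vB := ENNReal.toReal_pos (measure_ball_pos _ _ one_pos).ne' measure_ball_lt_top.ne
  set μ := s * p - γ * (p - 1) with hμ
  have hμp : 0 < μ := by rw [hμ]; nlinarith
  obtain ⟨C1, hC1, hB1⟩ := tail_power_bound N μ hμp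
  refine ⟨c * (lam * (ρ0 ^ N * vB)), by positivity, ?_⟩
  intro δ hδ hδ8
  refine ⟨Lam * (C1 * δ ^ (-μ)), by positivity, ?_⟩
  intro M M1 hM hM1
  obtain ⟨La, hLa, hga⟩ := hgain M M1 hM hM1
  obtain ⟨Lb, hLb, hgb⟩ := hgain 0 0 le_rfl le_rfl
  refine ⟨max La Lb, by positivity, ?_⟩
  intro L hL K hK a e0 ha ha1 he0 d C2 had hC2 jx jy hIntg hi hii hiii
  have hLp : 0 < L := hLa.trans_le ((le_max_left _ _).trans hL)
  have hA0 : 0 < ‖a‖ := norm_pos_iff.2 ha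
  set D := ann N (δ * ‖a‖) d with hD
  have hDm : MeasurableSet D := ann_meas _ _ _
  have hδA : 0 < δ * ‖a‖ := by positivity
  set F : Euc N → ℝ := fun z => jx z + jy z with hF
  set T := (L * ‖a‖ ^ γ) ^ (p - 1) with hT
  have hTp : 0 < T := by positivity
  set Sg := ball ((1 / 4 : ℝ) • a) (ρ0 * ‖a‖) with hSg
  have hρle : ρ0 ≤ 1 / 2048 := by rw [hρ0]; linarith
  have hSgn : ∀ z ∈ Sg, ‖a‖ / 8 ≤ ‖z‖ ∧ ‖z‖ ≤ ‖a‖ / 2 := by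
    intro z hz
    rw [hSg, mem_ball, dist_eq_norm] at hz
    have hn : ‖(1 / 4 : ℝ) • a‖ = ‖a‖ / 4 := by rw [norm_smul]; norm_num; ring
    have t1 := abs_norm_sub_norm_le z ((1 / 4 : ℝ) • a)
    rw [hn] at t1
    obtain ⟨t2, t3⟩ := abs_le.1 (t1.trans hz.le)
    constructor <;> nlinarith
  have hSgD : Sg ⊆ D := by
    intro z hz
    obtain ⟨h3, h4⟩ := hSgn z hz
    exact ⟨by nlinarith, by linarith⟩
  have hgainS : ∀ z ∈ Sg, c * T ≤ (F z + F (-z)) / 2 := by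
    intro z hz
    obtain ⟨h3, h4⟩ := hSgn z hz
    have hz' : ‖z - (1 / 4 : ℝ) • a‖ ≤ (1 - γ) / 2048 * ‖a‖ := by
      rw [hSg, mem_ball, dist_eq_norm] at hz; exact hz.le
    have g1 := hga L ((le_max_left _ _).trans hL) a e0 z ha ha1 he0 hz' (jx z) (jx (-z)) (hi z h4)
      (by
        have := hi (-z) (by rwa [norm_neg])
        rw [norm_neg, inner_neg_right, ← sub_eq_add_neg, ← sub_eq_add_neg] at this
        exact this)
    have g2 := hgb L ((le_max_right _ _).trans hL) a 0 z ha ha1 (by simp) hz' (jy (-z)) (jy z)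
      (by
        have := hii (-z) (by rwa [norm_neg])
        rw [sub_neg_eq_add] at this
        simpa using this)
      (by simpa using hii z h4)
    simp only [hF]
    linarith
  have hFn := setIntegrable_neg_sym D (ann_neg _ _ _) _ hIntg
  have hKneg : ∀ z ∈ D, K (-z) = K z := by
    intro z hz
    apply hK.2.2.1
    rintro rfl
    have := hz.1
    simp at this
    linarith
  have hKp : ∀ z ∈ D, 0 ≤ K z ∧ K z ≤ Lam * (δ * ‖a‖) ^ (-((N : ℝ) + s * p)) :=
    fun z hz => hK.bdd hsp0.le hLam.le hδA hz.1
  have hFs : ∫ z in D, F z * K z = ∫ z in D, (F z * K z + F (-z) * K (-z)) / 2 := by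
    rw [integral_div, integral_add hIntg hFn, setIntegral_neg_sym D (ann_neg _ _ _) (fun z => F z * K z)]
    ring
  have hFsi : IntegrableOn (fun z => (F z * K z + F (-z) * K (-z)) / 2) D := (hIntg.add hFn).div_const 2
  set G1 : Euc N → ℝ := fun z => Sg.indicator (fun _ => c * T) z * K z with hG1
  set G2 : Euc N → ℝ := fun z => (C2 * ‖z‖ ^ (γ * (p - 1))) * K z with hG2
  have hG1i : IntegrableOn G1 D := by
    refine integrableOn_ann hK hsp0.le hLam.le hδA (C := c * T) ?_ ?_
    · exact measurable_const.indicator measurableSet_ball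
    · intro z _
      by_cases h : z ∈ Sg
      · rw [indicator_of_mem h, abs_of_pos (by positivity)]
      · rw [indicator_of_notMem h, abs_zero]; positivity
  have hG2i : IntegrableOn G2 D := by
    refine integrableOn_ann hK hsp0.le hLam.le hδA (C := C2 * d ^ (γ * (p - 1))) ?_ ?_
    · fun_prop
    · intro z hz
      rw [abs_of_nonneg (by positivity)]
      have := hz.2.le
      gcongr
  have hmono : ∫ z in D, (G1 z - G2 z) ≤ ∫ z in D, F z * K z := by
    rw [hFs]
    apply setIntegral_mono_on (hG1i.sub hG2i) hFsi hDm
    intro z hz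
    rw [hKneg z hz]
    have hk := (hKp z hz).1
    have hz' : -z ∈ D := (ann_neg _ _ _ z).2 hz
    have e : (F z * K z + F (-z) * K z) / 2 = ((F z + F (-z)) / 2) * K z := by ring
    change G1 z - G2 z ≤ _
    simp only [hG1, hG2]
    rw [e, ← sub_mul]
    apply mul_le_mul_of_nonneg_right _ hk
    by_cases h : z ∈ Sg
    · rw [indicator_of_mem h]
      have := hgainS z h
      have : 0 ≤ C2 * ‖z‖ ^ (γ * (p - 1)) := by positivity
      linarith
    · rw [indicator_of_notMem h]
      have e1 := hiii z hz
      have e2 := hiii (-z) hz'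
      rw [norm_neg] at e2
      simp only [hF]
      linarith
  rw [integral_sub hG1i hG2i] at hmono
  have hexp : T * ‖a‖ ^ (-(s * p)) = L ^ (p - 1) * ‖a‖ ^ (γ * (p - 1) - s * p) := by
    rw [hT, Real.mul_rpow hLp.le (by positivity), ← Real.rpow_mul hA0.le, sub_eq_add_neg (γ * (p - 1)),
      Real.rpow_add hA0]
    ring
  have hlow : c * (lam * (ρ0 ^ N * vB)) * L ^ (p - 1) * ‖a‖ ^ (γ * (p - 1) - s * p) ≤ ∫ z in D, G1 z := by
    have e1 : ∫ z in D, G1 z = ∫ z in Sg, c * T * K z := by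
      have : G1 = Sg.indicator (fun z => c * T * K z) := by
        funext z
        by_cases h : z ∈ Sg
        · simp [hG1, h]
        · simp [hG1, h]
      rw [this, setIntegral_indicator measurableSet_ball, inter_eq_right.2 hSgD]
    have e2 : IntegrableOn (fun z => c * T * K z) Sg := by
      refine (hG1i.mono_set hSgD).congr_fun ?_ measurableSet_ball
      intro z hz
      simp [hG1, hz]
    rw [e1]
    have e3 : ∫ z in Sg, c * T * (lam * ‖a‖ ^ (-((N : ℝ) + s * p))) ≤ ∫ z in Sg, c * T * K z := by
      apply setIntegral_mono_on _ e2 measurableSet_ball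
      · intro z hz
        have hzz := hSgn z hz
        have hzp : 0 < ‖z‖ := by linarith
        have := (hK.2.2.2 z (norm_pos_iff.1 hzp)).1
        have h5 : ‖a‖ ^ (-((N : ℝ) + s * p)) ≤ ‖z‖ ^ (-((N : ℝ) + s * p)) := by
          apply Real.rpow_le_rpow_of_nonpos hzp (by linarith)
          have : (0:ℝ) ≤ N := Nat.cast_nonneg N
          linarith
        have h6 : lam * ‖a‖ ^ (-((N : ℝ) + s * p)) ≤ K z := le_trans (by gcongr) this
        gcongr
      · exact integrableOn_const measure_ball_lt_top.ne
    refine le_trans (le_of_eq ?_) e3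
    rw [setIntegral_const, smul_eq_mul, Measure.real, hSg,
      Measure.addHaar_ball_of_pos _ _ (by positivity), finrank_euclideanSpace_fin, ENNReal.toReal_mul,
      ENNReal.toReal_ofReal (by positivity), ← hvB]
    have e4 : ‖a‖ ^ N * ‖a‖ ^ (-((N : ℝ) + s * p)) = ‖a‖ ^ (-(s * p)) := by
      rw [← Real.rpow_natCast, ← Real.rpow_add hA0]; congr 1; ring
    calc _ = c * (lam * (ρ0 ^ N * vB)) * (L ^ (p - 1) * ‖a‖ ^ (γ * (p - 1) - s * p)) := by ring
      _ = c * (lam * (ρ0 ^ N * vB)) * (T * ‖a‖ ^ (-(s * p))) := by rw [hexp]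
      _ = c * (lam * (ρ0 ^ N * vB)) * (T * (‖a‖ ^ N * ‖a‖ ^ (-((N : ℝ) + s * p)))) := by rw [e4]
      _ = _ := by rw [mul_pow]; ring
  have hup : ∫ z in D, G2 z ≤ Lam * (C1 * δ ^ (-μ)) * C2 * ‖a‖ ^ (γ * (p - 1) - s * p) := by
    apply integral_le_of_lintegral_ofReal (by positivity)
    have h1 : ∫⁻ z in D, ENNReal.ofReal (G2 z) ≤ ∫⁻ z in {z : Euc N | δ * ‖a‖ ≤ ‖z‖},
        ENNReal.ofReal (C2 * Lam) * ENNReal.ofReal (‖z‖ ^ (-((N : ℝ) + μ))) := by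
      refine (setLIntegral_mono' hDm ?_).trans (lintegral_mono_set (fun z hz => hz.1))
      intro z hz
      rw [← ENNReal.ofReal_mul (by positivity)]
      apply ENNReal.ofReal_le_ofReal
      have hzp : 0 < ‖z‖ := hδA.trans_le hz.1
      have := (hK.2.2.2 z (norm_pos_iff.1 hzp)).2
      calc G2 z ≤ (C2 * ‖z‖ ^ (γ * (p - 1))) * (Lam * ‖z‖ ^ (-((N : ℝ) + s * p))) := by
            simp only [hG2]; gcongr
        _ = C2 * Lam * (‖z‖ ^ (γ * (p - 1)) * ‖z‖ ^ (-((N : ℝ) + s * p))) := by ring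
        _ = _ := by rw [← Real.rpow_add hzp]; congr 2; rw [hμ]; ring
    refine h1.trans ?_
    rw [lintegral_const_mul' _ _ ENNReal.ofReal_ne_top]
    refine (mul_le_mul_right (hB1 _ hδA) _).trans (le_of_eq ?_)
    rw [← ENNReal.ofReal_mul (by positivity), Real.mul_rpow hδ.le hA0.le]
    congr 1
    have : -μ = γ * (p - 1) - s * p := by rw [hμ]; ring
    rw [this]; ring
  calc _ = c * (lam * (ρ0 ^ N * vB)) * L ^ (p - 1) * ‖a‖ ^ (γ * (p - 1) - s * p)
      - Lam * (C1 * δ ^ (-μ)) * C2 * ‖a‖ ^ (γ * (p - 1) - s * p) := by ring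
    _ ≤ _ := by linarith

/-- spatial shift of a space-time point -/
def sh {N : ℕ} (ξ : Euc N × ℝ) (z : Euc N) : Euc N × ℝ := (ξ.1 + z, ξ.2)

instance volHaar (N : ℕ) : (volume : Measure (Euc N × ℝ)).IsAddHaarMeasure :=
  inferInstanceAs (((volume : Measure (Euc N)).prod (volume : Measure ℝ)).IsAddHaarMeasure)

/-- mollification -/
def mol {N : ℕ} (ρ h : Euc N × ℝ → ℝ) (ξ : Euc N × ℝ) : ℝ := ∫ ζ, ρ ζ * h (ξ - ζ)

open ContinuousLinearMap in
theorem exists_mollifier (N : ℕ) (δ : ℝ) (hδ : 0 < δ) :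
    ∃ ρ ρt : Euc N × ℝ → ℝ, Continuous ρ ∧ Continuous ρt ∧ HasCompactSupport ρ ∧
      HasCompactSupport ρt ∧ (∀ ζ, 0 ≤ ρ ζ) ∧ (∫ ζ, ρ ζ = 1) ∧ (∀ ζ, ρ ζ ≠ 0 → ‖ζ‖ < δ) ∧
      (∀ ζ, ρt (-ζ) = -ρt ζ) ∧
      ∀ h : Euc N × ℝ → ℝ, Continuous h → ContDiff ℝ (⊤ : ℕ∞) (mol ρ h) ∧
        ∀ x t, HasDerivAt (fun τ => mol ρ h (x, τ)) (mol ρt h (x, t)) t := by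
  let b : ContDiffBump (0 : Euc N × ℝ) := ⟨δ / 2, δ, by positivity, by linarith⟩
  set ρ := b.normed volume with hρ
  have hsm : ContDiff ℝ (⊤ : ℕ∞) ρ := b.contDiff_normed
  have hcs : HasCompactSupport ρ := b.hasCompactSupport_normed
  have h1 : ContDiff ℝ 1 ρ := hsm.of_le (by exact_mod_cast le_top)
  have hfc : Continuous (fderiv ℝ ρ) := h1.continuous_fderiv one_ne_zero
  refine ⟨ρ, fun ζ => fderiv ℝ ρ ζ (0, 1), hsm.continuous, ?_, hcs, ?_, fun ζ => b.nonneg_normed ζ,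
    b.integral_normed, ?_, ?_, ?_⟩
  · exact hfc.clm_apply continuous_const
  · exact (hcs.fderiv ℝ).comp_left (g := fun A : (Euc N × ℝ) →L[ℝ] ℝ => A (0, 1)) rfl
  · intro ζ hζ
    have : ζ ∈ Function.support ρ := hζ
    rw [hρ, b.support_normed_eq] at this
    simpa using this
  · intro ζ
    have he : (fun x => ρ (-x)) = ρ := by funext x; exact b.normed_neg x
    have : fderiv ℝ (fun x => ρ (-x)) ζ = -fderiv ℝ ρ (-ζ) := by
      have hd : HasFDerivAt ρ (fderiv ℝ ρ (-ζ)) (-ζ) :=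
        (h1.differentiable one_ne_zero).differentiableAt.hasFDerivAt
      have := hd.comp ζ (hasFDerivAt_id ζ).neg
      rw [HasFDerivAt.fderiv (f := fun x => ρ (-x)) this]
      ext <;> simp
    rw [he] at this
    simp [this]
  · intro h hh
    have hm : mol ρ h = convolution ρ h (lsmul ℝ ℝ) volume := by
      funext ξ; simp [mol, convolution_def]
    have hli : LocallyIntegrable h volume := hh.locallyIntegrable
    constructor
    · rw [hm]
      exact hcs.contDiff_convolution_left _ hsm hli
    · intro x t
      have hF := hcs.hasFDerivAt_convolution_left (lsmul ℝ ℝ) h1 hli (x, t)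
      rw [← hm] at hF
      have hl : HasDerivAt (fun τ : ℝ => ((x, τ) : Euc N × ℝ)) (0, 1) t :=
        (hasDerivAt_const t x).prodMk (hasDerivAt_id t)
      have := hF.comp_hasDerivAt t hl
      convert! this using 1
      rw [convolution_def, ContinuousLinearMap.integral_apply]
      · simp [mol]
      · have := (hcs.fderiv ℝ).convolutionExists_left ((lsmul ℝ ℝ).precompL (Euc N × ℝ)) hfc hli (x, t)
        exact this

theorem lintegral_rpow_le_of_prob {α : Type*} [MeasurableSpace α] (μ : Measure α) (hμ : μ univ = 1)
    {p : ℝ} (hp : 1 < p) (F : α → ℝ≥0∞) (hF : AEMeasurable F μ) :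
    (∫⁻ a, F a ∂μ) ^ p ≤ ∫⁻ a, F a ^ p ∂μ := by
  have hpq := Real.HolderConjugate.conjExponent hp
  have := ENNReal.lintegral_mul_le_Lp_mul_Lq μ hpq hF (aemeasurable_const (b := (1 : ℝ≥0∞)))
  simp only [Pi.mul_apply, mul_one, ENNReal.one_rpow, lintegral_const, hμ] at this
  calc (∫⁻ a, F a ∂μ) ^ p ≤ ((∫⁻ a, F a ^ p ∂μ) ^ (1 / p)) ^ p :=
        ENNReal.rpow_le_rpow this (by linarith)
    _ = _ := by rw [← ENNReal.rpow_mul, one_div_mul_cancel (by linarith), ENNReal.rpow_one]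

theorem mol_jensen {N : ℕ} {p : ℝ} (hp : 1 < p) (ρ h : Euc N × ℝ → ℝ) (hρ : Continuous ρ)
    (hρc : HasCompactSupport ρ) (h0 : ∀ ζ, 0 ≤ ρ ζ) (h1 : ∫ ζ, ρ ζ = 1) (hh : Continuous h)
    (ξ : Euc N × ℝ) :
    ENNReal.ofReal (|mol ρ h ξ| ^ p) ≤
      ∫⁻ ζ, ENNReal.ofReal (ρ ζ) * ENNReal.ofReal (|h (ξ - ζ)| ^ p) := by
  have hm : Measurable fun ζ => ENNReal.ofReal (ρ ζ) := hρ.measurable.ennreal_ofReal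
  set μ := (volume : Measure (Euc N × ℝ)).withDensity (fun ζ => ENNReal.ofReal (ρ ζ)) with hμ
  have hμ1 : μ univ = 1 := by
    rw [hμ, withDensity_apply _ MeasurableSet.univ, Measure.restrict_univ,
      ← ofReal_integral_eq_lintegral_ofReal (hρ.integrable_of_hasCompactSupport hρc)
        (ae_of_all _ h0), h1, ENNReal.ofReal_one]
  have hF : Measurable fun ζ => ENNReal.ofReal |h (ξ - ζ)| :=
    (hh.comp (continuous_const.sub continuous_id)).abs.measurable.ennreal_ofReal
  have e1 : ENNReal.ofReal |mol ρ h ξ| ≤ ∫⁻ ζ, ENNReal.ofReal |h (ξ - ζ)| ∂μ := by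
    rw [hμ, lintegral_withDensity_eq_lintegral_mul _ hm hF]
    rw [← Real.norm_eq_abs, ofReal_norm]
    refine (enorm_integral_le_lintegral_enorm _).trans (le_of_eq ?_)
    apply lintegral_congr; intro ζ
    rw [Pi.mul_apply, ← ENNReal.ofReal_mul (h0 _), ← ofReal_norm, Real.norm_eq_abs, abs_mul, abs_of_nonneg (h0 _)]
  have e2 := lintegral_rpow_le_of_prob μ hμ1 hp _ hF.aemeasurable
  rw [← ENNReal.ofReal_rpow_of_nonneg (abs_nonneg _) (by linarith)]
  refine (ENNReal.rpow_le_rpow e1 (by linarith)).trans (e2.trans (le_of_eq ?_))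
  rw [hμ, lintegral_withDensity_eq_lintegral_mul _ hm (hF.pow_const p)]
  apply lintegral_congr; intro ζ
  rw [Pi.mul_apply, ENNReal.ofReal_rpow_of_nonneg (abs_nonneg _) (by linarith)]

theorem mol_Lp {N : ℕ} {p : ℝ} (hp : 1 < p) (ρ h : Euc N × ℝ → ℝ) (hρ : Continuous ρ)
    (hρc : HasCompactSupport ρ) (h0 : ∀ ζ, 0 ≤ ρ ζ) (h1 : ∫ ζ, ρ ζ = 1) (hh : Continuous h)
    (S S' : Set (Euc N × ℝ)) (hS : MeasurableSet S) (hS' : MeasurableSet S')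
    (hSS : ∀ ζ, ρ ζ ≠ 0 → ∀ ξ ∈ S, ξ - ζ ∈ S') :
    ∫⁻ ξ in S, ENNReal.ofReal (|mol ρ h ξ| ^ p) ≤ ∫⁻ ξ in S', ENNReal.ofReal (|h ξ| ^ p) := by
  have hH : Measurable fun ξ : Euc N × ℝ => ENNReal.ofReal (|h ξ| ^ p) :=
    (hh.abs.measurable.pow_const p).ennreal_ofReal
  have hm : Measurable fun ζ => ENNReal.ofReal (ρ ζ) := hρ.measurable.ennreal_ofReal
  calc ∫⁻ ξ in S, ENNReal.ofReal (|mol ρ h ξ| ^ p)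
      ≤ ∫⁻ ξ in S, ∫⁻ ζ, ENNReal.ofReal (ρ ζ) * ENNReal.ofReal (|h (ξ - ζ)| ^ p) :=
        lintegral_mono fun ξ => mol_jensen hp ρ h hρ hρc h0 h1 hh ξ
    _ = ∫⁻ ζ, ∫⁻ ξ in S, ENNReal.ofReal (ρ ζ) * ENNReal.ofReal (|h (ξ - ζ)| ^ p) := by
        rw [lintegral_lintegral_swap]
        apply Measurable.aemeasurable
        exact (hm.comp measurable_snd).mul (hH.comp (measurable_fst.sub measurable_snd))
    _ ≤ ∫⁻ ζ, ENNReal.ofReal (ρ ζ) * ∫⁻ ξ in S', ENNReal.ofReal (|h ξ| ^ p) := by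
        apply lintegral_mono; intro ζ
        dsimp only
        rw [lintegral_const_mul' _ _ ENNReal.ofReal_ne_top]
        by_cases hz : ρ ζ = 0
        · simp [hz]
        apply mul_le_mul_right
        rw [← lintegral_indicator hS, ← lintegral_indicator hS',
          ← lintegral_sub_right_eq_self (S'.indicator _) ζ]
        apply lintegral_mono; intro ξ
        dsimp only
        by_cases hξ : ξ ∈ S
        · rw [indicator_of_mem hξ, indicator_of_mem (hSS ζ hz ξ hξ)]
        · rw [indicator_of_notMem hξ]; exact zero_le
    _ = _ := by
        rw [lintegral_mul_const _ hm, ← ofReal_integral_eq_lintegral_ofReal (hρ.integrable_of_hasCompactSupport hρc)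
        (ae_of_all _ h0), h1, ENNReal.ofReal_one, one_mul]

theorem hasDerivAt_half_sq (y : ℝ) : HasDerivAt (fun w : ℝ => (max w 0) ^ 2 / 2) (max y 0) y := by
  rcases lt_trichotomy y 0 with h | h | h
  · rw [max_eq_right h.le]
    refine (hasDerivAt_const y (0 : ℝ)).congr_of_eventuallyEq ?_
    filter_upwards [Iio_mem_nhds h] with w hw
    rw [max_eq_right (le_of_lt hw)]; simp
  · subst h
    rw [hasDerivAt_iff_isLittleO]
    simp only [max_self, sub_zero, smul_zero]
    have h2 : (fun w : ℝ => w ^ 2) =o[𝓝 0] fun w : ℝ => w := by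
      simpa using Asymptotics.isLittleO_pow_id (𝕜 := ℝ) one_lt_two
    refine Asymptotics.IsBigO.trans_isLittleO (Asymptotics.IsBigO.of_bound 1 ?_) h2
    refine Eventually.of_forall fun w => ?_
    have : (max w 0) ^ 2 ≤ w ^ 2 := by
      rcases le_total w 0 with h | h
      · rw [max_eq_right h]; nlinarith [sq_nonneg w]
      · rw [max_eq_left h]
    rw [Real.norm_eq_abs, Real.norm_eq_abs, abs_of_nonneg (sq_nonneg w)]
    norm_num
    rw [abs_of_nonneg (by positivity)]
    linarith [sq_nonneg w]
  · rw [max_eq_left h.le]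
    have : HasDerivAt (fun w : ℝ => w ^ 2 / 2) y y := by
      have := (hasDerivAt_pow 2 y).div_const 2
      convert! this using 1; simp
    refine this.congr_of_eventuallyEq ?_
    filter_upwards [Ioi_mem_nhds h] with w hw
    rw [max_eq_left (le_of_lt hw)]

theorem mol_near {N : ℕ} (ρ h : Euc N × ℝ → ℝ) (hρ : Continuous ρ)
    (hρc : HasCompactSupport ρ) (h0 : ∀ ζ, 0 ≤ ρ ζ) (h1 : ∫ ζ, ρ ζ = 1) (hh : Continuous h)
    (ξ : Euc N × ℝ) (a ε : ℝ) (hε : ∀ ζ, ρ ζ ≠ 0 → |h (ξ - ζ) - a| ≤ ε) :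
    |mol ρ h ξ - a| ≤ ε := by
  have hi := hρ.integrable_of_hasCompactSupport hρc (μ := volume)
  have hi2 : Integrable (fun ζ => ρ ζ * h (ξ - ζ)) := by
    apply Continuous.integrable_of_hasCompactSupport
    · fun_prop
    · exact hρc.mul_right
  have e : mol ρ h ξ - a = ∫ ζ, ρ ζ * (h (ξ - ζ) - a) := by
    have : ∀ ζ, ρ ζ * (h (ξ - ζ) - a) = ρ ζ * h (ξ - ζ) - ρ ζ * a := fun ζ => by ring
    simp_rw [this]
    rw [integral_sub hi2 (hi.mul_const a), integral_mul_const, h1, one_mul, mol]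
  rw [e, ← Real.norm_eq_abs]
  have : ‖∫ ζ, ρ ζ * (h (ξ - ζ) - a)‖ ≤ ∫ ζ, ρ ζ * ε := by
    apply norm_integral_le_of_norm_le (hi.mul_const ε)
    refine ae_of_all _ fun ζ => ?_
    rw [Real.norm_eq_abs, abs_mul, abs_of_nonneg (h0 ζ)]
    by_cases hz : ρ ζ = 0
    · simp [hz]
    · exact mul_le_mul_of_nonneg_left (hε ζ hz) (h0 ζ)
  rwa [integral_mul_const, h1, one_mul] at this

theorem mol_swap {N : ℕ} (k g U : Euc N × ℝ → ℝ) (hk : Continuous k) (hkc : HasCompactSupport k)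
    (hg : Continuous g) (hgc : HasCompactSupport g) (hU : Continuous U)
    (hodd : ∀ ζ, k (-ζ) = -k ζ) :
    ∫ ξ, U ξ * mol k g ξ = -∫ ξ, g ξ * mol k U ξ := by
  have hIntg : Integrable (fun q : (Euc N × ℝ) × (Euc N × ℝ) => U q.1 * (k (q.1 - q.2) * g q.2))
      ((volume : Measure (Euc N × ℝ)).prod volume) := by
    apply Continuous.integrable_of_hasCompactSupport
    · fun_prop
    · apply HasCompactSupport.intro ((hkc.isCompact.add hgc.isCompact).prod hgc.isCompact)
      intro q hq
      by_contra hne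
      apply hq
      have h1 : k (q.1 - q.2) ≠ 0 := fun h => hne (by rw [h]; ring)
      have h2 : g q.2 ≠ 0 := fun h => hne (by rw [h]; ring)
      refine ⟨⟨q.1 - q.2, subset_tsupport _ h1, q.2, subset_tsupport _ h2, by simp⟩,
        subset_tsupport _ h2⟩
  have e1 : ∀ ξ, mol k g ξ = ∫ ζ, k (ξ - ζ) * g ζ := by
    intro ξ
    rw [mol, ← integral_sub_left_eq_self _ volume ξ]
    simp
  have e2 : ∀ ζ, mol k U ζ = -∫ ξ, k (ξ - ζ) * U ξ := by
    intro ζ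
    rw [mol, ← integral_sub_left_eq_self _ volume ζ, ← integral_neg]
    apply integral_congr_ae (ae_of_all _ fun ξ => ?_)
    have := hodd (ξ - ζ)
    rw [neg_sub] at this
    simp [this]
  calc ∫ ξ, U ξ * mol k g ξ = ∫ ξ, ∫ ζ, U ξ * (k (ξ - ζ) * g ζ) := by
        simp_rw [e1, integral_const_mul]
    _ = ∫ ζ, ∫ ξ, U ξ * (k (ξ - ζ) * g ζ) := integral_integral_swap hIntg
    _ = ∫ ζ, -(g ζ * mol k U ζ) := by
        apply integral_congr_ae (ae_of_all _ fun ζ => ?_)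
        rw [e2, mul_neg, neg_neg, ← integral_const_mul]
        apply integral_congr_ae (ae_of_all _ fun ξ => ?_)
        ring
    _ = _ := integral_neg _

/-- `∫ (ω)_+ ∂ₜω = 0` -/
theorem integral_pos_part_deriv {N : ℕ} (w w' : Euc N × ℝ → ℝ) (hw : Continuous w) (hw' : Continuous w')
    (hd : ∀ x t, HasDerivAt (fun τ => w (x, τ)) (w' (x, t)) t)
    (hc : HasCompactSupport fun ξ => max (w ξ) 0) :
    ∫ ξ, max (w ξ) 0 * w' ξ = 0 := by
  have hi : Integrable (fun ξ => max (w ξ) 0 * w' ξ) ((volume : Measure (Euc N)).prod (volume : Measure ℝ)) := by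
    apply Continuous.integrable_of_hasCompactSupport
    · fun_prop
    · exact hc.mul_right
  have : ∫ ξ, max (w ξ) 0 * w' ξ = ∫ x, ∫ t, max (w (x, t)) 0 * w' (x, t) := integral_prod _ hi
  rw [this]
  have : ∀ x, ∫ t, max (w (x, t)) 0 * w' (x, t) = 0 := by
    intro x
    have hcl : Topology.IsClosedEmbedding fun t : ℝ => (x, t) := by
      refine Topology.IsClosedEmbedding.of_continuous_injective_isClosedMap (by fun_prop)
        (fun a b h => (Prod.mk.inj h).2) ?_
      intro C hC
      have : image (fun t : ℝ => (x, t)) C = {x} ×ˢ C := by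
        ext ⟨a, b⟩
        simp [eq_comm, and_comm]
      rw [this]
      exact isClosed_singleton.prod hC
    have hcx : HasCompactSupport fun t => max (w (x, t)) 0 := hc.comp_isClosedEmbedding hcl
    apply integral_eq_zero_of_hasDerivAt_of_integrable (f := fun t => (max (w (x, t)) 0) ^ 2 / 2)
    · intro t
      exact (hasDerivAt_half_sq (w (x, t))).comp t (hd x t)
    · apply Continuous.integrable_of_hasCompactSupport
      · fun_prop
      · exact hcx.mul_right
    · apply Continuous.integrable_of_hasCompactSupport
      · fun_prop
      · exact hcx.comp_left (g := fun y : ℝ => y ^ 2 / 2) (by simp)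
  simp [this]

theorem sh_sub {N : ℕ} (ξ ζ : Euc N × ℝ) (z : Euc N) : sh ξ z - ζ = sh (ξ - ζ) z := by
  ext1
  · simp only [sh, Prod.fst_sub]; abel
  · simp [sh]

theorem sh_dist {N : ℕ} (ξ P : Euc N × ℝ) (z : Euc N) : dist (sh ξ z) P ≤ dist ξ P + ‖z‖ := by
  have : dist (sh ξ z) ξ ≤ ‖z‖ := by
    simp [sh, Prod.dist_eq]
  linarith [dist_triangle (sh ξ z) ξ P]

theorem sh_sh_neg {N : ℕ} (ξ : Euc N × ℝ) (z : Euc N) : sh (sh ξ z) (-z) = ξ := by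
  ext1 <;> simp [sh]

theorem sh_dist' {N : ℕ} (ξ P : Euc N × ℝ) (z : Euc N) : dist ξ P ≤ dist (sh ξ z) P + ‖z‖ := by
  have := sh_dist (sh ξ z) P (-z)
  rwa [sh_sh_neg, norm_neg] at this

theorem continuous_sh {N : ℕ} (z : Euc N) : Continuous fun ξ : Euc N × ℝ => sh ξ z := by
  unfold sh; fun_prop

theorem mol_D {N : ℕ} (ρ h : Euc N × ℝ → ℝ) (hρ : Continuous ρ)
    (hρc : HasCompactSupport ρ) (hh : Continuous h) (z : Euc N) (ξ : Euc N × ℝ) :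
    mol ρ h ξ - mol ρ h (sh ξ z) = mol ρ (fun ξ => h ξ - h (sh ξ z)) ξ := by
  have hi : ∀ ξ, Integrable (fun ζ => ρ ζ * h (ξ - ζ)) := by
    intro ξ
    apply Continuous.integrable_of_hasCompactSupport
    · fun_prop
    · exact hρc.mul_right
  unfold mol
  rw [← integral_sub (hi _) (hi _)]
  apply integral_congr_ae (ae_of_all _ fun ζ => ?_)
  simp only [sh_sub]; ring

theorem add_rpow_le_two {p a b : ℝ} (hp : 0 ≤ p) (ha : 0 ≤ a) (hb : 0 ≤ b) :
    (a + b) ^ p ≤ 2 ^ p * (a ^ p + b ^ p) := by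
  have h1 : (a + b) ^ p ≤ (2 * max a b) ^ p := by
    apply Real.rpow_le_rpow (by positivity) _ hp
    have := le_max_left a b; have := le_max_right a b; linarith
  rw [Real.mul_rpow (by norm_num) (by positivity)] at h1
  refine h1.trans (mul_le_mul_of_nonneg_left ?_ (by positivity))
  have : 0 ≤ a ^ p := by positivity
  have : 0 ≤ b ^ p := by positivity
  rcases le_total a b with h | h
  · rw [max_eq_right h]; linarith
  · rw [max_eq_left h]; linarith

set_option maxHeartbeats 1000000 in
theorem approx_test {N : ℕ} {p : ℝ} (hp : 1 < p) (U : Euc N × ℝ → ℝ) (hU : Continuous U)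
    (hU1 : ∀ ξ, |U ξ| ≤ 1) (ψ1 : Euc N → ℝ) (hψ : Continuous ψ1) (η1 η1' : ℝ → ℝ)
    (hη : ∀ t, HasDerivAt η1 (η1' t) t) (hη' : Continuous η1') (P : Euc N × ℝ) (r c Λ1 : ℝ)
    (hr : 0 < r) (hr1 : r ≤ 1) (hc : 0 < c) (hcr : c ≤ r ^ 2 / 4) (hΛ : 0 ≤ Λ1)
    (hLip : ∀ x y, dist x P.1 < 3 * r → dist y P.1 < 3 * r → |ψ1 x - ψ1 y| ≤ Λ1 * ‖x - y‖)
    (hmax : ∀ ξ, U ξ - (ψ1 ξ.1 + η1 ξ.2) ≤ -dist ξ P ^ 2)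
    (g : Euc N × ℝ → ℝ) (hg : g = fun ξ => max (U ξ - (ψ1 ξ.1 + η1 ξ.2) + c) 0)
    (ε : ℝ) (hε : 0 < ε) :
    ∃ φ gε : Euc N × ℝ → ℝ, ContDiff ℝ (⊤ : ℕ∞) φ ∧ (∀ ξ, r < dist ξ P → φ ξ = 0) ∧
      Continuous gε ∧ (∀ ξ, r < dist ξ P → gε ξ = 0) ∧ (∀ ξ, |φ ξ - g ξ| ≤ ε) ∧
      (∀ ξ, |gε ξ - g ξ| ≤ ε) ∧
      (∫ ξ : Euc N × ℝ, U ξ * deriv (fun τ => φ (ξ.1, τ)) ξ.2 = -∫ ξ : Euc N × ℝ, η1' ξ.2 * gε ξ) ∧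
      ∀ z, ‖z‖ ≤ r → ∫⁻ ξ, ENNReal.ofReal (|φ ξ - φ (sh ξ z)| ^ p) ≤
        ENNReal.ofReal (2 ^ p) * ∫⁻ ξ in closedBall P (3 * r),
          (ENNReal.ofReal (|U ξ - U (sh ξ z)| ^ p) + ENNReal.ofReal ((Λ1 * ‖z‖) ^ p)) := by
  have hηc : Continuous η1 := continuous_iff_continuousAt.2 fun t => (hη t).continuousAt
  have hgc : Continuous g := by rw [hg]; fun_prop
  have hgs : ∀ ξ, r < dist ξ P → g ξ = 0 := by
    intro ξ hξ
    have := hmax ξ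
    have h2 : r ^ 2 < dist ξ P ^ 2 := by gcongr
    simp only [hg]
    apply max_eq_right
    nlinarith
  have hgcs : HasCompactSupport g := HasCompactSupport.intro (isCompact_closedBall P r) fun ξ hξ => by
    apply hgs; simpa using hξ
  set ε' := min (ε / 4) (r ^ 2 / 8) with hε'
  have hε'p : 0 < ε' := by positivity
  have hε'1 : ε' ≤ ε / 4 := min_le_left _ _
  have hε'2 : ε' ≤ r ^ 2 / 8 := min_le_right _ _
  obtain ⟨δg, hδg, hug⟩ := Metric.uniformContinuous_iff.1
    (hgcs.uniformContinuous_of_continuous hgc) ε' hε'p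
  obtain ⟨δU, hδU, huU⟩ := Metric.uniformContinuousOn_iff.1
    ((isCompact_closedBall P 3).uniformContinuousOn_of_continuous hU.continuousOn) ε' hε'p
  set δ := min (r / 4) (min δg δU) with hδ
  have hδp : 0 < δ := by positivity
  obtain ⟨ρ, ρt, hρ, hρt, hρc, hρtc, hρ0, hρ1, hρs, hodd, hmol⟩ := exists_mollifier N δ hδp
  have hδ1 : δ ≤ r / 4 := min_le_left _ _
  have hδ2 : δ ≤ δg := (min_le_right _ _).trans (min_le_left _ _)
  have hδ3 : δ ≤ δU := (min_le_right _ _).trans (min_le_right _ _)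
  set V := mol ρ U with hV
  obtain ⟨hVs, hVd⟩ := hmol U hU
  have hVc : Continuous V := hVs.continuous
  have hVt : Continuous (mol ρt U) := by
    have : mol ρt U = convolution ρt U (ContinuousLinearMap.lsmul ℝ ℝ) volume := by
      funext ξ; simp [mol, convolution_def]
    rw [this]
    exact hρtc.continuous_convolution_left _ hρt hU.locallyIntegrable
  have hVU : ∀ ξ, dist ξ P ≤ 2 → |V ξ - U ξ| ≤ ε' := by
    intro ξ hξ
    apply mol_near ρ U hρ hρc hρ0 hρ1 hU
    intro ζ hζ
    have h1 := hρs ζ hζ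
    have h2 : dist (ξ - ζ) ξ = ‖ζ‖ := by simp
    have := huU (ξ - ζ) (by rw [mem_closedBall]; linarith [dist_triangle (ξ - ζ) ξ P]) ξ (by rw [mem_closedBall]; linarith)
      (by rw [h2]; linarith)
    rw [Real.dist_eq] at this
    exact this.le
  have hV1 : ∀ ξ, |V ξ| ≤ 1 := by
    intro ξ
    have := mol_near ρ U hρ hρc hρ0 hρ1 hU ξ 0 1 (fun ζ _ => by rw [sub_zero]; exact hU1 _)
    rwa [sub_zero] at this
  set w : Euc N × ℝ → ℝ := fun ξ => V ξ - (ψ1 ξ.1 + η1 ξ.2) + c with hw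
  set gε : Euc N × ℝ → ℝ := fun ξ => max (w ξ) 0 with hgε
  have hwc : Continuous w := by rw [hw]; fun_prop
  have hgεc : Continuous gε := by rw [hgε]; fun_prop
  have hgεs : ∀ ξ, 5 / 8 * r < dist ξ P → gε ξ = 0 := by
    intro ξ hξ
    apply max_eq_right
    have h1 := hmax ξ
    have h3 : (5 / 8 * r) ^ 2 < dist ξ P ^ 2 := by gcongr
    rcases le_total (dist ξ P) 2 with h | h
    · have h2 := (abs_le.1 (hVU ξ h)).2
      simp only [hw]
      nlinarith
    · have h2 := (abs_le.1 (hV1 ξ)).2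
      have h4 := (abs_le.1 (hU1 ξ)).1
      simp only [hw]
      nlinarith
  have hgεcs : HasCompactSupport gε := HasCompactSupport.intro (isCompact_closedBall P (5 / 8 * r))
    fun ξ hξ => by apply hgεs; simpa using hξ
  have hgεg : ∀ ξ, |gε ξ - g ξ| ≤ ε' := by
    intro ξ
    rcases le_total (dist ξ P) 2 with h | h
    · simp only [hgε, hg, hw]
      refine (abs_max_sub_max_le_abs _ _ _).trans ?_
      have := hVU ξ h
      have e : V ξ - (ψ1 ξ.1 + η1 ξ.2) + c - (U ξ - (ψ1 ξ.1 + η1 ξ.2) + c) = V ξ - U ξ := by ring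
      rwa [e]
    · rw [hgεs ξ (by linarith), hgs ξ (by linarith)]; simp [hε'p.le]
  obtain ⟨hφs, hφd⟩ := hmol gε hgεc
  refine ⟨mol ρ gε, gε, hφs, ?_, hgεc, fun ξ hξ => hgεs ξ (by linarith), ?_, fun ξ => (hgεg ξ).trans (by linarith), ?_, ?_⟩
  · intro ξ hξ
    have : ∀ ζ, ρ ζ * gε (ξ - ζ) = 0 := by
      intro ζ
      by_cases hζ : ρ ζ = 0
      · simp [hζ]
      · have h1 := hρs ζ hζ
        have h2 : dist ξ (ξ - ζ) = ‖ζ‖ := by simp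
        rw [hgεs, mul_zero]
        linarith [dist_triangle ξ (ξ - ζ) P]
    simp [mol, this]
  · intro ξ
    refine (mol_near ρ gε hρ hρc hρ0 hρ1 hgεc ξ (g ξ) (2 * ε') ?_).trans (by linarith)
    intro ζ hζ
    have h1 := hρs ζ hζ
    have h2 : dist (ξ - ζ) ξ = ‖ζ‖ := by simp
    have h3 := hug (a := ξ - ζ) (b := ξ) (by rw [h2]; linarith)
    rw [Real.dist_eq] at h3
    have h4 := hgεg (ξ - ζ)
    have := abs_sub_le (gε (ξ - ζ)) (g (ξ - ζ)) (g ξ)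
    linarith
  · have e1 : ∀ ξ : Euc N × ℝ, deriv (fun τ => mol ρ gε (ξ.1, τ)) ξ.2 = mol ρt gε ξ :=
      fun ξ => (hφd ξ.1 ξ.2).deriv
    simp_rw [e1]
    rw [mol_swap ρt gε U hρt hρtc hgεc hgεcs hU hodd]
    congr 1
    have hwd : ∀ x t, HasDerivAt (fun τ => w (x, τ)) (mol ρt U (x, t) - η1' t) t := by
      intro x t
      have := ((hVd x t).sub ((hη t).const_add (ψ1 x))).add_const c
      exact this
    have hz := integral_pos_part_deriv w (fun ξ => mol ρt U ξ - η1' ξ.2) hwc (by fun_prop) hwd hgεcs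
    have i1 : Integrable (fun ξ => gε ξ * mol ρt U ξ) :=
      Continuous.integrable_of_hasCompactSupport (by fun_prop) hgεcs.mul_right
    have i2 : Integrable (fun ξ : Euc N × ℝ => η1' ξ.2 * gε ξ) :=
      Continuous.integrable_of_hasCompactSupport (by fun_prop) hgεcs.mul_left
    rw [← sub_eq_zero, ← integral_sub i1 i2, ← hz]
    apply integral_congr_ae (ae_of_all _ fun ξ => ?_)
    simp only [hgε]; ring
  · intro z hz
    have hDc : ∀ h : Euc N × ℝ → ℝ, Continuous h → Continuous fun ξ => h ξ - h (sh ξ z) :=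
      fun h hh => hh.sub (hh.comp (continuous_sh z))
    have h1 : ∫⁻ ξ, ENNReal.ofReal (|mol ρ gε ξ - mol ρ gε (sh ξ z)| ^ p) ≤
        ∫⁻ ξ, ENNReal.ofReal (|gε ξ - gε (sh ξ z)| ^ p) := by
      simp_rw [mol_D ρ gε hρ hρc hgεc z]
      have := mol_Lp hp ρ (fun ξ => gε ξ - gε (sh ξ z)) hρ hρc hρ0 hρ1 (hDc _ hgεc) univ univ
        MeasurableSet.univ MeasurableSet.univ (fun _ _ _ _ => mem_univ _)
      simpa only [Measure.restrict_univ] using this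
    have h2 : ∀ ξ, ENNReal.ofReal (|gε ξ - gε (sh ξ z)| ^ p) ≤ (closedBall P (2 * r)).indicator
        (fun ξ => ENNReal.ofReal (2 ^ p) * (ENNReal.ofReal (|V ξ - V (sh ξ z)| ^ p) + ENNReal.ofReal ((Λ1 * ‖z‖) ^ p))) ξ := by
      intro ξ
      by_cases hξ : ξ ∈ closedBall P (2 * r)
      · rw [indicator_of_mem hξ]
        rw [← ENNReal.ofReal_add (by positivity) (by positivity), ← ENNReal.ofReal_mul (by positivity)]
        apply ENNReal.ofReal_le_ofReal
        refine le_trans ?_ (add_rpow_le_two (by linarith) (abs_nonneg _) (by positivity))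
        by_cases h0 : gε ξ = 0 ∧ gε (sh ξ z) = 0
        · rw [h0.1, h0.2, sub_zero, abs_zero, Real.zero_rpow (by linarith)]
          positivity
        have hd : dist ξ P ≤ 2 * r ∧ dist (sh ξ z) P ≤ 2 * r := by
          by_contra hcon
          apply h0
          have ha := sh_dist ξ P z
          have hb := sh_dist' ξ P z
          by_cases hh : dist ξ P ≤ 2 * r
          · have : 2 * r < dist (sh ξ z) P := by
              by_contra h; exact hcon ⟨hh, not_lt.1 h⟩
            constructor <;> apply hgεs <;> linarith
          · constructor <;> apply hgεs <;> linarith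
        apply Real.rpow_le_rpow (abs_nonneg _) _ (by linarith)
        simp only [hgε, hw]
        refine (abs_max_sub_max_le_abs _ _ _).trans ?_
        have e : V ξ - (ψ1 ξ.1 + η1 ξ.2) + c - (V (sh ξ z) - (ψ1 (sh ξ z).1 + η1 (sh ξ z).2) + c)
          = (V ξ - V (sh ξ z)) + (ψ1 (sh ξ z).1 - ψ1 ξ.1) := by simp only [sh]; ring
        rw [e]
        refine (abs_add_le _ _).trans (add_le_add le_rfl ?_)
        have hx : dist ξ.1 P.1 ≤ dist ξ P := by rw [Prod.dist_eq]; exact le_max_left _ _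
        have hy : dist (sh ξ z).1 P.1 ≤ dist (sh ξ z) P := by rw [Prod.dist_eq]; exact le_max_left _ _
        have := hLip (sh ξ z).1 ξ.1 (by linarith) (by linarith)
        simpa [sh] using this
      · have ha := sh_dist' ξ P z
        rw [mem_closedBall, not_le] at hξ
        rw [hgεs ξ (by linarith), hgεs (sh ξ z) (by linarith), sub_zero, abs_zero, Real.zero_rpow (by linarith)]
        simp
    have h3 : ∫⁻ ξ in closedBall P (2 * r), ENNReal.ofReal (|V ξ - V (sh ξ z)| ^ p) ≤
        ∫⁻ ξ in closedBall P (3 * r), ENNReal.ofReal (|U ξ - U (sh ξ z)| ^ p) := by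
      simp_rw [hV, mol_D ρ U hρ hρc hU z]
      refine mol_Lp hp ρ (fun ξ => U ξ - U (sh ξ z)) hρ hρc hρ0 hρ1 (hDc _ hU) _ _
        measurableSet_closedBall measurableSet_closedBall ?_
      intro ζ hζ ξ hξ
      have h1 := hρs ζ hζ
      have h2 : dist (ξ - ζ) ξ = ‖ζ‖ := by simp
      rw [mem_closedBall] at hξ ⊢
      linarith [dist_triangle (ξ - ζ) ξ P]
    have hmV : Measurable fun ξ => ENNReal.ofReal (|V ξ - V (sh ξ z)| ^ p) :=
      ((hDc V hVc).abs.measurable.pow_const p).ennreal_ofReal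
    have hmU : Measurable fun ξ => ENNReal.ofReal (|U ξ - U (sh ξ z)| ^ p) :=
      ((hDc U hU).abs.measurable.pow_const p).ennreal_ofReal
    refine h1.trans ((lintegral_mono h2).trans ?_)
    rw [lintegral_indicator measurableSet_closedBall, lintegral_const_mul' _ _ ENNReal.ofReal_ne_top]
    apply mul_le_mul_right
    rw [lintegral_add_left hmV, lintegral_add_left hmU]
    apply add_le_add h3
    exact lintegral_mono_set (closedBall_subset_closedBall (by linarith))

structure Good (N : ℕ) (p s : ℝ) (K : Euc N → ℝ) (f : Euc N × ℝ → ℝ) : Prop where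
  cont : Continuous f
  bd : ∀ x t, ‖x‖ < 2 → -2 < t → t < 0 → |f (x, t)| ≤ 1
  tail : ∀ᵐ t : ℝ, -2 < t → t < 0 →
    ∫⁻ x in (ball (0 : Euc N) 2)ᶜ, ENNReal.ofReal (|f (x, t)| ^ (p - 1) * ‖x‖ ^ (-((N : ℝ) + s * p))) ≤ 1
  energy : ∀ R a b : ℝ, R < 2 → -2 < a → b < 0 →
    ∫⁻ t in Icc a b, ∫⁻ x in ball (0 : Euc N) R, ∫⁻ y in ball (0 : Euc N) R,
      ENNReal.ofReal (|f (x, t) - f (y, t)| ^ p * ‖x - y‖ ^ (-((N : ℝ) + s * p))) < ⊤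
  weak : ∀ φ : Euc N × ℝ → ℝ, ContDiff ℝ (⊤ : ℕ∞) φ → HasCompactSupport φ →
    tsupport φ ⊆ ball (0 : Euc N) 2 ×ˢ Ioo (-2 : ℝ) 0 →
    -(∫ t in Ioc (-2 : ℝ) 0, ∫ x in ball (0 : Euc N) 2, f (x, t) * deriv (fun τ => φ (x, τ)) t) +
      (1 / 2) * ∫ t in Ioc (-2 : ℝ) 0, ∫ x, ∫ y,
        Jp p (f (x, t) - f (y, t)) * (φ (x, t) - φ (y, t)) * K (x - y) = 0

theorem Good.neg {N : ℕ} {p s : ℝ} {K : Euc N → ℝ} {f : Euc N × ℝ → ℝ} (h : Good N p s K f) :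
    Good N p s K (fun ξ => -f ξ) := by
  refine ⟨h.cont.neg, ?_, ?_, ?_, ?_⟩
  · intro x t a b c; rw [abs_neg]; exact h.bd x t a b c
  · simpa only [abs_neg] using h.tail
  · intro R a b h1 h2 h3
    have e : ∀ x t y, |-f (x, t) - -f (y, t)| = |f (x, t) - f (y, t)| := by
      intro x t y; rw [← abs_neg]; congr 1; ring
    simp only [e]
    exact h.energy R a b h1 h2 h3
  · intro φ h1 h2 h3
    have := h.weak φ h1 h2 h3
    have e : ∀ x t y, Jp p (-f (x, t) - -f (y, t)) = -Jp p (f (x, t) - f (y, t)) := by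
      intro x t y; rw [← Jp_neg]; congr 1; ring
    simp only [e, neg_mul, integral_neg]
    linarith

theorem far_bound (N : ℕ) {p s lam Lam : ℝ} (hp : 1 < p) (hs : 0 < s) (hLam : 0 < Lam)
    (R θ : ℝ) (hR2 : R < 2) (hθ : 0 < θ) :
    ∃ C : ℝ, 0 < C ∧ ∀ K : Euc N → ℝ, IsKernel N p s lam Lam K → ∀ f, Good N p s K f →
      ∀ᵐ t : ℝ, -2 < t → t < 0 → ∀ x : Euc N, ‖x‖ ≤ R →
        ∫⁻ z in {z : Euc N | θ ≤ ‖z‖}, ENNReal.ofReal (|Jp p (f (x, t) - f (x + z, t))| * K z) ≤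
          ENNReal.ofReal C := by
  have hsp : 0 < s * p := by positivity
  obtain ⟨Ct, hCt, htail⟩ := tail_power_bound N (s * p) hsp
  have hκ : 0 < 1 - R / 2 := by linarith
  set κ := 1 - R / 2 with hκd
  set m := -((N : ℝ) + s * p) with hm
  have hm0 : m ≤ 0 := by have : (0:ℝ) ≤ N := Nat.cast_nonneg N
                         rw [hm]; linarith
  set A := 2 ^ (p - 1) * 2 * Lam with hA
  set B := 2 ^ (p - 1) * Lam * κ ^ m with hB
  have hA0 : 0 < A := by positivity
  have hB0 : 0 < B := by positivity
  refine ⟨A * (Ct * θ ^ (-(s * p))) + B, by positivity, ?_⟩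
  intro K hK f hf
  filter_upwards [hf.tail] with t ht h1 h2 x hx
  have ht' := ht h1 h2
  have hmeas : MeasurableSet {z : Euc N | θ ≤ ‖z‖} := measurableSet_le measurable_const measurable_norm
  set T : Euc N → ℝ≥0∞ := (ball (0 : Euc N) 2)ᶜ.indicator
    (fun y => ENNReal.ofReal (|f (y, t)| ^ (p - 1) * ‖y‖ ^ m)) with hT
  have hpt : ∀ z ∈ {z : Euc N | θ ≤ ‖z‖}, ENNReal.ofReal (|Jp p (f (x, t) - f (x + z, t))| * K z) ≤
      ENNReal.ofReal A * ENNReal.ofReal (‖z‖ ^ m) + ENNReal.ofReal B * T (x + z) := by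
    intro z hz
    have hzp : 0 < ‖z‖ := hθ.trans_le hz
    have hKz := hK.2.2.2 z (norm_pos_iff.1 hzp)
    have hKp := hK.2.1 z (norm_pos_iff.1 hzp)
    have hfx := hf.bd x t (by linarith) h1 h2
    set y := x + z with hy
    have hJ : |Jp p (f (x, t) - f (y, t))| ≤ 2 ^ (p - 1) * (1 + |f (y, t)| ^ (p - 1)) := by
      rw [Jp_abs hp]
      have e1 : |f (x, t) - f (y, t)| ≤ 1 + |f (y, t)| := (abs_sub _ _).trans (by linarith)
      refine (Real.rpow_le_rpow (abs_nonneg _) e1 (by linarith)).trans ?_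
      have := add_rpow_le_two (p := p - 1) (by linarith) zero_le_one (abs_nonneg (f (y, t)))
      rwa [Real.one_rpow] at this
    by_cases hy2 : ‖y‖ < 2
    · have hfy := hf.bd y t hy2 h1 h2
      have : |f (y, t)| ^ (p - 1) ≤ 1 := Real.rpow_le_one (abs_nonneg _) hfy (by linarith)
      refine le_trans ?_ (le_add_of_nonneg_right zero_le)
      rw [← ENNReal.ofReal_mul hA0.le]
      apply ENNReal.ofReal_le_ofReal
      calc _ ≤ (2 ^ (p - 1) * (1 + 1)) * (Lam * ‖z‖ ^ m) := by
            apply mul_le_mul _ hKz.2 hKp.le (by positivity)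
            refine hJ.trans ?_
            gcongr
        _ = _ := by rw [hA]; ring
    · have hmem : y ∈ (ball (0 : Euc N) 2)ᶜ := by simpa using hy2
      rw [hT, indicator_of_mem hmem, ← ENNReal.ofReal_mul hA0.le, ← ENNReal.ofReal_mul hB0.le,
        ← ENNReal.ofReal_add (by positivity) (by positivity)]
      apply ENNReal.ofReal_le_ofReal
      have hyz : κ * ‖y‖ ≤ ‖z‖ := by
        have : ‖y‖ ≤ ‖x‖ + ‖z‖ := norm_add_le _ _
        rw [hκd]
        nlinarith [mul_nonneg ((norm_nonneg x).trans hx) (sub_nonneg.2 (not_lt.1 hy2))]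
      have hyp : 0 < ‖y‖ := by linarith [not_lt.1 hy2]
      have h5 : ‖z‖ ^ m ≤ κ ^ m * ‖y‖ ^ m := by
        rw [← Real.mul_rpow hκ.le hyp.le]
        exact Real.rpow_le_rpow_of_nonpos (by positivity) hyz hm0
      calc _ ≤ (2 ^ (p - 1) * (1 + |f (y, t)| ^ (p - 1))) * (Lam * ‖z‖ ^ m) :=
            mul_le_mul hJ hKz.2 hKp.le (by positivity)
        _ = 2 ^ (p - 1) * Lam * ‖z‖ ^ m + 2 ^ (p - 1) * Lam * |f (y, t)| ^ (p - 1) * ‖z‖ ^ m := by ring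
        _ ≤ A * ‖z‖ ^ m + 2 ^ (p - 1) * Lam * |f (y, t)| ^ (p - 1) * (κ ^ m * ‖y‖ ^ m) := by
            apply add_le_add
            · apply mul_le_mul_of_nonneg_right _ (by positivity)
              rw [hA]; nlinarith [show 0 < (2:ℝ) ^ (p - 1) * Lam by positivity]
            · gcongr
        _ = _ := by rw [hB]; ring
  refine (setLIntegral_mono' hmeas hpt).trans ?_
  rw [lintegral_add_left (by fun_prop), lintegral_const_mul' _ _ ENNReal.ofReal_ne_top,
    lintegral_const_mul' _ _ ENNReal.ofReal_ne_top, ENNReal.ofReal_add (by positivity) hB0.le]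
  apply add_le_add
  · rw [ENNReal.ofReal_mul hA0.le]
    exact mul_le_mul_right (htail θ hθ) _
  · have : ∫⁻ z in {z : Euc N | θ ≤ ‖z‖}, T (x + z) ≤ 1 := by
      refine (setLIntegral_le_lintegral _ _).trans ?_
      rw [lintegral_add_left_eq_self T x, hT, lintegral_indicator measurableSet_ball.compl]
      exact ht'
    calc _ ≤ ENNReal.ofReal B * 1 := mul_le_mul_right this _
      _ = _ := mul_one _

/-- the swap involution -/
def swp {N : ℕ} (q : Euc N × (Euc N × ℝ)) : Euc N × (Euc N × ℝ) := (-q.1, sh q.2 q.1)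

theorem swp_swp {N : ℕ} (q : Euc N × (Euc N × ℝ)) : swp (swp q) = q := by
  simp [swp, sh_sh_neg]

theorem sh_eq_add {N : ℕ} (ξ : Euc N × ℝ) (z : Euc N) : sh ξ z = ξ + (z, 0) := by
  ext1 <;> simp [sh]

theorem swp_mp {N : ℕ} : MeasurePreserving (swp (N := N)) (volume.prod volume) (volume.prod volume) := by
  apply MeasurePreserving.skew_product (f := fun z : Euc N => -z) (g := fun z ξ => sh ξ z)
  · exact Measure.measurePreserving_neg volume
  · unfold Function.uncurry sh
    fun_prop
  · refine ae_of_all _ fun z => ?_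
    simp only [sh_eq_add]
    exact map_add_right_eq_self volume ((z, 0) : Euc N × ℝ)

theorem swp_meas {N : ℕ} : Measurable (swp (N := N)) := swp_mp.measurable

theorem swp_integral {N : ℕ} (G : Euc N × (Euc N × ℝ) → ℝ) :
    ∫ q, G (swp q) ∂(volume.prod volume) = ∫ q, G q ∂(volume.prod volume) := by
  let e : (Euc N × (Euc N × ℝ)) ≃ᵐ (Euc N × (Euc N × ℝ)) :=
    { toFun := swp, invFun := swp, left_inv := swp_swp, right_inv := swp_swp,
      measurable_toFun := swp_meas, measurable_invFun := swp_meas }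
  exact (swp_mp (N := N)).integral_comp e.measurableEmbedding G

theorem swp_integrable {N : ℕ} {G : Euc N × (Euc N × ℝ) → ℝ} (hG : Integrable G (volume.prod volume)) :
    Integrable (fun q => G (swp q)) (volume.prod volume) :=
  swp_mp.integrable_comp_of_integrable hG

theorem energy_z {N : ℕ} {p s : ℝ} {K : Euc N → ℝ} {f : Euc N × ℝ → ℝ}
    (hf : Good N p s K f) (P : Euc N × ℝ) (r : ℝ) (hr : 0 < r) (h1 : ‖P.1‖ + 4 * r < 2)
    (h2 : -2 < P.2 - 4 * r) (h3 : P.2 + 4 * r < 0) :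
    ∫⁻ z in ball (0 : Euc N) r, (∫⁻ ξ in closedBall P (3 * r), ENNReal.ofReal (|f ξ - f (sh ξ z)| ^ p)) *
      ENNReal.ofReal (‖z‖ ^ (-((N : ℝ) + s * p))) < ⊤ := by
  have hfc := hf.cont
  have hen := hf.energy (‖P.1‖ + 4 * r) (P.2 - 3 * r) (P.2 + 3 * r) h1 (by linarith) (by linarith)
  refine lt_of_le_of_lt ?_ hen
  set m := -((N : ℝ) + s * p) with hm
  set F : Euc N → Euc N → ℝ → ℝ≥0∞ := fun x y t =>
    ENNReal.ofReal (|f (x, t) - f (y, t)| ^ p * ‖x - y‖ ^ m) with hF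
  have hFm : Measurable fun q : (Euc N × Euc N) × ℝ => F q.1.1 q.1.2 q.2 := by
    simp only [hF]; fun_prop
  have e1 : ∀ z, (∫⁻ ξ in closedBall P (3 * r), ENNReal.ofReal (|f ξ - f (sh ξ z)| ^ p)) *
      ENNReal.ofReal (‖z‖ ^ m) = ∫⁻ t in Icc (P.2 - 3 * r) (P.2 + 3 * r), ∫⁻ x in closedBall P.1 (3 * r), F x (x + z) t := by
    intro z
    rw [← lintegral_mul_const' _ _ ENNReal.ofReal_ne_top]
    rw [← Real.closedBall_eq_Icc, show closedBall P (3 * r) = closedBall P.1 (3 * r) ×ˢ closedBall P.2 (3 * r) from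
      (closedBall_prod_same P.1 P.2 (3 * r)).symm, Measure.volume_eq_prod, ← Measure.prod_restrict,
      lintegral_prod_symm]
    · apply lintegral_congr; intro t
      apply lintegral_congr; intro x
      simp only [hF, sh]
      rw [ENNReal.ofReal_mul (by positivity)]
      congr 3
      rw [← norm_neg]; congr 1; abel
    · apply Measurable.aemeasurable
      have := hfc.comp (continuous_sh z)
      have h5 : Measurable fun a : Euc N × ℝ => |f a - f (sh a z)| := (hfc.sub this).abs.measurable
      exact ((h5.pow_const p).ennreal_ofReal).mul_const _
  simp_rw [e1]
  rw [lintegral_lintegral_swap]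
  swap
  · apply Measurable.aemeasurable
    apply Measurable.lintegral_prod_right' (f := fun q : (Euc N × ℝ) × Euc N => F q.2 (q.2 + q.1.1) q.1.2)
    exact hFm.comp (f := fun q : (Euc N × ℝ) × Euc N => ((q.2, q.2 + q.1.1), q.1.2)) (by fun_prop)
  apply lintegral_mono; intro t
  dsimp only
  rw [lintegral_lintegral_swap]
  swap
  · apply Measurable.aemeasurable
    exact hFm.comp (f := fun q : Euc N × Euc N => ((q.2, q.2 + q.1), t)) (by fun_prop)
  have e2 : closedBall P.1 (3 * r) ⊆ ball 0 (‖P.1‖ + 4 * r) := by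
    intro x hx
    rw [mem_closedBall, dist_eq_norm] at hx
    rw [mem_ball_zero_iff]
    have : ‖x‖ ≤ ‖x - P.1‖ + ‖P.1‖ := by simpa using norm_add_le (x - P.1) P.1
    linarith
  refine le_trans ?_ (lintegral_mono_set e2)
  refine setLIntegral_mono' measurableSet_closedBall ?_
  intro x hx
  rw [← lintegral_indicator measurableSet_ball, ← lintegral_indicator measurableSet_ball,
    ← lintegral_add_left_eq_self ((ball (0 : Euc N) (‖P.1‖ + 4 * r)).indicator _) x]
  apply lintegral_mono; intro z
  dsimp only
  by_cases hz : z ∈ ball (0 : Euc N) r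
  · rw [indicator_of_mem hz, indicator_of_mem]
    rw [mem_ball_zero_iff] at hz ⊢
    rw [mem_closedBall, dist_eq_norm] at hx
    have : ‖x‖ ≤ ‖x - P.1‖ + ‖P.1‖ := by simpa using norm_add_le (x - P.1) P.1
    linarith [norm_add_le x z]
  · rw [indicator_of_notMem hz]; exact zero_le

/-- the basic antisymmetric integrand -/
def JJ {N : ℕ} (p : ℝ) (K : Euc N → ℝ) (f : Euc N × ℝ → ℝ) (q : Euc N × (Euc N × ℝ)) : ℝ :=
  Jp p (f q.2 - f (sh q.2 q.1)) * K q.1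

theorem K_neg {N : ℕ} {p s lam Lam : ℝ} {K : Euc N → ℝ} (hK : IsKernel N p s lam Lam K) (z : Euc N) :
    K (-z) = K z := by
  by_cases h : z = 0
  · simp [h]
  · exact hK.2.2.1 z h

theorem JJ_swp {N : ℕ} {p s lam Lam : ℝ} {K : Euc N → ℝ} (hK : IsKernel N p s lam Lam K)
    (f : Euc N × ℝ → ℝ) (q) : JJ p K f (swp q) = -JJ p K f q := by
  simp only [JJ, swp, sh_sh_neg, K_neg hK]
  rw [← neg_sub (f q.2), Jp_neg]; ring

theorem JJ_meas {N : ℕ} {p s lam Lam : ℝ} {K : Euc N → ℝ} (hK : IsKernel N p s lam Lam K)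
    {f : Euc N × ℝ → ℝ} (hf : Continuous f) : Measurable (JJ p K f) := by
  have h1 : Measurable fun q : Euc N × (Euc N × ℝ) => f q.2 - f (sh q.2 q.1) := by
    have : Continuous fun q : Euc N × (Euc N × ℝ) => sh q.2 q.1 := by unfold sh; fun_prop
    exact ((hf.comp continuous_snd).sub (hf.comp this)).measurable
  exact ((Jp_measurable p).comp h1).mul (hK.1.comp measurable_fst)

/-- symmetric cylinder -/
def farS (N : ℕ) (θ : ℝ) : Set (Euc N × (Euc N × ℝ)) := {q | θ ≤ ‖q.1‖}

theorem farS_meas (N : ℕ) (θ : ℝ) : MeasurableSet (farS N θ) :=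
  measurableSet_le measurable_const measurable_fst.norm

/-- half-swap identity on a symmetric set -/
theorem swap_half {N : ℕ} {p s lam Lam : ℝ} {K : Euc N → ℝ} (hK : IsKernel N p s lam Lam K)
    (A : Set (Euc N)) (hA : MeasurableSet A) (hAs : ∀ z, -z ∈ A ↔ z ∈ A) (φ h : Euc N × ℝ → ℝ)
    (hIntg : IntegrableOn (fun q : Euc N × (Euc N × ℝ) => φ q.2 * JJ p K h q) (Prod.fst ⁻¹' A) (volume.prod volume)) :
    IntegrableOn (fun q : Euc N × (Euc N × ℝ) => (φ q.2 - φ (sh q.2 q.1)) * JJ p K h q) (Prod.fst ⁻¹' A) (volume.prod volume) ∧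
    ∫ q in Prod.fst ⁻¹' A, (φ q.2 - φ (sh q.2 q.1)) * JJ p K h q ∂(volume.prod volume) =
      2 * ∫ q in Prod.fst ⁻¹' A, φ q.2 * JJ p K h q ∂(volume.prod volume) := by
  have hm : MeasurableSet (Prod.fst ⁻¹' A : Set (Euc N × (Euc N × ℝ))) := measurable_fst hA
  set G : Euc N × (Euc N × ℝ) → ℝ := (Prod.fst ⁻¹' A).indicator (fun q => φ q.2 * JJ p K h q) with hG
  have hGi : Integrable G (volume.prod volume) := (integrable_indicator_iff hm).2 hIntg
  have e : (Prod.fst ⁻¹' A).indicator (fun q : Euc N × (Euc N × ℝ) => (φ q.2 - φ (sh q.2 q.1)) * JJ p K h q)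
      = fun q => G q + G (swp q) := by
    funext q
    by_cases hq : q.1 ∈ A
    · have h1 : q ∈ (Prod.fst ⁻¹' A : Set (Euc N × (Euc N × ℝ))) := hq
      have h2 : swp q ∈ (Prod.fst ⁻¹' A : Set (Euc N × (Euc N × ℝ))) := (hAs q.1).2 hq
      rw [hG, indicator_of_mem h1, indicator_of_mem h1, indicator_of_mem h2, JJ_swp hK]
      simp only [swp]; ring
    · have h1 : q ∉ (Prod.fst ⁻¹' A : Set (Euc N × (Euc N × ℝ))) := hq
      have h2 : swp q ∉ (Prod.fst ⁻¹' A : Set (Euc N × (Euc N × ℝ))) := fun h => hq ((hAs q.1).1 h)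
      rw [hG, indicator_of_notMem h1, indicator_of_notMem h1, indicator_of_notMem h2, add_zero]
  constructor
  · rw [← integrable_indicator_iff hm, e]
    exact hGi.add (swp_integrable hGi)
  · rw [← integral_indicator hm, ← integral_indicator hm, e, integral_add hGi (swp_integrable hGi),
      swp_integral]
    ring

theorem ae_snd {N : ℕ} {Q : ℝ → Prop} (h : ∀ᵐ t : ℝ, Q t) : ∀ᵐ ξ : Euc N × ℝ, Q ξ.2 :=
  Measure.quasiMeasurePreserving_snd.ae h

theorem far_lint {N : ℕ} {p s lam Lam : ℝ} {K : Euc N → ℝ} (hK : IsKernel N p s lam Lam K)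
    {f : Euc N × ℝ → ℝ} (hf : Continuous f) (θ C B r : ℝ) (hθ : 0 < θ) (hB : 0 ≤ B) (P : Euc N × ℝ)
    (hC : ∀ᵐ t : ℝ, -2 < t → t < 0 → ∀ x : Euc N, ‖x‖ ≤ ‖P.1‖ + r →
        ∫⁻ z in {z : Euc N | θ ≤ ‖z‖}, ENNReal.ofReal (|Jp p (f (x, t) - f (x + z, t))| * K z) ≤
          ENNReal.ofReal C)
    (h2 : -2 < P.2 - r) (h3 : P.2 + r < 0) (φ : Euc N × ℝ → ℝ) (hφ : Measurable φ)
    (hφB : ∀ ξ, |φ ξ| ≤ B) (hφ0 : ∀ ξ, r < dist ξ P → φ ξ = 0) :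
    ∫⁻ q in Prod.fst ⁻¹' {z : Euc N | θ ≤ ‖z‖}, ‖φ q.2 * JJ p K f q‖ₑ ∂(volume.prod volume) ≤
      ENNReal.ofReal B * ENNReal.ofReal C * volume (closedBall P r) := by
  have hms : MeasurableSet {z : Euc N | θ ≤ ‖z‖} := measurableSet_le measurable_const measurable_norm
  have e0 : (Prod.fst ⁻¹' {z : Euc N | θ ≤ ‖z‖} : Set (Euc N × (Euc N × ℝ))) = {z : Euc N | θ ≤ ‖z‖} ×ˢ univ := by
    ext q; simp
  rw [e0, ← Measure.prod_restrict, Measure.restrict_univ, lintegral_prod_symm]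
  swap
  · exact ((hφ.comp measurable_snd).mul (JJ_meas hK hf)).enorm.aemeasurable
  have : ENNReal.ofReal B * ENNReal.ofReal C * volume (closedBall P r) =
      ∫⁻ ξ, (closedBall P r).indicator (fun _ => ENNReal.ofReal B * ENNReal.ofReal C) ξ := by
    rw [lintegral_indicator measurableSet_closedBall, lintegral_const, Measure.restrict_apply_univ]
  rw [this]
  apply lintegral_mono_ae
  filter_upwards [ae_snd hC] with ξ hξ
  by_cases hd : ξ ∈ closedBall P r
  · rw [indicator_of_mem hd]
    rw [mem_closedBall, Prod.dist_eq, max_le_iff, Real.dist_eq, dist_eq_norm, abs_le] at hd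
    have hx : ‖ξ.1‖ ≤ ‖P.1‖ + r := by
      have : ‖ξ.1‖ ≤ ‖ξ.1 - P.1‖ + ‖P.1‖ := by simpa using norm_add_le (ξ.1 - P.1) P.1
      linarith
    have h5 := hξ (by linarith [hd.2.1]) (by linarith [hd.2.2]) ξ.1 hx
    refine le_trans ?_ (mul_le_mul_right h5 _)
    rw [← lintegral_const_mul' _ _ ENNReal.ofReal_ne_top]
    refine setLIntegral_mono' hms ?_
    intro z hz
    have hK0 := (hK.2.1 z (norm_pos_iff.1 (hθ.trans_le hz))).le
    rw [← ENNReal.ofReal_mul hB, ← ofReal_norm]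
    apply ENNReal.ofReal_le_ofReal
    rw [Real.norm_eq_abs, abs_mul, JJ, abs_mul, abs_of_nonneg hK0]
    exact mul_le_mul_of_nonneg_right (hφB ξ) (by positivity)
  · rw [indicator_of_notMem hd]
    have := hφ0 ξ (by simpa using hd)
    simp [this]

theorem near_lint {N : ℕ} {p s lam Lam : ℝ} {K : Euc N → ℝ} (hK : IsKernel N p s lam Lam K)
    (hp : 1 < p) (hLam : 0 ≤ Lam)
    {f : Euc N × ℝ → ℝ} (hf : Continuous f) (θ r : ℝ) (hθ : θ ≤ r) (P : Euc N × ℝ)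
    (φ : Euc N × ℝ → ℝ) (hφ : Continuous φ) (hφ0 : ∀ ξ, r < dist ξ P → φ ξ = 0) (W : Euc N → ℝ≥0∞)
    (hW : ∀ z, ‖z‖ ≤ r → ∫⁻ ξ, ENNReal.ofReal (|φ ξ - φ (sh ξ z)| ^ p) ≤ W z) :
    ∫⁻ q in Prod.fst ⁻¹' (ball (0 : Euc N) θ), ‖(φ q.2 - φ (sh q.2 q.1)) * JJ p K f q‖ₑ ∂(volume.prod volume) ≤
      ENNReal.ofReal Lam * ∫⁻ z in ball (0 : Euc N) θ,
        ((∫⁻ ξ in closedBall P (3 * r), ENNReal.ofReal (|f ξ - f (sh ξ z)| ^ p)) + W z) *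
          ENNReal.ofReal (‖z‖ ^ (-((N : ℝ) + s * p))) := by
  have e0 : (Prod.fst ⁻¹' (ball (0 : Euc N) θ) : Set (Euc N × (Euc N × ℝ))) = ball (0 : Euc N) θ ×ˢ univ := by
    ext q; simp
  have hshc : Continuous fun q : Euc N × (Euc N × ℝ) => sh q.2 q.1 := by unfold sh; fun_prop
  rw [e0, ← Measure.prod_restrict, Measure.restrict_univ, lintegral_prod]
  swap
  · exact (((hφ.comp continuous_snd).sub (hφ.comp hshc)).measurable.mul (JJ_meas hK hf)).enorm.aemeasurable
  rw [← lintegral_const_mul' _ _ ENNReal.ofReal_ne_top]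
  refine setLIntegral_mono' measurableSet_ball ?_
  intro z hz
  rw [mem_ball_zero_iff] at hz
  by_cases hz0 : z = 0
  · have : ∀ ξ : Euc N × ℝ, sh ξ (0 : Euc N) = ξ := fun ξ => by simp [sh]
    simp [hz0, this]
  have hKz := hK.2.2.2 z hz0
  have hKp := (hK.2.1 z hz0).le
  set m := -((N : ℝ) + s * p) with hm
  have h0f : ∀ ξ, φ ξ - φ (sh ξ z) ≠ 0 → ξ ∈ closedBall P (3 * r) := by
    intro ξ hne
    rw [mem_closedBall]
    by_contra hcon
    apply hne
    have hr : 0 ≤ ‖z‖ := norm_nonneg z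
    rw [hφ0 ξ (by linarith), hφ0 (sh ξ z) (by linarith [sh_dist' ξ P z]), sub_zero]
  have hpt : ∀ ξ, ‖(φ ξ - φ (sh ξ z)) * JJ p K f (z, ξ)‖ₑ ≤
      (((closedBall P (3 * r)).indicator (fun ξ => ENNReal.ofReal (|f ξ - f (sh ξ z)| ^ p)) ξ) +
        ENNReal.ofReal (|φ ξ - φ (sh ξ z)| ^ p)) * ENNReal.ofReal (Lam * ‖z‖ ^ m) := by
    intro ξ
    by_cases hne : φ ξ - φ (sh ξ z) = 0
    · simp [hne]
    rw [indicator_of_mem (h0f ξ hne), ← ENNReal.ofReal_add (by positivity) (by positivity),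
      ← ENNReal.ofReal_mul (by positivity), ← ofReal_norm]
    apply ENNReal.ofReal_le_ofReal
    rw [Real.norm_eq_abs, abs_mul, JJ, abs_mul, abs_of_nonneg hKp, ← mul_assoc, Jp_abs hp]
    apply mul_le_mul _ hKz.2 hKp (by positivity)
    set a := |φ ξ - φ (sh ξ z)|
    set b := |f ξ - f (sh ξ z)|
    have ha : 0 ≤ a := abs_nonneg _
    have hb : 0 ≤ b := abs_nonneg _
    have hsplit : ∀ y : ℝ, 0 ≤ y → y * y ^ (p - 1) = y ^ p := by
      intro y hy
      rcases hy.eq_or_lt with h | h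
      · rw [← h, Real.zero_rpow (by linarith : p ≠ 0), zero_mul]
      · nth_rewrite 1 [← Real.rpow_one y]
        rw [← Real.rpow_add h]; congr 1; ring
    rcases le_total a b with h | h
    · calc a * b ^ (p - 1) ≤ b * b ^ (p - 1) := by gcongr
        _ = b ^ p := hsplit b hb
        _ ≤ _ := le_add_of_nonneg_right (by positivity)
    · calc a * b ^ (p - 1) ≤ a * a ^ (p - 1) := by
            have : b ^ (p - 1) ≤ a ^ (p - 1) := Real.rpow_le_rpow hb h (by linarith)
            gcongr
        _ = a ^ p := hsplit a ha
        _ ≤ _ := le_add_of_nonneg_left (by positivity)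
  refine (lintegral_mono hpt).trans ?_
  rw [lintegral_mul_const' _ _ ENNReal.ofReal_ne_top, ENNReal.ofReal_mul hLam]
  have hmm : Measurable fun ξ => ENNReal.ofReal (|f ξ - f (sh ξ z)| ^ p) :=
      ((hf.sub (hf.comp (continuous_sh z))).abs.measurable.pow_const p).ennreal_ofReal
  rw [lintegral_add_left (hmm.indicator measurableSet_closedBall), lintegral_indicator measurableSet_closedBall,
    mul_comm, mul_assoc, mul_comm (ENNReal.ofReal (‖z‖ ^ m))]
  gcongr
  exact hW z (by linarith)

theorem weak_prod {N : ℕ} {p s lam Lam : ℝ} {K : Euc N → ℝ} (hK : IsKernel N p s lam Lam K)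
    {f : Euc N × ℝ → ℝ} (hf : Good N p s K f) (P : Euc N × ℝ) (r : ℝ)
    (h1 : ‖P.1‖ + r < 2) (h2 : -2 < P.2 - r) (h3 : P.2 + r < 0)
    (φ : Euc N × ℝ → ℝ) (hφ : ContDiff ℝ (⊤ : ℕ∞) φ) (hφ0 : ∀ ξ, r < dist ξ P → φ ξ = 0)
    (hI : Integrable (fun q : Euc N × (Euc N × ℝ) => (φ q.2 - φ (sh q.2 q.1)) * JJ p K f q) (volume.prod volume)) :
    ∫ ξ : Euc N × ℝ, f ξ * deriv (fun τ => φ (ξ.1, τ)) ξ.2 =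
      (1 / 2) * ∫ q : Euc N × (Euc N × ℝ), (φ q.2 - φ (sh q.2 q.1)) * JJ p K f q ∂(volume.prod volume) := by
  have hsupp : Function.support φ ⊆ closedBall P r := by
    intro ξ hξ
    rw [mem_closedBall]; by_contra hc; exact hξ (hφ0 ξ (not_le.1 hc))
  have hts : tsupport φ ⊆ closedBall P r := closure_minimal hsupp isClosed_closedBall
  have hcs : HasCompactSupport φ := HasCompactSupport.of_support_subset_isCompact (isCompact_closedBall P r) hsupp
  have hreg : closedBall P r ⊆ ball (0 : Euc N) 2 ×ˢ Ioo (-2 : ℝ) 0 := by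
    intro ξ hd
    rw [mem_closedBall, Prod.dist_eq, max_le_iff, Real.dist_eq, dist_eq_norm, abs_le] at hd
    have : ‖ξ.1‖ ≤ ‖ξ.1 - P.1‖ + ‖P.1‖ := by simpa using norm_add_le (ξ.1 - P.1) P.1
    refine ⟨by rw [mem_ball_zero_iff]; linarith [hd.1], by linarith [hd.2.1], by linarith [hd.2.2]⟩
  have hw := hf.weak φ hφ hcs (hts.trans hreg)
  have hder : ∀ ξ : Euc N × ℝ, deriv (fun τ => φ (ξ.1, τ)) ξ.2 = fderiv ℝ φ ξ ((0 : Euc N), (1 : ℝ)) := by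
    intro ξ
    have hd : HasFDerivAt φ (fderiv ℝ φ ξ) ξ := (hφ.differentiable (by simp)).differentiableAt.hasFDerivAt
    have hc : HasDerivAt (fun τ : ℝ => (ξ.1, τ)) ((0 : Euc N), (1 : ℝ)) ξ.2 :=
      (hasDerivAt_const _ _).prodMk (hasDerivAt_id _)
    have := HasFDerivAt.comp_hasDerivAt (f := fun τ : ℝ => (ξ.1, τ)) ξ.2 (l := φ) hd hc
    exact this.deriv
  have hFc : Continuous fun ξ : Euc N × ℝ => f ξ * deriv (fun τ => φ (ξ.1, τ)) ξ.2 := by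
    simp only [hder]
    exact hf.cont.mul ((hφ.continuous_fderiv (by simp)).clm_apply continuous_const)
  have hF0 : ∀ ξ : Euc N × ℝ, ξ ∉ closedBall P r → f ξ * deriv (fun τ => φ (ξ.1, τ)) ξ.2 = 0 := by
    intro ξ hξ
    rw [hder, fderiv_of_notMem_tsupport ℝ (fun h => hξ (hts h))]; simp
  have hFi : Integrable fun ξ : Euc N × ℝ => f ξ * deriv (fun τ => φ (ξ.1, τ)) ξ.2 :=
    hFc.integrable_of_hasCompactSupport (HasCompactSupport.of_support_subset_isCompact
      (isCompact_closedBall P r) (fun ξ hξ => by by_contra hc; exact hξ (hF0 ξ hc)))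
  have e1 : ∫ ξ : Euc N × ℝ, f ξ * deriv (fun τ => φ (ξ.1, τ)) ξ.2 =
      ∫ t in Ioc (-2 : ℝ) 0, ∫ x in ball (0 : Euc N) 2, f (x, t) * deriv (fun τ => φ (x, τ)) t := by
    rw [Measure.volume_eq_prod, integral_prod_symm _ hFi]
    symm
    rw [setIntegral_eq_integral_of_forall_compl_eq_zero]
    · apply integral_congr_ae; refine Eventually.of_forall fun t => ?_
      apply setIntegral_eq_integral_of_forall_compl_eq_zero
      intro x hx
      exact hF0 (x, t) (fun h => hx (hreg h).1)
    · intro t ht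
      have : ∀ x, f (x, t) * deriv (fun τ => φ (x, τ)) t = 0 := fun x =>
        hF0 (x, t) (fun h => ht ⟨(hreg h).2.1, (hreg h).2.2.le⟩)
      simp [this]
  have e2 : ∫ q : Euc N × (Euc N × ℝ), (φ q.2 - φ (sh q.2 q.1)) * JJ p K f q ∂(volume.prod volume) =
      ∫ t in Ioc (-2 : ℝ) 0, ∫ x, ∫ y,
        Jp p (f (x, t) - f (y, t)) * (φ (x, t) - φ (y, t)) * K (x - y) := by
    rw [integral_prod_symm _ hI]
    have h5 := hI.integral_prod_right
    rw [Measure.volume_eq_prod] at h5 ⊢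
    rw [integral_prod_symm _ h5, setIntegral_eq_integral_of_forall_compl_eq_zero]
    · apply integral_congr_ae; refine Eventually.of_forall fun t => ?_
      apply integral_congr_ae; refine Eventually.of_forall fun x => ?_
      dsimp only
      rw [← integral_add_left_eq_self (fun y => Jp p (f (x, t) - f (y, t)) * (φ (x, t) - φ (y, t)) * K (x - y)) x]
      apply integral_congr_ae; refine Eventually.of_forall fun z => ?_
      simp only [JJ, sh]
      rw [← K_neg hK z]
      have : x - (x + z) = -z := by abel
      rw [this]; ring
    · intro t ht
      have : ∀ x, φ (x, t) = 0 := fun x => by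
        by_contra h
        have := hreg (hsupp h)
        exact ht ⟨this.2.1, this.2.2.le⟩
      simp [this]
  rw [e1, e2]; linarith

theorem pow_fin (N : ℕ) (hN : 1 ≤ N) {p s : ℝ} (hp : 1 < p) (hs1 : s < 1) (r : ℝ) (hr : 0 < r) :
    ∫⁻ z in ball (0 : Euc N) r, ENNReal.ofReal (‖z‖ ^ p * ‖z‖ ^ (-((N : ℝ) + s * p))) < ⊤ := by
  have hσ : 0 < p - s * p := by nlinarith
  obtain ⟨C, hC, h⟩ := ball_power_bound N hN (p - s * p) 0 hσ le_rfl one_pos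
  have h5 := h r hr (EuclideanSpace.single ⟨0, hN⟩ 1) (by simp)
  refine lt_of_le_of_lt ?_ (lt_of_le_of_lt h5 ENNReal.ofReal_lt_top)
  have e : ball (0 : Euc N) r = {z | ‖z‖ < r} := by ext; simp
  rw [e]
  apply lintegral_mono
  intro z
  apply ENNReal.ofReal_le_ofReal
  rw [neg_zero, Real.rpow_zero, one_mul]
  by_cases hz : z = 0
  · rw [hz, norm_zero, Real.zero_rpow (by linarith : p ≠ 0), zero_mul]
    positivity
  · rw [← Real.rpow_add (norm_pos_iff.2 hz)]
    apply le_of_eq; congr 1; ring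

/-- pointwise integrand that dominates the near part -/
def eDom {N : ℕ} (p s Λ1 : ℝ) (f : Euc N × ℝ → ℝ) (P : Euc N × ℝ) (r : ℝ) (z : Euc N) : ℝ≥0∞ :=
  ((∫⁻ ξ in closedBall P (3 * r), ENNReal.ofReal (|f ξ - f (sh ξ z)| ^ p)) +
    ENNReal.ofReal (2 ^ p) * ((∫⁻ ξ in closedBall P (3 * r), ENNReal.ofReal (|f ξ - f (sh ξ z)| ^ p)) +
      ENNReal.ofReal ((Λ1 * ‖z‖) ^ p) * volume (closedBall P (3 * r)))) *
    ENNReal.ofReal (‖z‖ ^ (-((N : ℝ) + s * p)))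

theorem eDom_fin {N : ℕ} (hN : 1 ≤ N) {p s : ℝ} (hp : 1 < p) (hs1 : s < 1) {K : Euc N → ℝ} {f : Euc N × ℝ → ℝ}
    (hf : Good N p s K f) (P : Euc N × ℝ) (r Λ1 : ℝ) (hΛ : 0 ≤ Λ1) (hr : 0 < r) (h1 : ‖P.1‖ + 4 * r < 2)
    (h2 : -2 < P.2 - 4 * r) (h3 : P.2 + 4 * r < 0) :
    ∫⁻ z in ball (0 : Euc N) r, eDom p s Λ1 f P r z < ⊤ := by
  have hE := energy_z hf P r hr h1 h2 h3
  have hV : volume (closedBall P (3 * r)) < ⊤ := measure_closedBall_lt_top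
  have e : ∀ z : Euc N, eDom p s Λ1 f P r z =
      (1 + ENNReal.ofReal (2 ^ p)) * ((∫⁻ ξ in closedBall P (3 * r), ENNReal.ofReal (|f ξ - f (sh ξ z)| ^ p)) *
      ENNReal.ofReal (‖z‖ ^ (-((N : ℝ) + s * p)))) +
      (ENNReal.ofReal (2 ^ p) * ENNReal.ofReal (Λ1 ^ p) * volume (closedBall P (3 * r))) *
        ENNReal.ofReal (‖z‖ ^ p * ‖z‖ ^ (-((N : ℝ) + s * p))) := by
    intro z
    rw [eDom, Real.mul_rpow hΛ (norm_nonneg z), ENNReal.ofReal_mul (by positivity : 0 ≤ Λ1 ^ p),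
      ENNReal.ofReal_mul (by positivity : 0 ≤ ‖z‖ ^ p)]
    ring
  simp only [e]
  rw [lintegral_add_right]
  swap
  · have : Measurable fun z : Euc N => ‖z‖ ^ p * ‖z‖ ^ (-((N : ℝ) + s * p)) :=
      (measurable_norm.pow_const _).mul (measurable_norm.pow_const _)
    exact this.ennreal_ofReal.const_mul _
  rw [lintegral_const_mul' _ _ (by finiteness), lintegral_const_mul' _ _ (by finiteness)]
  refine ENNReal.add_lt_top.2 ⟨ENNReal.mul_lt_top (by finiteness) hE, ENNReal.mul_lt_top (by finiteness) (pow_fin N hN hp hs1 r hr)⟩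

theorem eDom_small {N : ℕ} (hN : 1 ≤ N) {p s : ℝ} (hp : 1 < p) (hs1 : s < 1) {K : Euc N → ℝ} {f : Euc N × ℝ → ℝ}
    (hf : Good N p s K f) (P : Euc N × ℝ) (r Λ1 : ℝ) (hΛ : 0 ≤ Λ1) (hr : 0 < r) (h1 : ‖P.1‖ + 4 * r < 2)
    (h2 : -2 < P.2 - 4 * r) (h3 : P.2 + 4 * r < 0) (ε : ℝ≥0∞) (hε : 0 < ε) :
    ∃ θ1 : ℝ, 0 < θ1 ∧ θ1 ≤ r ∧ ∀ θ, 0 < θ → θ ≤ θ1 → ∫⁻ z in ball (0 : Euc N) θ, eDom p s Λ1 f P r z < ε := by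
  have hfin := eDom_fin hN hp hs1 hf P r Λ1 hΛ hr h1 h2 h3
  have hT : Tendsto (fun θ : ℝ => (volume.restrict (ball (0 : Euc N) r)) (ball (0 : Euc N) θ)) (𝓝[>] 0) (𝓝 0) := by
    have hb : Tendsto (fun θ : ℝ => ENNReal.ofReal (θ ^ N) * volume (ball (0 : Euc N) 1)) (𝓝[>] 0) (𝓝 0) := by
      have h6 : Tendsto (fun θ : ℝ => ENNReal.ofReal (θ ^ N)) (𝓝[>] 0) (𝓝 0) := by
        have : Continuous fun θ : ℝ => ENNReal.ofReal (θ ^ N) := ENNReal.continuous_ofReal.comp (continuous_pow N)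
        have h7 := this.tendsto 0
        rw [zero_pow (by omega), ENNReal.ofReal_zero] at h7
        exact h7.mono_left nhdsWithin_le_nhds
      have := ENNReal.Tendsto.mul_const (b := volume (ball (0 : Euc N) 1)) h6 (Or.inr measure_ball_lt_top.ne)
      rwa [zero_mul] at this
    refine tendsto_of_tendsto_of_tendsto_of_le_of_le' tendsto_const_nhds hb (Eventually.of_forall fun _ => zero_le) ?_
    filter_upwards [self_mem_nhdsWithin] with θ hθ
    refine (Measure.restrict_apply_le _ _).trans ?_
    rw [Measure.addHaar_ball_of_pos _ _ hθ, finrank_euclideanSpace_fin]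
  have h5 := tendsto_setLIntegral_zero (f := eDom p s Λ1 f P r) hfin.ne hT
  have h6 := (h5.eventually (gt_mem_nhds hε)).and (Ioc_mem_nhdsGT hr)
  rw [Filter.Eventually, mem_nhdsGT_iff_exists_Ioc_subset] at h6
  obtain ⟨θ1, hθ1, hs⟩ := h6
  refine ⟨θ1, hθ1, (hs ⟨hθ1, le_rfl⟩).2.2, fun θ h0 h => ?_⟩
  have h7 := hs ⟨h0, h⟩
  have h8 := h7.1
  rwa [Measure.restrict_restrict measurableSet_ball, inter_eq_self_of_subset_left (ball_subset_ball h7.2.2)] at h8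

theorem integral_lower {α : Type*} [MeasurableSpace α] {μ : Measure α} {F : α → ℝ} {c : ℝ} (hc : 0 ≤ c)
    (h : ∫⁻ x, ‖F x‖ₑ ∂μ ≤ ENNReal.ofReal c) : |∫ x, F x ∂μ| ≤ c := by
  have h1 := enorm_integral_le_lintegral_enorm (μ := μ) F
  have h2 := h1.trans h
  rw [← ofReal_norm, ENNReal.ofReal_le_ofReal_iff hc] at h2
  exact h2

theorem limit_ineq {N : ℕ} (hN : 1 ≤ N) {p s lam Lam : ℝ} (hp : 1 < p) (hs : s ∈ Ioo (0 : ℝ) 1) (hLam : 0 < Lam)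
    {K : Euc N → ℝ} (hK : IsKernel N p s lam Lam K)
    {f : Euc N × ℝ → ℝ} (hf : Good N p s K f) (P : Euc N × ℝ) (r : ℝ) (hr : 0 < r) (hr1 : r ≤ 1)
    (h1 : ‖P.1‖ + 4 * r < 2) (h2 : -2 < P.2 - 4 * r) (h3 : P.2 + 4 * r < 0)
    (U : Euc N × ℝ → ℝ) (hU : Continuous U) (hU1 : ∀ ξ, |U ξ| ≤ 1)
    (hUf : ∀ ξ, dist ξ P ≤ 4 * r → U ξ = f ξ)
    (ψ1 : Euc N → ℝ) (hψ : Continuous ψ1) (η1 η1' : ℝ → ℝ)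
    (hη : ∀ t, HasDerivAt η1 (η1' t) t) (hη' : Continuous η1') (c Λ1 : ℝ)
    (hc : 0 < c) (hcr : c ≤ r ^ 2 / 4) (hΛ : 0 ≤ Λ1)
    (hLip : ∀ x y, dist x P.1 < 3 * r → dist y P.1 < 3 * r → |ψ1 x - ψ1 y| ≤ Λ1 * ‖x - y‖)
    (hmax : ∀ ξ, U ξ - (ψ1 ξ.1 + η1 ξ.2) ≤ -dist ξ P ^ 2)
    (g : Euc N × ℝ → ℝ) (hg : g = fun ξ => max (U ξ - (ψ1 ξ.1 + η1 ξ.2) + c) 0)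
    (ε0 : ℝ) (hε0 : 0 < ε0) :
    ∃ θ1 : ℝ, 0 < θ1 ∧ θ1 ≤ r ∧ ∀ θ, 0 < θ → θ ≤ θ1 →
      (∫ ξ : Euc N × ℝ, η1' ξ.2 * g ξ) +
        (∫ q in Prod.fst ⁻¹' {z : Euc N | θ ≤ ‖z‖}, g q.2 * JJ p K f q ∂(volume.prod volume)) ≤ ε0 := by
  obtain ⟨θ1, hθ1, hθr, hsmall⟩ := eDom_small hN hp hs.2 hf P r Λ1 hΛ hr h1 h2 h3 (ENNReal.ofReal (ε0 / Lam))
    (ENNReal.ofReal_pos.2 (by positivity))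
  refine ⟨θ1, hθ1, hθr, fun θ hθ hθle => ?_⟩
  have hsm := hsmall θ hθ hθle
  have hηc : Continuous η1 := continuous_iff_continuousAt.2 fun t => (hη t).continuousAt
  have hgc : Continuous g := by rw [hg]; fun_prop
  have hgs : ∀ ξ, r < dist ξ P → g ξ = 0 := by
    intro ξ hξ
    have := hmax ξ
    have h2 : r ^ 2 < dist ξ P ^ 2 := by gcongr
    simp only [hg]
    apply max_eq_right
    nlinarith
  obtain ⟨C, hC, hfar⟩ := far_bound N (lam := lam) hp hs.1 hLam (‖P.1‖ + r) θ (by linarith) hθ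
  have hfar := hfar K hK f hf
  set A : Set (Euc N) := {z : Euc N | θ ≤ ‖z‖} with hA
  have hAm : MeasurableSet A := measurableSet_le measurable_const measurable_norm
  have hAs : ∀ z, -z ∈ A ↔ z ∈ A := fun z => by simp [hA]
  have hAm' : MeasurableSet (Prod.fst ⁻¹' A : Set (Euc N × (Euc N × ℝ))) := measurable_fst hAm
  have hAc : (Prod.fst ⁻¹' A : Set (Euc N × (Euc N × ℝ)))ᶜ = Prod.fst ⁻¹' (ball (0 : Euc N) θ) := by
    ext q; simp [hA]
  have hV : volume (closedBall P r) < ⊤ := measure_closedBall_lt_top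
  -- integrability on the far set for any bounded measurable function vanishing off the ball
  have hfarI : ∀ (φ : Euc N × ℝ → ℝ) (B : ℝ), Measurable φ → 0 ≤ B → (∀ ξ, |φ ξ| ≤ B) →
      (∀ ξ, r < dist ξ P → φ ξ = 0) →
      IntegrableOn (fun q : Euc N × (Euc N × ℝ) => φ q.2 * JJ p K f q) (Prod.fst ⁻¹' A) (volume.prod volume) ∧
      |∫ q in Prod.fst ⁻¹' A, φ q.2 * JJ p K f q ∂(volume.prod volume)| ≤ B * C * (volume (closedBall P r)).toReal := by
    intro φ B hm hB hb h0
    have h5 := far_lint hK hf.cont θ C B r hθ hB P hfar (by linarith) (by linarith) φ hm hb h0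
    have h6 : ENNReal.ofReal B * ENNReal.ofReal C * volume (closedBall P r) =
        ENNReal.ofReal (B * C * (volume (closedBall P r)).toReal) := by
      rw [ENNReal.ofReal_mul (by positivity), ENNReal.ofReal_mul hB, ENNReal.ofReal_toReal hV.ne]
    rw [h6] at h5
    refine ⟨⟨((hm.comp measurable_snd).mul (JJ_meas hK hf.cont)).aestronglyMeasurable, ?_⟩, ?_⟩
    · exact lt_of_le_of_lt h5 ENNReal.ofReal_lt_top
    · exact integral_lower (by positivity) h5
  have hgb : ∃ B, ∀ ξ, |g ξ| ≤ B := by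
    refine ⟨c, fun ξ => ?_⟩
    rw [hg]; dsimp only
    rw [abs_of_nonneg (le_max_right _ _)]
    apply max_le _ hc.le
    have := hmax ξ
    nlinarith [sq_nonneg (dist ξ P)]
  obtain ⟨Bg, hBg⟩ := hgb
  have hBg0 : 0 ≤ Bg := (abs_nonneg _).trans (hBg P)
  have hgI := (hfarI g Bg hgc.measurable hBg0 hBg hgs).1
  have hηI : ∀ h : Euc N × ℝ → ℝ, Continuous h → (∀ ξ, r < dist ξ P → h ξ = 0) →
      Integrable (fun ξ : Euc N × ℝ => η1' ξ.2 * h ξ) := by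
    intro h hh h0
    refine Continuous.integrable_of_hasCompactSupport (by fun_prop) (HasCompactSupport.intro (isCompact_closedBall P r) fun ξ hξ => ?_)
    rw [h0 ξ (by simpa using hξ), mul_zero]
  obtain ⟨Cη, hCη⟩ : ∃ Cη, ∀ ξ ∈ closedBall P r, ‖η1' ξ.2‖ ≤ Cη :=
    (isCompact_closedBall P r).exists_bound_of_continuousOn (f := fun ξ : Euc N × ℝ => η1' ξ.2) (by fun_prop)
  have hCη0 : 0 ≤ Cη := (norm_nonneg _).trans (hCη P (mem_closedBall_self hr.le))
  set V := (volume (closedBall P r)).toReal with hVd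
  -- the key estimate for each ε
  have key : ∀ ε > 0, (∫ ξ : Euc N × ℝ, η1' ξ.2 * g ξ) +
        (∫ q in Prod.fst ⁻¹' A, g q.2 * JJ p K f q ∂(volume.prod volume)) ≤ ε0 / 2 + ε * (Cη * V + C * V) := by
    intro ε hε
    obtain ⟨φ, gε, hφs, hφ0, hgεc, hgε0, hφg, hgεg, hIntg, hW⟩ := approx_test hp U hU hU1 ψ1 hψ η1 η1' hη hη' P r c Λ1
      hr hr1 hc hcr hΛ hLip hmax g hg ε hε
    have hφc : Continuous φ := hφs.continuous
    set H : Euc N × (Euc N × ℝ) → ℝ := fun q => (φ q.2 - φ (sh q.2 q.1)) * JJ p K f q with hH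
    have hφb : ∀ ξ, |φ ξ| ≤ Bg + ε := by
      intro ξ
      have e : φ ξ = (φ ξ - g ξ) + g ξ := by ring
      rw [e]; exact (abs_add_le _ _).trans (by linarith [hφg ξ, hBg ξ])
    have hfφ := hfarI φ (Bg + ε) hφc.measurable (by linarith) hφb hφ0
    obtain ⟨hHf, hHe⟩ := swap_half hK A hAm hAs φ f hfφ.1
    set W : Euc N → ℝ≥0∞ := fun z => ENNReal.ofReal (2 ^ p) * ((∫⁻ ξ in closedBall P (3 * r), ENNReal.ofReal (|f ξ - f (sh ξ z)| ^ p)) +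
      ENNReal.ofReal ((Λ1 * ‖z‖) ^ p) * volume (closedBall P (3 * r))) with hWd
    have hW' : ∀ z, ‖z‖ ≤ r → ∫⁻ ξ, ENNReal.ofReal (|φ ξ - φ (sh ξ z)| ^ p) ≤ W z := by
      intro z hz
      refine (hW z hz).trans ?_
      rw [hWd]; dsimp only
      gcongr
      rw [lintegral_add_right _ measurable_const, lintegral_const, Measure.restrict_apply_univ]
      gcongr ?_ + _
      refine setLIntegral_mono' measurableSet_closedBall fun ξ hξ => ?_
      rw [mem_closedBall] at hξ
      rw [hUf ξ (by linarith), hUf (sh ξ z) (by linarith [sh_dist ξ P z])]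
    have hnear : ∀ θ', θ' ≤ r → ∫⁻ q in Prod.fst ⁻¹' (ball (0 : Euc N) θ'), ‖H q‖ₑ ∂(volume.prod volume) ≤
        ENNReal.ofReal Lam * ∫⁻ z in ball (0 : Euc N) θ', eDom p s Λ1 f P r z := fun θ' h' =>
      near_lint hK hp hLam.le hf.cont θ' r h' P φ hφc hφ0 W hW'
    have hn := hnear θ (hθle.trans hθr)
    have hn2 : ∫⁻ q in Prod.fst ⁻¹' (ball (0 : Euc N) θ), ‖H q‖ₑ ∂(volume.prod volume) ≤ ENNReal.ofReal ε0 := by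
      refine hn.trans ((mul_le_mul_right hsm.le _).trans ?_)
      rw [← ENNReal.ofReal_mul hLam.le, mul_div_cancel₀ _ hLam.ne']
    have hHm : Measurable H := by
      have hshc : Continuous fun q : Euc N × (Euc N × ℝ) => sh q.2 q.1 := by unfold sh; fun_prop
      exact ((hφc.comp continuous_snd).sub (hφc.comp hshc)).measurable.mul (JJ_meas hK hf.cont)
    have hHn : IntegrableOn H (Prod.fst ⁻¹' (ball (0 : Euc N) θ)) (volume.prod volume) :=
      ⟨hHm.aestronglyMeasurable, lt_of_le_of_lt hn2 ENNReal.ofReal_lt_top⟩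
    have hHI : Integrable H (volume.prod volume) := by
      rw [← integrableOn_univ, ← union_compl_self (Prod.fst ⁻¹' A), hAc]
      exact hHf.union hHn
    have hwk := weak_prod hK hf P r (by linarith) (by linarith) (by linarith) φ hφs hφ0 hHI
    have hUe : ∫ ξ : Euc N × ℝ, U ξ * deriv (fun τ => φ (ξ.1, τ)) ξ.2 =
        ∫ ξ : Euc N × ℝ, f ξ * deriv (fun τ => φ (ξ.1, τ)) ξ.2 := by
      apply integral_congr_ae; refine Eventually.of_forall fun ξ => ?_
      dsimp only
      rcases le_or_gt (dist ξ P) r with h | h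
      · rw [hUf ξ (by linarith)]
      · have : (fun τ => φ (ξ.1, τ)) =ᶠ[𝓝 ξ.2] fun _ => 0 := by
          have ho : ∀ᶠ τ in 𝓝 ξ.2, r < dist (ξ.1, τ) P := by
            have hcd : Continuous fun τ : ℝ => dist (ξ.1, τ) P := by fun_prop
            exact hcd.continuousAt.eventually (lt_mem_nhds h)
          filter_upwards [ho] with τ hτ using hφ0 _ hτ
        rw [this.deriv_eq]; simp
    rw [← hUe, hIntg, ← integral_add_compl hAm' hHI, hAc, hHe] at hwk
    have hnI : |∫ q in Prod.fst ⁻¹' (ball (0 : Euc N) θ), H q ∂(volume.prod volume)| ≤ ε0 := integral_lower hε0.le hn2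
    have d1 : |∫ q in Prod.fst ⁻¹' A, (φ q.2 - g q.2) * JJ p K f q ∂(volume.prod volume)| ≤ ε * C * V :=
      (hfarI (fun ξ => φ ξ - g ξ) ε (hφc.sub hgc).measurable hε.le hφg (fun ξ h => by rw [hφ0 ξ h, hgs ξ h, sub_zero])).2
    have d2 : (∫ q in Prod.fst ⁻¹' A, (φ q.2 - g q.2) * JJ p K f q ∂(volume.prod volume)) =
        (∫ q in Prod.fst ⁻¹' A, φ q.2 * JJ p K f q ∂(volume.prod volume)) -
        ∫ q in Prod.fst ⁻¹' A, g q.2 * JJ p K f q ∂(volume.prod volume) := by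
      rw [← integral_sub hfφ.1 hgI]; congr 1; funext q; ring
    have d3 : (∫ ξ : Euc N × ℝ, η1' ξ.2 * (g ξ - gε ξ)) = (∫ ξ : Euc N × ℝ, η1' ξ.2 * g ξ) - ∫ ξ : Euc N × ℝ, η1' ξ.2 * gε ξ := by
      rw [← integral_sub (hηI g hgc hgs) (hηI gε hgεc hgε0)]; congr 1; funext q; ring
    have d4 : |∫ ξ : Euc N × ℝ, η1' ξ.2 * (g ξ - gε ξ)| ≤ Cη * ε * V := by
      rw [← setIntegral_eq_integral_of_forall_compl_eq_zero (s := closedBall P r)]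
      · have := norm_setIntegral_le_of_norm_le_const (f := fun ξ : Euc N × ℝ => η1' ξ.2 * (g ξ - gε ξ)) (C := Cη * ε) hV (fun ξ hξ => by
          rw [norm_mul]
          apply mul_le_mul (hCη ξ hξ) _ (norm_nonneg _) hCη0
          rw [Real.norm_eq_abs, abs_sub_comm]; exact hgεg ξ)
        simpa using! this
      · intro ξ hξ
        rw [hgs ξ (by simpa using hξ), hgε0 ξ (by simpa using hξ)]; simp
    rw [d2] at d1; rw [d3] at d4
    have a1 := abs_le.1 d1
    have a2 := abs_le.1 d4
    have a3 := abs_le.1 hnI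
    nlinarith [a1.1, a2.2, a3.1]
  set X := Cη * V + C * V with hX
  have hX0 : 0 ≤ X := by positivity
  have := key (ε0 / 2 / (X + 1)) (by positivity)
  refine this.trans ?_
  have : ε0 / 2 / (X + 1) * X ≤ ε0 / 2 := by
    rw [div_mul_eq_mul_div, div_le_iff₀ (by positivity)]
    nlinarith
  linarith

theorem Jp_cont {p : ℝ} (hp : 1 < p) : Continuous (Jp p) := by
  rw [continuous_iff_continuousAt]
  intro t
  by_cases ht : t = 0
  · subst ht
    rw [ContinuousAt, Jp_zero]
    rw [tendsto_zero_iff_abs_tendsto_zero]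
    have h : Continuous fun t : ℝ => |t| ^ (p - 1) := continuous_abs.rpow_const fun x => Or.inr (by linarith)
    have h2 := h.tendsto 0
    rw [abs_zero, Real.zero_rpow (by linarith)] at h2
    refine h2.congr fun x => ?_
    rw [Function.comp, Jp_abs hp]
  · unfold Jp
    refine ContinuousAt.mul ?_ continuousAt_id
    exact continuous_abs.continuousAt.rpow_const (Or.inl (by simpa using ht))

theorem fub_lower {N : ℕ} {p : ℝ} {K : Euc N → ℝ} (A : Set (Euc N))
    (g h : Euc N × ℝ → ℝ) (hg0 : ∀ ξ, 0 ≤ g ξ) (hgi : Integrable g)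
    (hIntg : IntegrableOn (fun q : Euc N × (Euc N × ℝ) => g q.2 * JJ p K h q) (Prod.fst ⁻¹' A) (volume.prod volume))
    (l : ℝ) (hl : ∀ᵐ ξ : Euc N × ℝ, g ξ ≠ 0 → l ≤ ∫ z in A, JJ p K h (z, ξ)) :
    l * ∫ ξ, g ξ ≤ ∫ q in Prod.fst ⁻¹' A, g q.2 * JJ p K h q ∂(volume.prod volume) := by
  have e0 : (Prod.fst ⁻¹' A : Set (Euc N × (Euc N × ℝ))) = A ×ˢ univ := by ext q; simp
  rw [IntegrableOn, e0, ← Measure.prod_restrict, Measure.restrict_univ] at hIntg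
  rw [e0, ← Measure.prod_restrict, Measure.restrict_univ, integral_prod_symm _ hIntg, ← integral_const_mul]
  apply integral_mono_ae (hgi.const_mul l) hIntg.integral_prod_right
  filter_upwards [hl] with ξ hξ
  rw [integral_const_mul, mul_comm]
  by_cases h : g ξ = 0
  · simp [h]
  · exact mul_le_mul_of_nonneg_left (hξ h) (hg0 ξ)

theorem mid_cont {N : ℕ} {p s lam Lam : ℝ} (hp : 1 < p) (hs : 0 < s) (hLam : 0 < Lam)
    {K : Euc N → ℝ} (hK : IsKernel N p s lam Lam K)
    {f : Euc N × ℝ → ℝ} (hf : Continuous f) (P : Euc N × ℝ) (θ d : ℝ) (hθ : 0 < θ) :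
    ContinuousAt (fun ξ => ∫ z in ann N θ d, JJ p K f (z, ξ)) P := by
  have hcont2 : Continuous fun q : (Euc N × ℝ) × Euc N => Jp p (f q.1 - f (sh q.1 q.2)) := by
    have : Continuous fun q : (Euc N × ℝ) × Euc N => sh q.1 q.2 := by unfold sh; fun_prop
    exact (Jp_cont hp).comp ((hf.comp continuous_fst).sub (hf.comp this))
  obtain ⟨B, hB⟩ := ((isCompact_closedBall P 1).prod (isCompact_closedBall (0 : Euc N) d)).exists_bound_of_continuousOn
    hcont2.continuousOn
  have hsp : 0 ≤ s * p := by positivity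
  have : Fact (volume (ann N θ d) < ⊤) := ⟨ann_finite N θ d⟩
  refine continuousAt_of_dominated (bound := fun _ => B * (Lam * θ ^ (-((N : ℝ) + s * p)))) ?_ ?_ ?_ ?_
  · refine Eventually.of_forall fun ξ => ?_
    have := (JJ_meas hK hf (p := p)).comp (measurable_prodMk_right (y := ξ))
    exact this.aestronglyMeasurable
  · filter_upwards [closedBall_mem_nhds P one_pos] with ξ hξ
    filter_upwards [ae_restrict_mem (ann_meas N θ d)] with z hz
    have hk := IsKernel.bdd hK hsp hLam.le hθ hz.1
    have hb := hB (ξ, z) ⟨hξ, by simpa using hz.2.le⟩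
    rw [JJ, norm_mul, Real.norm_of_nonneg hk.1]
    exact mul_le_mul hb hk.2 hk.1 ((norm_nonneg _).trans hb)
  · exact integrable_const _
  · refine Eventually.of_forall fun z => ?_
    have : Continuous fun ξ => JJ p K f (z, ξ) := by
      exact (hcont2.comp (continuous_id.prodMk (continuous_const (y := z)))).mul (continuous_const (y := K z))
    exact this.continuousAt

/-- comparison on the small annulus -/
theorem cmp_ann {N : ℕ} {p s lam Lam : ℝ} (hp : 1 < p) (hs : 0 < s) (hLam : 0 < Lam)
    {K : Euc N → ℝ} (hK : IsKernel N p s lam Lam K)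
    {f : Euc N × ℝ → ℝ} (ψ1 : Euc N → ℝ) (hψ : Continuous ψ1) (P : Euc N × ℝ) (r θ θ0 : ℝ) (hθ : 0 < θ)
    (g : Euc N × ℝ → ℝ) (hgc : Continuous g) (hg0 : ∀ ξ, 0 ≤ g ξ) (hgs : ∀ ξ, r < dist ξ P → g ξ = 0)
    (hcmp : ∀ ξ z, ‖z‖ < θ0 → 0 ≤ (g ξ - g (sh ξ z)) * (Jp p (f ξ - f (sh ξ z)) - Jp p (ψ1 ξ.1 - ψ1 (ξ.1 + z))))
    (hIntg : IntegrableOn (fun q : Euc N × (Euc N × ℝ) => g q.2 * JJ p K f q) (Prod.fst ⁻¹' (ann N θ θ0)) (volume.prod volume))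
    (l : ℝ) (hl : ∀ x, dist x P.1 ≤ r → l ≤ ∫ z in ann N θ θ0, Jp p (ψ1 x - ψ1 (x + z)) * K z) :
    l * ∫ ξ, g ξ ≤ ∫ q in Prod.fst ⁻¹' (ann N θ θ0), g q.2 * JJ p K f q ∂(volume.prod volume) := by
  set h : Euc N × ℝ → ℝ := fun ξ => ψ1 ξ.1 with hh
  have hhc : Continuous h := hψ.comp continuous_fst
  have hsp : 0 ≤ s * p := by positivity
  have hcs : HasCompactSupport g := HasCompactSupport.intro (isCompact_closedBall P r) fun ξ hξ => by
    apply hgs; simpa using hξ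
  have hgi : Integrable g := hgc.integrable_of_hasCompactSupport hcs
  have hAm := ann_meas N θ θ0
  have hAm' : MeasurableSet (Prod.fst ⁻¹' (ann N θ θ0) : Set (Euc N × (Euc N × ℝ))) := measurable_fst hAm
  have hcont2 : Continuous fun q : (Euc N × ℝ) × Euc N => g q.1 * Jp p (h q.1 - h (sh q.1 q.2)) := by
    have : Continuous fun q : (Euc N × ℝ) × Euc N => sh q.1 q.2 := by unfold sh; fun_prop
    exact (hgc.comp continuous_fst).mul ((Jp_cont hp).comp ((hhc.comp continuous_fst).sub (hhc.comp this)))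
  obtain ⟨B, hB⟩ := ((isCompact_closedBall P r).prod (isCompact_closedBall (0 : Euc N) θ0)).exists_bound_of_continuousOn
    hcont2.continuousOn
  have hIntg2 : IntegrableOn (fun q : Euc N × (Euc N × ℝ) => g q.2 * JJ p K h q) (Prod.fst ⁻¹' (ann N θ θ0)) (volume.prod volume) := by
    have hm : Measurable fun q : Euc N × (Euc N × ℝ) => g q.2 * JJ p K h q :=
      (hgc.measurable.comp measurable_snd).mul (JJ_meas hK hhc)
    have h1 : IntegrableOn (fun q : Euc N × (Euc N × ℝ) => g q.2 * JJ p K h q) (ann N θ θ0 ×ˢ closedBall P r) (volume.prod volume) := by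
      refine IntegrableOn.of_bound (C := B * (Lam * θ ^ (-((N : ℝ) + s * p)))) ?_ hm.aestronglyMeasurable ?_
      · rw [Measure.prod_prod]; exact ENNReal.mul_lt_top (ann_finite N θ θ0) measure_closedBall_lt_top
      · filter_upwards [ae_restrict_mem (hAm.prod measurableSet_closedBall)] with q hq
        have hk := IsKernel.bdd hK hsp hLam.le hθ hq.1.1
        have hb := hB (q.2, q.1) ⟨hq.2, by simpa using hq.1.2.le⟩
        rw [JJ, ← mul_assoc, norm_mul, Real.norm_of_nonneg hk.1]
        exact mul_le_mul hb hk.2 hk.1 ((norm_nonneg _).trans hb)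
    refine (h1.of_forall_sdiff_eq_zero hAm' ?_)
    intro q hq
    have : q.2 ∉ closedBall P r := fun h => hq.2 ⟨hq.1, h⟩
    rw [hgs q.2 (by simpa using this), zero_mul]
  obtain ⟨i1, e1⟩ := swap_half hK _ hAm (ann_neg N θ θ0) g f hIntg
  obtain ⟨i2, e2⟩ := swap_half hK _ hAm (ann_neg N θ θ0) g h hIntg2
  have h3 := setIntegral_mono_on i2 i1 hAm' (fun q hq => by
    have hk := IsKernel.bdd hK hsp hLam.le hθ (show q.1 ∈ ann N θ θ0 from hq).1
    have h5 := mul_nonneg (hcmp q.2 q.1 (show q.1 ∈ ann N θ θ0 from hq).2) hk.1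
    simp only [JJ, hh, sh] at h5 ⊢
    nlinarith)
  rw [e1, e2] at h3
  have h4 := fub_lower (p := p) (K := K) (ann N θ θ0) g h hg0 hgi hIntg2 l (Eventually.of_forall fun ξ hξ => by
    have : dist ξ P ≤ r := by by_contra hc; exact hξ (hgs ξ (not_le.1 hc))
    exact hl ξ.1 ((le_max_left _ _).trans this))
  linarith

set_option maxHeartbeats 1000000 in
theorem visc {N : ℕ} (hN : 1 ≤ N) {p s lam Lam : ℝ} (hp : 1 < p) (hs : s ∈ Ioo (0 : ℝ) 1) (hLam : 0 < Lam)
    {K : Euc N → ℝ} (hK : IsKernel N p s lam Lam K)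
    {f : Euc N × ℝ → ℝ} (hf : Good N p s K f) (P : Euc N × ℝ)
    (hP2 : -2 < P.2) (hP3 : P.2 < 0)
    (U : Euc N × ℝ → ℝ) (hU : Continuous U) (hU1 : ∀ ξ, |U ξ| ≤ 1)
    (hUf : ∀ ξ, ‖ξ.1‖ < 2 → -2 < ξ.2 → ξ.2 < 0 → U ξ = f ξ)
    (ψ0 : Euc N → ℝ) (hψ : Continuous ψ0) (ρ0 Λ0 : ℝ) (hρ0 : 0 < ρ0) (hΛ0 : 0 ≤ Λ0)
    (hLip : ∀ x y, dist x P.1 < ρ0 → dist y P.1 < ρ0 → |ψ0 x - ψ0 y| ≤ Λ0 * ‖x - y‖)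
    (η η' : ℝ → ℝ) (hη : ∀ t, HasDerivAt η (η' t) t) (hη' : Continuous η')
    (hmax : ∀ ξ, U ξ - (ψ0 ξ.1 + η ξ.2) ≤ U P - (ψ0 P.1 + η P.2))
    (θ0 d : ℝ) (hθ0 : 0 < θ0) (hd : θ0 ≤ d) (hPθ : ‖P.1‖ + θ0 < 2)
    (R C3 : ℝ) (hR : ‖P.1‖ < R) (hC3 : 0 ≤ C3)
    (hfar : ∀ᵐ t : ℝ, -2 < t → t < 0 → ∀ x : Euc N, ‖x‖ ≤ R →
        ∫⁻ z in {z : Euc N | d ≤ ‖z‖}, ENNReal.ofReal (|Jp p (f (x, t) - f (x + z, t))| * K z) ≤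
          ENNReal.ofReal C3)
    (Nx : ℝ) (hNx : ∀ x, dist x P.1 < ρ0 → ∀ θ, 0 < θ → θ < θ0 →
      -Nx ≤ ∫ z in ann N θ θ0, Jp p ((ψ0 x + ‖x - P.1‖ ^ 2) - (ψ0 (x + z) + ‖x + z - P.1‖ ^ 2)) * K z) :
    η' P.2 + (∫ z in ann N θ0 d, Jp p (f P - f (sh P z)) * K z) - Nx - C3 ≤ 0 := by
  by_contra hcon
  push Not at hcon
  set mid : Euc N × ℝ → ℝ := fun ξ => ∫ z in ann N θ0 d, JJ p K f (z, ξ) with hmid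
  change 0 < η' P.2 + mid P - Nx - C3 at hcon
  set β := (η' P.2 + mid P - Nx - C3) / 4 with hβ
  have hβ0 : 0 < β := by rw [hβ]; linarith
  set ψ1 : Euc N → ℝ := fun x => ψ0 x + ‖x - P.1‖ ^ 2 with hψ1
  have hψ1c : Continuous ψ1 := by fun_prop
  set k0 := U P - (ψ0 P.1 + η P.2) with hk0
  set η1 : ℝ → ℝ := fun t => η t + (t - P.2) ^ 2 + k0 with hη1
  set η1' : ℝ → ℝ := fun t => η' t + 2 * (t - P.2) with hη1'
  have hη1d : ∀ t, HasDerivAt η1 (η1' t) t := by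
    intro t
    have h1 : HasDerivAt (fun t : ℝ => (t - P.2) ^ 2) (2 * (t - P.2)) t := by
      have := ((hasDerivAt_id t).sub_const P.2).pow 2
      simpa using! this
    exact ((hη t).add h1).add_const k0
  have hη1c : Continuous η1' := by fun_prop
  have hmidc : ContinuousAt mid P := mid_cont hp hs.1 hLam hK hf.cont P θ0 d hθ0
  have ev1 : ∀ᶠ ξ in 𝓝 P, mid P - β < mid ξ := hmidc.eventually (lt_mem_nhds (by linarith))
  have ev2 : ∀ᶠ ξ : Euc N × ℝ in 𝓝 P, η' P.2 - β < η1' ξ.2 := by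
    have h5 : ContinuousAt (fun ξ : Euc N × ℝ => η1' ξ.2) P := (hη1c.comp continuous_snd).continuousAt
    apply h5.eventually (lt_mem_nhds _)
    simp only [hη1', sub_self]; linarith
  obtain ⟨r0, hr0, hev⟩ := Metric.eventually_nhds_iff_ball.1 (ev1.and ev2)
  obtain ⟨r, hr, hrr0, hr1, hrρ, hrR, hrθ, hrt1, hrt2⟩ : ∃ r : ℝ, 0 < r ∧ r < r0 ∧ r ≤ 1 ∧ 3 * r ≤ ρ0 ∧ r ≤ R - ‖P.1‖ ∧
      4 * r < 2 - ‖P.1‖ - θ0 ∧ 4 * r < P.2 + 2 ∧ 4 * r < -P.2 := by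
    have hpos : 0 < min (min (min r0 1) (min ρ0 (R - ‖P.1‖))) (min (2 - ‖P.1‖ - θ0) (min (P.2 + 2) (-P.2))) := by
      simp only [lt_min_iff]
      refine ⟨⟨⟨hr0, one_pos⟩, hρ0, by linarith⟩, by linarith, by linarith, by linarith⟩
    set M := min (min (min r0 1) (min ρ0 (R - ‖P.1‖))) (min (2 - ‖P.1‖ - θ0) (min (P.2 + 2) (-P.2))) with hM
    have hle : M ≤ M := le_rfl
    nth_rewrite 2 [hM] at hle
    simp only [le_min_iff] at hle
    obtain ⟨⟨⟨a1, a2⟩, a3, a4⟩, a5, a6, a7⟩ := hle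
    exact ⟨M / 5, by linarith, by linarith, by linarith, by linarith, by linarith, by linarith, by linarith, by linarith⟩
  set c := r ^ 2 / 4 with hc
  have hc0 : 0 < c := by positivity
  set g : Euc N × ℝ → ℝ := fun ξ => max (U ξ - (ψ1 ξ.1 + η1 ξ.2) + c) 0 with hg
  have hηc : Continuous η1 := continuous_iff_continuousAt.2 fun t => (hη1d t).continuousAt
  have hgc : Continuous g := by rw [hg]; fun_prop
  have hmax1 : ∀ ξ, U ξ - (ψ1 ξ.1 + η1 ξ.2) ≤ -dist ξ P ^ 2 := by
    intro ξ
    have h5 := hmax ξ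
    have h6 : dist ξ P ^ 2 ≤ ‖ξ.1 - P.1‖ ^ 2 + (ξ.2 - P.2) ^ 2 := by
      rw [Prod.dist_eq, dist_eq_norm, Real.dist_eq]
      rcases max_cases ‖ξ.1 - P.1‖ |ξ.2 - P.2| with h | h
      · rw [h.1]; nlinarith [sq_nonneg (ξ.2 - P.2)]
      · rw [h.1, sq_abs]; nlinarith [sq_nonneg ‖ξ.1 - P.1‖]
    simp only [hψ1, hη1]
    linarith
  have hg0 : ∀ ξ, 0 ≤ g ξ := fun ξ => le_max_right _ _
  have hgs : ∀ ξ, r < dist ξ P → g ξ = 0 := by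
    intro ξ hξ
    have := hmax1 ξ
    have h2 : r ^ 2 < dist ξ P ^ 2 := by gcongr
    simp only [hg]
    apply max_eq_right
    nlinarith
  have hgle : ∀ ξ, |g ξ| ≤ c := by
    intro ξ
    rw [abs_of_nonneg (hg0 ξ)]
    apply max_le _ hc0.le
    have := hmax1 ξ
    nlinarith [sq_nonneg (dist ξ P)]
  have hgne : ∀ ξ, g ξ ≠ 0 → dist ξ P ≤ r := fun ξ h => by by_contra hc; exact h (hgs ξ (not_le.1 hc))
  have hcs : HasCompactSupport g := HasCompactSupport.intro (isCompact_closedBall P r) fun ξ hξ => by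
    apply hgs; simpa using hξ
  have hgi : Integrable g := hgc.integrable_of_hasCompactSupport hcs
  have hgP : g P ≠ 0 := by
    have : g P = c := by
      have e : U P - (ψ1 P.1 + η1 P.2) = 0 := by
        simp only [hψ1, hη1, hk0, sub_self, norm_zero]; ring
      simp only [hg]
      rw [e, zero_add, max_eq_left hc0.le]
    rw [this]; exact hc0.ne'
  set G := ∫ ξ, g ξ with hGd
  have hG : 0 < G := hgc.integral_pos_of_hasCompactSupport_nonneg_nonzero hcs hg0 hgP
  have hLip1 : ∀ x y, dist x P.1 < 3 * r → dist y P.1 < 3 * r → |ψ1 x - ψ1 y| ≤ (Λ0 + 6) * ‖x - y‖ := by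
    intro x y hx hy
    have h5 := hLip x y (by linarith) (by linarith)
    rw [dist_eq_norm] at hx hy
    have h6 : |‖x - P.1‖ - ‖y - P.1‖| ≤ ‖x - y‖ := by
      have := abs_norm_sub_norm_le (x - P.1) (y - P.1)
      simpa using this
    have e : ψ1 x - ψ1 y = (ψ0 x - ψ0 y) + (‖x - P.1‖ - ‖y - P.1‖) * (‖x - P.1‖ + ‖y - P.1‖) := by
      simp only [hψ1]; ring
    rw [e]
    refine (abs_add_le _ _).trans ?_
    rw [abs_mul, abs_of_nonneg (by positivity : 0 ≤ ‖x - P.1‖ + ‖y - P.1‖)]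
    have h7 : |‖x - P.1‖ - ‖y - P.1‖| * (‖x - P.1‖ + ‖y - P.1‖) ≤ ‖x - y‖ * 6 :=
      mul_le_mul h6 (by linarith) (by positivity) (norm_nonneg _)
    linarith
  have hUf' : ∀ ξ, ‖ξ.1‖ < 2 → -2 < ξ.2 → ξ.2 < 0 → U ξ = f ξ := hUf
  have hUr : ∀ ξ, dist ξ P ≤ 4 * r → U ξ = f ξ := by
    intro ξ hξ
    rw [Prod.dist_eq, max_le_iff, Real.dist_eq, dist_eq_norm, abs_le] at hξ
    have : ‖ξ.1‖ ≤ ‖ξ.1 - P.1‖ + ‖P.1‖ := by simpa using norm_add_le (ξ.1 - P.1) P.1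
    exact hUf ξ (by linarith [hξ.1]) (by linarith [hξ.2.1]) (by linarith [hξ.2.2])
  obtain ⟨θ1, hθ1, hθ1r, hlim⟩ := limit_ineq hN hp hs hLam hK hf P r hr hr1 (by linarith) (by linarith) (by linarith)
    U hU hU1 hUr ψ1 hψ1c η1 η1' hη1d hη1c c (Λ0 + 6) hc0 le_rfl (by linarith) hLip1 hmax1 g rfl (β * G) (by positivity)
  set θ := min θ1 (θ0 / 2) with hθ
  have hθp : 0 < θ := by positivity
  have hθθ0 : θ < θ0 := (min_le_right _ _).trans_lt (by linarith)
  have hlim := hlim θ hθp (min_le_left _ _)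
  -- integrability on the far set
  obtain ⟨C, hC, hfarθ⟩ := far_bound N (lam := lam) hp hs.1 hLam (‖P.1‖ + r) θ (by linarith) hθp
  have hFI : IntegrableOn (fun q : Euc N × (Euc N × ℝ) => g q.2 * JJ p K f q) (Prod.fst ⁻¹' {z : Euc N | θ ≤ ‖z‖}) (volume.prod volume) := by
    refine ⟨((hgc.measurable.comp measurable_snd).mul (JJ_meas hK hf.cont)).aestronglyMeasurable, ?_⟩
    refine lt_of_le_of_lt (far_lint hK hf.cont θ C c r hθp hc0.le P (hfarθ K hK f hf) (by linarith) (by linarith) g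
      hgc.measurable hgle hgs) ?_
    exact ENNReal.mul_lt_top (ENNReal.mul_lt_top ENNReal.ofReal_lt_top ENNReal.ofReal_lt_top) measure_closedBall_lt_top
  -- splitting
  have hset : (Prod.fst ⁻¹' {z : Euc N | θ ≤ ‖z‖} : Set (Euc N × (Euc N × ℝ))) =
      Prod.fst ⁻¹' (ann N θ θ0) ∪ (Prod.fst ⁻¹' (ann N θ0 d) ∪ Prod.fst ⁻¹' {z : Euc N | d ≤ ‖z‖}) := by
    ext q
    simp only [ann, mem_preimage, mem_ofPred_eq, mem_union]
    constructor
    · intro h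
      by_cases h1 : ‖q.1‖ < θ0
      · exact Or.inl ⟨h, h1⟩
      · by_cases h2 : ‖q.1‖ < d
        · exact Or.inr (Or.inl ⟨not_lt.1 h1, h2⟩)
        · exact Or.inr (Or.inr (not_lt.1 h2))
    · rintro (h | h | h)
      · exact h.1
      · linarith [h.1]
      · linarith
  have hm1 : MeasurableSet (Prod.fst ⁻¹' (ann N θ0 d) : Set (Euc N × (Euc N × ℝ))) := measurable_fst (ann_meas _ _ _)
  have hm2 : MeasurableSet (Prod.fst ⁻¹' {z : Euc N | d ≤ ‖z‖} : Set (Euc N × (Euc N × ℝ))) :=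
    measurable_fst (measurableSet_le measurable_const measurable_norm)
  rw [hset] at hlim hFI
  have I1 := hFI.left_of_union
  have I23 := hFI.right_of_union
  have I2 := I23.left_of_union
  have I3 := I23.right_of_union
  rw [setIntegral_union _ (hm1.union hm2) I1 I23, setIntegral_union _ hm2 I2 I3] at hlim
  rotate_left
  · rw [Set.disjoint_left]
    intro q h1 h2
    exact absurd (show q.1 ∈ ann N θ0 d from h1).2 (not_lt.2 h2)
  · rw [Set.disjoint_left]
    rintro q h1 (h2 | h2)
    · exact absurd (show q.1 ∈ ann N θ θ0 from h1).2 (not_lt.2 (show q.1 ∈ ann N θ0 d from h2).1)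
    · exact absurd (show q.1 ∈ ann N θ θ0 from h1).2 (not_lt.2 (hd.trans h2))
  have B1 : -Nx * G ≤ ∫ q in Prod.fst ⁻¹' (ann N θ θ0), g q.2 * JJ p K f q ∂(volume.prod volume) := by
    refine cmp_ann hp hs.1 hLam hK ψ1 hψ1c P r θ θ0 hθp g hgc hg0 hgs ?_ I1 (-Nx) ?_
    · intro ξ z hz
      by_cases hz0 : g ξ = 0 ∧ g (sh ξ z) = 0
      · rw [hz0.1, hz0.2]; simp
      have hdd : ‖ξ.1 - P.1‖ ≤ r + θ0 ∧ ‖ξ.1 + z - P.1‖ ≤ r + θ0 ∧ |ξ.2 - P.2| ≤ r := by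
        have key : dist ξ P ≤ r ∨ dist (sh ξ z) P ≤ r := by
          by_contra hcc; push Not at hcc
          exact hz0 ⟨hgs _ hcc.1, hgs _ hcc.2⟩
        rw [Prod.dist_eq, Prod.dist_eq, max_le_iff, max_le_iff, Real.dist_eq, Real.dist_eq, dist_eq_norm, dist_eq_norm] at key
        simp only [sh] at key
        rcases key with ⟨h, h'⟩ | ⟨h, h'⟩
        · refine ⟨by linarith, ?_, h'⟩
          have e : ξ.1 + z - P.1 = (ξ.1 - P.1) + z := by abel
          rw [e]; exact (norm_add_le _ _).trans (by linarith)
        · refine ⟨?_, by linarith, h'⟩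
          have e : ξ.1 - P.1 = (ξ.1 + z - P.1) - z := by abel
          rw [e]; exact (norm_sub_le _ _).trans (by linarith)
      rw [abs_le] at hdd
      have u1 : U ξ = f ξ := by
        have : ‖ξ.1‖ ≤ ‖ξ.1 - P.1‖ + ‖P.1‖ := by simpa using norm_add_le (ξ.1 - P.1) P.1
        exact hUf ξ (by linarith [hdd.1]) (by linarith [hdd.2.2.1]) (by linarith [hdd.2.2.2])
      have u2 : U (sh ξ z) = f (sh ξ z) := by
        have : ‖ξ.1 + z‖ ≤ ‖ξ.1 + z - P.1‖ + ‖P.1‖ := by simpa using norm_add_le (ξ.1 + z - P.1) P.1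
        exact hUf (sh ξ z) (show ‖ξ.1 + z‖ < 2 by linarith [hdd.2.1]) (show -2 < ξ.2 by linarith [hdd.2.2.1])
          (show ξ.2 < 0 by linarith [hdd.2.2.2])
      have hgx : g ξ = max (f ξ - (ψ1 ξ.1 + η1 ξ.2) + c) 0 := by rw [← u1]
      have hgz : g (sh ξ z) = max (f (sh ξ z) - (ψ1 (ξ.1 + z) + η1 ξ.2) + c) 0 := by rw [← u2]; rfl
      rcases le_total (f ξ - f (sh ξ z)) (ψ1 ξ.1 - ψ1 (ξ.1 + z)) with h | h
      · apply mul_nonneg_of_nonpos_of_nonpos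
        · rw [hgx, hgz, sub_nonpos]; apply max_le_max _ le_rfl; linarith
        · exact sub_nonpos.2 (Jp_mono hp h)
      · apply mul_nonneg
        · rw [hgx, hgz, sub_nonneg]; apply max_le_max _ le_rfl; linarith
        · exact sub_nonneg.2 (Jp_mono hp h)
    · intro x hx
      exact hNx x (by linarith) θ hθp hθθ0
  have B2 : (mid P - β) * G ≤ ∫ q in Prod.fst ⁻¹' (ann N θ0 d), g q.2 * JJ p K f q ∂(volume.prod volume) := by
    refine fub_lower _ g f hg0 hgi I2 _ (Eventually.of_forall fun ξ hξ => ?_)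
    exact (hev ξ (by rw [mem_ball]; linarith [hgne ξ hξ])).1.le
  have B3 : -C3 * G ≤ ∫ q in Prod.fst ⁻¹' {z : Euc N | d ≤ ‖z‖}, g q.2 * JJ p K f q ∂(volume.prod volume) := by
    refine fub_lower _ g f hg0 hgi I3 _ ?_
    filter_upwards [ae_snd hfar] with ξ hξ hgξ
    have hdξ := hgne ξ hgξ
    rw [Prod.dist_eq, max_le_iff, Real.dist_eq, dist_eq_norm, abs_le] at hdξ
    have hx : ‖ξ.1‖ ≤ ‖ξ.1 - P.1‖ + ‖P.1‖ := by simpa using norm_add_le (ξ.1 - P.1) P.1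
    have h5 := hξ (by linarith [hdξ.2.1]) (by linarith [hdξ.2.2]) ξ.1 (by linarith [hdξ.1])
    have h6 : |∫ z in {z : Euc N | d ≤ ‖z‖}, JJ p K f (z, ξ)| ≤ C3 := by
      apply integral_lower hC3
      refine le_trans ?_ h5
      refine setLIntegral_mono' (measurableSet_le measurable_const measurable_norm) fun z hz => ?_
      have hk := IsKernel.bdd hK (mul_nonneg hs.1.le (by linarith)) hLam.le (hθ0.trans_le hd) hz
      rw [← ofReal_norm, JJ, norm_mul, Real.norm_of_nonneg hk.1, Real.norm_eq_abs]
      rfl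
    exact (abs_le.1 h6).1
  have B0 : (η' P.2 - β) * G ≤ ∫ ξ : Euc N × ℝ, η1' ξ.2 * g ξ := by
    rw [hGd, ← integral_const_mul]
    apply integral_mono (hgi.const_mul _)
    · refine Continuous.integrable_of_hasCompactSupport (by fun_prop) (HasCompactSupport.intro (isCompact_closedBall P r) fun ξ hξ => ?_)
      rw [hgs ξ (by simpa using hξ), mul_zero]
    · intro ξ
      dsimp only
      by_cases h : g ξ = 0
      · simp [h]
      · exact mul_le_mul_of_nonneg_right (hev ξ (by rw [mem_ball]; linarith [hgne ξ h])).2.le (hg0 ξ)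
  have : (η' P.2 + mid P - Nx - C3 - 2 * β) * G ≤ β * G := by nlinarith
  have h9 : η' P.2 + mid P - Nx - C3 - 2 * β ≤ β := le_of_mul_le_mul_right this hG
  linarith

theorem norm_rpow_quad {N : ℕ} {γ : ℝ} (h0 : 0 < γ) (h1 : γ < 1) (a z : Euc N) (ha : a ≠ 0) :
    ‖a + z‖ ^ γ ≤ ‖a‖ ^ γ + γ * ‖a‖ ^ (γ - 2) * inner ℝ a z + γ / 2 * ‖a‖ ^ (γ - 2) * ‖z‖ ^ 2 := by
  have hA : 0 < ‖a‖ := norm_pos_iff.2 ha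
  set s := (2 * inner ℝ a z + ‖z‖ ^ 2) / ‖a‖ ^ 2 with hs
  have hX : ‖a + z‖ ^ 2 = ‖a‖ ^ 2 * (1 + s) := by
    rw [norm_add_sq_real, hs]; field_simp
    ring
  have hs1 : -1 ≤ s := by
    have : 0 ≤ ‖a‖ ^ 2 * (1 + s) := by rw [← hX]; positivity
    have := nonneg_of_mul_nonneg_right this (by positivity)
    linarith
  have hb := rpow_one_add_le_one_add_mul_self hs1 (by positivity : 0 ≤ γ / 2) (by linarith)
  have e1 : ∀ y : ℝ, 0 ≤ y → y ^ γ = (y ^ 2) ^ (γ / 2) := by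
    intro y hy
    rw [← Real.rpow_natCast y 2, ← Real.rpow_mul hy]; congr 1; push_cast; ring
  have e2 : ‖a‖ ^ γ = ‖a‖ ^ (γ - 2) * ‖a‖ ^ 2 := by
    rw [← Real.rpow_natCast ‖a‖ 2, ← Real.rpow_add hA]; congr 1; push_cast; ring
  calc ‖a + z‖ ^ γ = (‖a‖ ^ 2 * (1 + s)) ^ (γ / 2) := by rw [e1 _ (norm_nonneg _), hX]
    _ = ‖a‖ ^ γ * (1 + s) ^ (γ / 2) := by rw [Real.mul_rpow (by positivity) (by linarith), ← e1 _ hA.le]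
    _ ≤ ‖a‖ ^ γ * (1 + γ / 2 * s) := by gcongr
    _ = ‖a‖ ^ γ + γ / 2 * (‖a‖ ^ (γ - 2) * (‖a‖ ^ 2 * s)) := by rw [e2]; ring
    _ = _ := by
      have : ‖a‖ ^ 2 * s = 2 * inner ℝ a z + ‖z‖ ^ 2 := by rw [hs]; field_simp
      rw [this]; ring

set_option maxHeartbeats 1000000 in
theorem tiny_test (N : ℕ) (hN : 1 ≤ N) {p s lam Lam γ : ℝ} (hp : 1 < p) (hs : s ∈ Ioo (0:ℝ) 1)
    (hLam : 0 < Lam) (h0 : 0 < γ) (h1 : γ < 1) :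
    ∃ Ct : ℝ, 0 < Ct ∧ ∀ M : ℝ, 0 ≤ M → ∃ L1 : ℝ, 0 < L1 ∧ ∀ L, L1 ≤ L → ∀ K : Euc N → ℝ, IsKernel N p s lam Lam K →
      ∀ (w x0 xb x : Euc N) (δ : ℝ), xb - w ≠ 0 → ‖xb - w‖ ≤ 1 / 2 → ‖x - xb‖ ≤ ‖xb - w‖ / 2 → ‖x - x0‖ ≤ 1 →
        0 < δ → δ ≤ 1 / 8 → ∀ θ, 0 < θ →
        -(Ct * δ ^ (p - s * p) * L ^ (p - 1) * ‖xb - w‖ ^ (γ * (p - 1) - s * p)) ≤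
          ∫ z in ann N θ (δ * ‖xb - w‖), Jp p ((L * ‖x - w‖ ^ γ + M * ‖x - x0‖ ^ 2 + ‖x - xb‖ ^ 2)
            - (L * ‖x + z - w‖ ^ γ + M * ‖x + z - x0‖ ^ 2 + ‖x + z - xb‖ ^ 2)) * K z := by
  obtain ⟨C, hC, htiny⟩ := tiny_bound N hN (lam := lam) hp hs hLam
  refine ⟨C * 2 ^ |p - 2| * 2 ^ p, by positivity, fun M hM => ⟨(4 * M + 4) / γ, by positivity, ?_⟩⟩
  intro L hL K hK w x0 xb x δ ha ha2 hx hx0 hδ hδ8 θ hθ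
  set a := xb - w with hadef
  have hA : 0 < ‖a‖ := norm_pos_iff.2 ha
  set a' := x - w with ha'
  have e' : a' = a + (x - xb) := by rw [ha', hadef]; abel
  have hl : ‖a‖ / 2 ≤ ‖a'‖ := by
    have := norm_sub_norm_le a (-(x - xb))
    rw [sub_neg_eq_add, ← e', norm_neg] at this
    linarith
  have hu : ‖a'‖ ≤ 1 := by
    rw [e']; exact (norm_add_le _ _).trans (by linarith)
  have hA' : 0 < ‖a'‖ := by linarith
  have ha'0 : a' ≠ 0 := norm_pos_iff.1 hA'
  have hLg : 4 * M + 4 ≤ L * γ := by rwa [div_le_iff₀ h0] at hL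
  have hL0 : 0 < L := lt_of_lt_of_le (by positivity) hL
  set k := L * γ * ‖a'‖ ^ (γ - 2) with hk
  have hk1 : L * γ ≤ k := by
    have : 1 ≤ ‖a'‖ ^ (γ - 2) := Real.one_le_rpow_of_pos_of_le_one_of_nonpos hA' hu (by linarith)
    have h5 : 0 ≤ L * γ := by positivity
    nlinarith
  have hkp : 0 < k := by positivity
  have hka : k * ‖a'‖ = L * γ * ‖a'‖ ^ (γ - 1) := by
    rw [hk, mul_assoc]; congr 1
    nth_rewrite 2 [← Real.rpow_one ‖a'‖]
    rw [← Real.rpow_add hA']; congr 1; ring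
  have hka1 : L * γ ≤ k * ‖a'‖ := by
    rw [hka]
    have : 1 ≤ ‖a'‖ ^ (γ - 1) := Real.one_le_rpow_of_pos_of_le_one_of_nonpos hA' hu (by linarith)
    have h5 : 0 ≤ L * γ := by positivity
    nlinarith
  set q := k • a' + (2 * M) • (x - x0) + (2 : ℝ) • (x - xb) with hq
  set b := k / 2 + M + 1 with hb
  have hbk : b ≤ k := by rw [hb]; linarith
  have hrest : ‖(2 * M) • (x - x0) + (2 : ℝ) • (x - xb)‖ ≤ k * ‖a'‖ / 2 := by
    refine (norm_add_le _ _).trans ?_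
    rw [norm_smul, norm_smul, Real.norm_of_nonneg (by positivity), Real.norm_of_nonneg (by norm_num)]
    have : 2 * M * ‖x - x0‖ ≤ 2 * M * 1 := by gcongr
    linarith
  have hq1 : k * ‖a'‖ / 2 ≤ ‖q‖ := by
    have h5 := norm_sub_norm_le (k • a') (-((2 * M) • (x - x0) + (2 : ℝ) • (x - xb)))
    rw [sub_neg_eq_add, norm_neg, ← add_assoc, ← hq, norm_smul, Real.norm_of_nonneg hkp.le] at h5
    linarith
  have hq2 : ‖q‖ ≤ 2 * (k * ‖a'‖) := by
    rw [hq, add_assoc]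
    refine (norm_add_le _ _).trans ?_
    rw [norm_smul, Real.norm_of_nonneg hkp.le]
    nlinarith
  have hqp : 0 < ‖q‖ := lt_of_lt_of_le (by positivity) hq1
  set θ₀ := δ * ‖a‖ with hθ₀
  have hθ₀p : 0 < θ₀ := by positivity
  have hbθ : b * θ₀ ≤ ‖q‖ := by
    have h6 : θ₀ ≤ ‖a'‖ / 4 := by
      rw [hθ₀]; nlinarith
    calc b * θ₀ ≤ k * (‖a'‖ / 4) := mul_le_mul hbk h6 hθ₀p.le hkp.le
      _ ≤ _ := by nlinarith [mul_pos hkp hA']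
  have hb0 : 0 ≤ b := by positivity
  have hψc : Continuous fun x : Euc N => L * ‖x - w‖ ^ γ + M * ‖x - x0‖ ^ 2 + ‖x - xb‖ ^ 2 := by
    have : Continuous fun x : Euc N => ‖x - w‖ ^ γ := (by fun_prop : Continuous fun x : Euc N => ‖x - w‖).rpow_const fun _ => Or.inr h0.le
    fun_prop
  have hmain := htiny K hK (fun x => L * ‖x - w‖ ^ γ + M * ‖x - x0‖ ^ 2 + ‖x - xb‖ ^ 2) x q b θ₀ hψc
    (norm_pos_iff.1 hqp) hb0 hθ₀p hbθ ?_ θ hθ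
  · refine le_trans (neg_le_neg ?_) hmain
    have f1 : ‖q‖ ^ (p - 2) ≤ 2 ^ |p - 2| * (k * ‖a'‖) ^ (p - 2) := by
      have hka0 : 0 < k * ‖a'‖ := by positivity
      rcases le_total 2 p with h | h
      · rw [abs_of_nonneg (by linarith), ← Real.mul_rpow (by norm_num) hka0.le]
        exact Real.rpow_le_rpow hqp.le hq2 (by linarith)
      · rw [abs_of_nonpos (by linarith), Real.rpow_neg (by norm_num), ← Real.inv_rpow (by norm_num),
          ← Real.mul_rpow (by norm_num) hka0.le]
        exact Real.rpow_le_rpow_of_nonpos (by positivity) (by linarith) (by linarith)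
    have f2 : (k * ‖a'‖) ^ (p - 2) * k = (L * γ) ^ (p - 1) * ‖a'‖ ^ (γ * (p - 1) - p) := by
      rw [hka, Real.mul_rpow (by positivity) (by positivity), hk, ← Real.rpow_mul hA'.le]
      have g1 : (L * γ) ^ (p - 1) = (L * γ) ^ (p - 2) * (L * γ) := by
        have : 0 < L * γ := by positivity
        nth_rewrite 3 [← Real.rpow_one (L * γ)]
        rw [← Real.rpow_add this]; congr 1; ring
      have g2 : ‖a'‖ ^ (γ * (p - 1) - p) = ‖a'‖ ^ ((γ - 1) * (p - 2)) * ‖a'‖ ^ (γ - 2) := by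
        rw [← Real.rpow_add hA']; congr 1; ring
      rw [g1, g2]; ring
    have hgp : γ * (p - 1) ≤ p - 1 := by nlinarith
    have hgp0 : 0 ≤ γ * (p - 1) := mul_nonneg h0.le (by linarith)
    have f3 : ‖a'‖ ^ (γ * (p - 1) - p) ≤ 2 ^ p * ‖a‖ ^ (γ * (p - 1) - p) := by
      calc ‖a'‖ ^ (γ * (p - 1) - p) ≤ (‖a‖ / 2) ^ (γ * (p - 1) - p) :=
            Real.rpow_le_rpow_of_nonpos (by positivity) hl (by linarith)
        _ = 2 ^ (p - γ * (p - 1)) * ‖a‖ ^ (γ * (p - 1) - p) := by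
            rw [Real.div_rpow hA.le (by norm_num), div_eq_mul_inv, ← Real.rpow_neg (by norm_num)]
            rw [mul_comm]; congr 2; ring
        _ ≤ _ := by
            gcongr
            · norm_num
            · linarith
    have f4 : (L * γ) ^ (p - 1) ≤ L ^ (p - 1) := by
      apply Real.rpow_le_rpow (by positivity) (by nlinarith) (by linarith)
    have f5 : θ₀ ^ (p - s * p) = δ ^ (p - s * p) * ‖a‖ ^ (p - s * p) := Real.mul_rpow hδ.le hA.le
    have f6 : ‖a‖ ^ (γ * (p - 1) - s * p) = ‖a‖ ^ (γ * (p - 1) - p) * ‖a‖ ^ (p - s * p) := by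
      rw [← Real.rpow_add hA]; congr 1; ring
    calc C * ‖q‖ ^ (p - 2) * b * θ₀ ^ (p - s * p)
        ≤ C * (2 ^ |p - 2| * (k * ‖a'‖) ^ (p - 2)) * k * θ₀ ^ (p - s * p) := by gcongr
      _ = C * 2 ^ |p - 2| * ((k * ‖a'‖) ^ (p - 2) * k) * θ₀ ^ (p - s * p) := by ring
      _ ≤ C * 2 ^ |p - 2| * (L ^ (p - 1) * (2 ^ p * ‖a‖ ^ (γ * (p - 1) - p))) * θ₀ ^ (p - s * p) := by
          rw [f2]; gcongr
      _ = _ := by rw [f5, f6]; ring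
  · intro z _
    have g1 := norm_rpow_quad h0 h1 a' z ha'0
    have e1 : x + z - w = a' + z := by rw [ha']; abel
    have e2 : x + z - x0 = (x - x0) + z := by abel
    have e3 : x + z - xb = (x - xb) + z := by abel
    rw [e1, e2, e3, norm_add_sq_real, norm_add_sq_real, hq, inner_add_left, inner_add_left, inner_smul_left,
      inner_smul_left, inner_smul_left]
    simp only [conj_trivial]
    have g2 := mul_le_mul_of_nonneg_left g1 hL0.le
    have e4 : L * (‖a'‖ ^ γ + γ * ‖a'‖ ^ (γ - 2) * inner ℝ a' z + γ / 2 * ‖a'‖ ^ (γ - 2) * ‖z‖ ^ 2) =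
      L * ‖a'‖ ^ γ + k * inner ℝ a' z + k / 2 * ‖z‖ ^ 2 := by rw [hk]; ring
    rw [e4] at g2
    rw [hb]
    linarith

theorem lip_psi {N : ℕ} (γ L M : ℝ) (w x0 xb : Euc N) (h : xb - w ≠ 0) :
    ∃ ρ Λ : ℝ, 0 < ρ ∧ 0 ≤ Λ ∧ ∀ x y : Euc N, dist x xb < ρ → dist y xb < ρ →
      |(L * ‖x - w‖ ^ γ + M * ‖x - x0‖ ^ 2) - (L * ‖y - w‖ ^ γ + M * ‖y - x0‖ ^ 2)| ≤ Λ * ‖x - y‖ := by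
  have hc : ContDiffAt ℝ 1 (fun x : Euc N => L * ‖x - w‖ ^ γ + M * ‖x - x0‖ ^ 2) xb := by
    have h1 : ContDiffAt ℝ 1 (fun x : Euc N => ‖x - w‖) xb :=
      (contDiffAt_id.sub contDiffAt_const).norm ℝ h
    have h2 : ContDiffAt ℝ 1 (fun x : Euc N => ‖x - w‖ ^ γ) xb :=
      h1.rpow_const_of_ne (norm_ne_zero_iff.2 h)
    have h3 : ContDiffAt ℝ 1 (fun x : Euc N => ‖x - x0‖ ^ 2) xb :=
      (contDiffAt_id.sub contDiffAt_const).norm_sq ℝ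
    exact (contDiffAt_const.mul h2).add (contDiffAt_const.mul h3)
  obtain ⟨k, t, ht, hl⟩ := hc.exists_lipschitzOnWith
  obtain ⟨ρ, hρ, hb⟩ := Metric.mem_nhds_iff.1 ht
  refine ⟨ρ, k, hρ, k.2, fun x y hx hy => ?_⟩
  have := hl.dist_le_mul x (hb hx) y (hb hy)
  rwa [Real.dist_eq, dist_eq_norm] at this

theorem jp_loss {p κ γ : ℝ} (hp : 1 < p) (h0 : 0 < γ) (h1 : γ < 1)
    (hc : (2 ≤ p ∧ γ * (p - 1) ≤ κ * (p - 2) + 1) ∨ p ≤ 2) (Lk E : ℝ) (hLk : 0 ≤ Lk) (hE : 0 ≤ E) :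
    ∃ C2 : ℝ, 0 ≤ C2 ∧ ∀ r, 0 < r → r ≤ 1 → ∀ A B, |A| ≤ Lk * r ^ κ → |B| ≤ Lk * r ^ κ →
      B - E * r ≤ A → -(C2 * r ^ (γ * (p - 1))) ≤ Jp p A - Jp p B := by
  rcases hc with ⟨hp2, hg⟩ | hp2
  · refine ⟨2 * (p - 1) * Lk ^ (p - 2) * E, mul_nonneg (mul_nonneg (by linarith) (by positivity)) hE, ?_⟩
    intro r hr hr1 A B hA hB hAB
    have hnn : 0 ≤ 2 * (p - 1) * Lk ^ (p - 2) * E :=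
      mul_nonneg (mul_nonneg (by linarith) (by positivity)) hE
    rcases le_total B A with h | h
    · have := Jp_mono hp h
      have : 0 ≤ 2 * (p - 1) * Lk ^ (p - 2) * E * r ^ (γ * (p - 1)) := by positivity
      linarith
    · have h3 := Jp_sub_le_of_two_le hp2 h hB hA
      have hX : 0 ≤ (Lk * r ^ κ) ^ (p - 2) := by positivity
      have h4 : 2 * (p - 1) * (Lk * r ^ κ) ^ (p - 2) * (B - A) ≤
          2 * (p - 1) * (Lk * r ^ κ) ^ (p - 2) * (E * r) := by
        apply mul_le_mul_of_nonneg_left (by linarith)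
        exact mul_nonneg (by linarith) hX
      have h5 : 2 * (p - 1) * (Lk * r ^ κ) ^ (p - 2) * (E * r) =
          2 * (p - 1) * Lk ^ (p - 2) * E * r ^ (κ * (p - 2) + 1) := by
        rw [Real.mul_rpow hLk (by positivity), ← Real.rpow_mul hr.le, Real.rpow_add hr, Real.rpow_one]; ring
      have h6 : r ^ (κ * (p - 2) + 1) ≤ r ^ (γ * (p - 1)) :=
        Real.rpow_le_rpow_of_exponent_ge hr hr1 hg
      have h7 := mul_le_mul_of_nonneg_left h6 hnn
      linarith
  · refine ⟨2 * E ^ (p - 1), by positivity, ?_⟩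
    intro r hr hr1 A B hA hB hAB
    rcases le_total B A with h | h
    · have := Jp_mono hp h
      have : 0 ≤ 2 * E ^ (p - 1) * r ^ (γ * (p - 1)) := by positivity
      linarith
    · have h3 := Jp_sub_le_of_le_two hp hp2 h
      have h4 : (B - A) ^ (p - 1) ≤ (E * r) ^ (p - 1) :=
        Real.rpow_le_rpow (by linarith) (by linarith) (by linarith)
      rw [Real.mul_rpow hE hr.le] at h4
      have h6 : r ^ (p - 1) ≤ r ^ (γ * (p - 1)) :=
        Real.rpow_le_rpow_of_exponent_ge hr hr1 (by nlinarith)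
      have h7 := mul_le_mul_of_nonneg_left h6 (by positivity : 0 ≤ E ^ (p - 1))
      linarith

theorem sq_pen {c a v : ℝ} (ha : 0 < a) (hv : 0 ≤ v) (h : 3 / a ^ 2 * v ^ 2 < 3) : v < a := by
  by_contra hcon
  push Not at hcon
  have : a ^ 2 ≤ v ^ 2 := by gcongr
  have h2 : 3 / a ^ 2 * a ^ 2 ≤ 3 / a ^ 2 * v ^ 2 := by gcongr
  rw [div_mul_cancel₀ _ (by positivity)] at h2
  linarith

/-- the doubled functional -/
def WW {N : ℕ} (U : Euc N × ℝ → ℝ) (γ L M M' H B : ℝ) (x0 : Euc N) (t0 : ℝ) (x y : Euc N) (t s : ℝ) : ℝ :=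
  U (x, t) - U (y, s) - (L * ‖x - y‖ ^ γ + M * ‖x - x0‖ ^ 2 +
    (M' * (t - t0) ^ 2 + H * (max (t - t0) 0) ^ 2) + B * (t - s) ^ 2)

theorem dbl_max {N : ℕ} (U : Euc N × ℝ → ℝ) (hU : Continuous U) (hU1 : ∀ ξ, |U ξ| ≤ 1) {γ L d ω t0 : ℝ}
    (x0 y0 : Euc N) (h0 : 0 < γ) (hL : 0 ≤ L) (hd : 0 < d) (hω : 0 < ω) (ht0 : t0 < 0) (hLd : 3 ≤ L * d ^ γ)
    (hm : 0 < U (x0, t0) - U (y0, t0) - L * ‖x0 - y0‖ ^ γ) :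
    ∃ H B : ℝ, 0 ≤ H ∧ 0 ≤ B ∧ ∃ xb yb : Euc N, ∃ tb sb : ℝ, ‖xb - x0‖ < d ∧ ‖xb - yb‖ < d ∧ xb - yb ≠ 0 ∧
      |tb - t0| < ω ∧ |tb - sb| < ω ∧ tb < 0 ∧ sb < 0 ∧
      ∀ x y t s, WW U γ L (3 / d ^ 2) (3 / ω ^ 2) H B x0 t0 x y t s ≤
        WW U γ L (3 / d ^ 2) (3 / ω ^ 2) H B x0 t0 xb yb tb sb := by
  set m0 := U (x0, t0) - U (y0, t0) - L * ‖x0 - y0‖ ^ γ with hm0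
  have hcomp : IsCompact (closedBall x0 d ×ˢ Icc (t0 - 2 * ω) (t0 + 2 * ω)) :=
    (isCompact_closedBall x0 d).prod isCompact_Icc
  have huc := hcomp.uniformContinuousOn_of_continuous hU.continuousOn
  rw [Metric.uniformContinuousOn_iff] at huc
  obtain ⟨δ', hδ', huc⟩ := huc (m0 / 2) (by positivity)
  set ι := min (min ω (-t0 / 2)) δ' with hι
  have hιp : 0 < ι := lt_min (lt_min hω (by linarith)) hδ'
  have hι1 : ι ≤ ω := (min_le_left _ _).trans (min_le_left _ _)
  have hι2 : ι ≤ -t0 / 2 := (min_le_left _ _).trans (min_le_right _ _)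
  have hι3 : ι ≤ δ' := min_le_right _ _
  set H := 3 / (-t0 / 2) ^ 2 with hH
  set B := 3 / ι ^ 2 with hB
  set M := 3 / d ^ 2 with hM
  set M' := 3 / ω ^ 2 with hM'
  have hMp : 0 ≤ M := by positivity
  have hM'p : 0 ≤ M' := by positivity
  have hHp : 0 ≤ H := by positivity
  have hBp : 0 ≤ B := by positivity
  have ht2 : 0 < -t0 / 2 := by linarith
  have hloc : ∀ x y t s, 0 < WW U γ L M M' H B x0 t0 x y t s → ‖x - x0‖ < d ∧ ‖x - y‖ < d ∧
      |t - t0| < ω ∧ max (t - t0) 0 < -t0 / 2 ∧ |t - s| < ι := by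
    intro x y t s hW
    unfold WW at hW
    have b1 := abs_le.1 (hU1 (x, t))
    have b2 := abs_le.1 (hU1 (y, s))
    have c1 : 0 ≤ L * ‖x - y‖ ^ γ := by positivity
    have c2 : 0 ≤ M * ‖x - x0‖ ^ 2 := by positivity
    have c3 : 0 ≤ M' * (t - t0) ^ 2 := by positivity
    have c4 : 0 ≤ H * (max (t - t0) 0) ^ 2 := by positivity
    have c5 : 0 ≤ B * (t - s) ^ 2 := by positivity
    refine ⟨sq_pen (c := 0) hd (norm_nonneg _) (by rw [← hM]; linarith), ?_,
      sq_pen (c := 0) hω (abs_nonneg _) (by rw [← hM', sq_abs]; linarith),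
      sq_pen (c := 0) ht2 (le_max_right _ _) (by rw [← hH]; linarith),
      sq_pen (c := 0) hιp (abs_nonneg _) (by rw [← hB, sq_abs]; linarith)⟩
    by_contra hcon
    push Not at hcon
    have : L * d ^ γ ≤ L * ‖x - y‖ ^ γ := by gcongr
    linarith
  have hWm : WW U γ L M M' H B x0 t0 x0 y0 t0 t0 = m0 := by
    unfold WW; rw [hm0]; simp
  set S : Set (Euc N × Euc N × ℝ × ℝ) := closedBall x0 d ×ˢ closedBall x0 (2 * d) ×ˢ
    Icc (t0 - ω) (t0 + ω) ×ˢ Icc (t0 - 2 * ω) (t0 + 2 * ω) with hS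
  have hScomp : IsCompact S := (isCompact_closedBall _ _).prod
    ((isCompact_closedBall _ _).prod (isCompact_Icc.prod isCompact_Icc))
  have hmemS : ∀ x y t s, 0 < WW U γ L M M' H B x0 t0 x y t s → (x, y, t, s) ∈ S := by
    intro x y t s hW
    obtain ⟨e1, e2, e3, e4, e5⟩ := hloc x y t s hW
    have e3' := abs_lt.1 e3
    have e5' := abs_lt.1 e5
    refine ⟨?_, ?_, ?_, ?_⟩
    · simp only [mem_closedBall, dist_eq_norm]; exact e1.le
    · simp only [mem_closedBall, dist_eq_norm]
      have : y - x0 = (x - x0) - (x - y) := by abel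
      rw [this]; exact (norm_sub_le _ _).trans (by linarith)
    · exact ⟨by simp only; linarith, by simp only; linarith⟩
    · exact ⟨by simp only; linarith, by simp only; linarith⟩
  have hWc : Continuous fun q : Euc N × Euc N × ℝ × ℝ =>
      WW U γ L M M' H B x0 t0 q.1 q.2.1 q.2.2.1 q.2.2.2 := by
    unfold WW
    have : Continuous fun q : Euc N × Euc N × ℝ × ℝ => ‖q.1 - q.2.1‖ ^ γ :=
      (by fun_prop : Continuous fun q : Euc N × Euc N × ℝ × ℝ => ‖q.1 - q.2.1‖).rpow_const
        fun _ => Or.inr h0.le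
    fun_prop
  have h0S := hmemS x0 y0 t0 t0 (by rw [hWm]; exact hm)
  obtain ⟨⟨xb, yb, tb, sb⟩, hbS, hmax⟩ := hScomp.exists_isMaxOn ⟨_, h0S⟩ hWc.continuousOn
  have hmb : m0 ≤ WW U γ L M M' H B x0 t0 xb yb tb sb := by
    have := hmax h0S
    simp only [mem_ofPred_eq] at this
    rwa [hWm] at this
  have hglob : ∀ x y t s, WW U γ L M M' H B x0 t0 x y t s ≤ WW U γ L M M' H B x0 t0 xb yb tb sb := by
    intro x y t s
    rcases le_or_gt (WW U γ L M M' H B x0 t0 x y t s) 0 with h | h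
    · linarith
    · exact hmax (hmemS x y t s h)
  obtain ⟨e1, e2, e3, e4, e5⟩ := hloc xb yb tb sb (by linarith)
  have e4' := (le_max_left _ _).trans_lt e4
  have e5' := abs_lt.1 e5
  have e3' := abs_lt.1 e3
  refine ⟨H, B, hHp, hBp, xb, yb, tb, sb, e1, e2, ?_, e3, e5.trans_le hι1, by linarith, by linarith, hglob⟩
  intro hxy
  have hxy' : xb = yb := sub_eq_zero.1 hxy
  subst hxy'
  have hd1 : dist (U (xb, tb)) (U (xb, sb)) < m0 / 2 := by
    apply huc
    · exact ⟨by simp only [mem_closedBall, dist_eq_norm]; exact e1.le, by simp only; linarith, by simp only; linarith⟩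
    · exact ⟨by simp only [mem_closedBall, dist_eq_norm]; exact e1.le, by simp only; linarith, by simp only; linarith⟩
    · rw [Prod.dist_eq]
      simp only [dist_self, Real.dist_eq]
      exact max_lt hδ' (e5.trans_le hι3)
  rw [Real.dist_eq] at hd1
  have hd2 := (abs_lt.1 hd1).2
  unfold WW at hmb
  have c1 : 0 ≤ L * ‖xb - xb‖ ^ γ := by positivity
  have c2 : 0 ≤ M * ‖xb - x0‖ ^ 2 := by positivity
  have c3 : 0 ≤ M' * (tb - t0) ^ 2 := by positivity
  have c4 : 0 ≤ H * (max (tb - t0) 0) ^ 2 := by positivity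
  have c5 : 0 ≤ B * (tb - sb) ^ 2 := by positivity
  linarith

theorem norm_rpow_cont {N : ℕ} {γ : ℝ} (h0 : 0 < γ) (L M : ℝ) (w x0 : Euc N) :
    Continuous fun x : Euc N => L * ‖x - w‖ ^ γ + M * ‖x - x0‖ ^ 2 := by
  have : Continuous fun x : Euc N => ‖x - w‖ ^ γ :=
    (by fun_prop : Continuous fun x : Euc N => ‖x - w‖).rpow_const fun _ => Or.inr h0.le
  fun_prop

set_option maxHeartbeats 1000000 in
theorem visc_pair {N : ℕ} (hN : 1 ≤ N) {p s lam Lam : ℝ} (hp : 1 < p) (hs : s ∈ Ioo (0:ℝ) 1) (hLam : 0 < Lam)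
    {K : Euc N → ℝ} (hK : IsKernel N p s lam Lam K) {f : Euc N × ℝ → ℝ} (hf : Good N p s K f)
    (U : Euc N × ℝ → ℝ) (hU : Continuous U) (hU1 : ∀ ξ, |U ξ| ≤ 1)
    (hUf : ∀ ξ : Euc N × ℝ, ‖ξ.1‖ < 2 → -2 < ξ.2 → ξ.2 < 0 → U ξ = f ξ)
    {γ L M M' H B d ω t0 θ0 tb sb : ℝ} {x0 xb yb : Euc N} (h0 : 0 < γ) (hH : 0 ≤ H) (hM' : 0 ≤ M')
    (hne : xb - yb ≠ 0) (htb : |tb - t0| < ω) (htb1 : -2 < tb) (htb2 : tb < 0) (hsb1 : -2 < sb) (hsb2 : sb < 0)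
    (hmax : ∀ x y t s, WW U γ L M M' H B x0 t0 x y t s ≤ WW U γ L M M' H B x0 t0 xb yb tb sb)
    (hθ0 : 0 < θ0) (hθd : θ0 ≤ d) (R : ℝ) (hxR : ‖xb‖ + d < R) (hyR : ‖yb‖ + d < R) (hR2 : R < 2)
    (C3 : ℝ) (hC3 : 0 ≤ C3)
    (hfar : ∀ᵐ t : ℝ, -2 < t → t < 0 → ∀ x : Euc N, ‖x‖ ≤ R →
      ∫⁻ z in {z : Euc N | d ≤ ‖z‖}, ENNReal.ofReal (|Jp p (f (x, t) - f (x + z, t))| * K z) ≤ ENNReal.ofReal C3)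
    (hfar' : ∀ᵐ t : ℝ, -2 < t → t < 0 → ∀ x : Euc N, ‖x‖ ≤ R →
      ∫⁻ z in {z : Euc N | d ≤ ‖z‖}, ENNReal.ofReal (|Jp p (-f (x, t) - -f (x + z, t))| * K z) ≤ ENNReal.ofReal C3)
    (Nx Ny ρ1 : ℝ) (hρ1 : 0 < ρ1)
    (hNx : ∀ x, dist x xb < ρ1 → ∀ θ, 0 < θ → -Nx ≤ ∫ z in ann N θ θ0,
      Jp p ((L * ‖x - yb‖ ^ γ + M * ‖x - x0‖ ^ 2 + ‖x - xb‖ ^ 2)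
            - (L * ‖x + z - yb‖ ^ γ + M * ‖x + z - x0‖ ^ 2 + ‖x + z - xb‖ ^ 2)) * K z)
    (hNy : ∀ x, dist x yb < ρ1 → ∀ θ, 0 < θ → -Ny ≤ ∫ z in ann N θ θ0,
      Jp p ((L * ‖x - xb‖ ^ γ + 0 * ‖x - yb‖ ^ 2 + ‖x - yb‖ ^ 2)
            - (L * ‖x + z - xb‖ ^ γ + 0 * ‖x + z - yb‖ ^ 2 + ‖x + z - yb‖ ^ 2)) * K z) :
    -(2 * M' * ω) + (∫ z in ann N θ0 d, Jp p (f (xb, tb) - f (xb + z, tb)) * K z)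
      + (∫ z in ann N θ0 d, Jp p (f (yb + z, sb) - f (yb, sb)) * K z) - Nx - Ny - 2 * C3 ≤ 0 := by
  have hne' : yb - xb ≠ 0 := by rw [← neg_sub]; exact neg_ne_zero.2 hne
  obtain ⟨ρa, Λa, hρa, hΛa, hLa⟩ := lip_psi γ L M yb x0 xb hne
  obtain ⟨ρb, Λb, hρb, hΛb, hLb⟩ := lip_psi γ L 0 xb yb yb hne'
  have hτ : ∀ t : ℝ, HasDerivAt (fun t => (M' * (t - t0) ^ 2 + H * (max (t - t0) 0) ^ 2) + B * (t - sb) ^ 2)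
      (2 * M' * (t - t0) + 2 * H * max (t - t0) 0 + 2 * B * (t - sb)) t := by
    intro t
    have i1 : HasDerivAt (fun t => t - t0) 1 t := (hasDerivAt_id t).sub_const t0
    have i2 : HasDerivAt (fun t => t - sb) 1 t := (hasDerivAt_id t).sub_const sb
    have i3 := (hasDerivAt_half_sq (t - t0)).comp t i1
    have := ((((i1.pow 2).const_mul M').add (i3.const_mul (2 * H)))).add ((i2.pow 2).const_mul B)
    refine (this.congr_deriv ?_).congr_of_eventuallyEq (Eventually.of_forall fun y => ?_)
    · simp; ring
    · simp; ring
  have hτ2 : ∀ t : ℝ, HasDerivAt (fun t => B * (tb - t) ^ 2) (-(2 * B * (tb - t))) t := by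
    intro t
    have i2 : HasDerivAt (fun t => tb - t) (-1) t := (hasDerivAt_id t).const_sub tb
    refine ((i2.pow 2).const_mul B).congr_deriv ?_
    simp; ring
  have hd0 : 0 < d := hθ0.trans_le hθd
  have v1 := visc hN hp hs hLam hK hf (xb, tb) htb1 htb2 U hU hU1 hUf
    (fun x => L * ‖x - yb‖ ^ γ + M * ‖x - x0‖ ^ 2) (norm_rpow_cont h0 L M yb x0) (min ρa ρ1) Λa (lt_min hρa hρ1) hΛa
    (fun x y hx hy => hLa x y (hx.trans_le (min_le_left _ _)) (hy.trans_le (min_le_left _ _)))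
    _ _ hτ (by fun_prop)
    (by
      intro ξ
      have := hmax ξ.1 yb ξ.2 sb
      unfold WW at this
      simp only [Prod.mk.eta] at this ⊢
      linarith)
    θ0 d hθ0 hθd (by simp only; linarith) R C3 (by simp only; linarith) hC3 hfar Nx
    (fun x hx θ hθ _ => hNx x (hx.trans_le (min_le_right _ _)) θ hθ)
  have v2 := visc hN hp hs hLam hK hf.neg (yb, sb) hsb1 hsb2 (fun ξ => -U ξ) hU.neg (fun ξ => by rw [abs_neg]; exact hU1 ξ)
    (fun ξ a b c => by rw [hUf ξ a b c])
    (fun x => L * ‖x - xb‖ ^ γ + 0 * ‖x - yb‖ ^ 2) (norm_rpow_cont h0 L 0 xb yb) (min ρb ρ1) Λb (lt_min hρb hρ1) hΛb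
    (fun x y hx hy => hLb x y (hx.trans_le (min_le_left _ _)) (hy.trans_le (min_le_left _ _)))
    _ _ hτ2 (by fun_prop)
    (by
      intro ξ
      have := hmax xb ξ.1 tb ξ.2
      unfold WW at this
      rw [norm_sub_rev xb ξ.1, norm_sub_rev xb yb] at this
      simp only [Prod.mk.eta] at this ⊢
      linarith)
    θ0 d hθ0 hθd (by simp only; linarith) R C3 (by simp only; linarith) hC3 hfar' Ny
    (fun x hx θ hθ _ => hNy x (hx.trans_le (min_le_right _ _)) θ hθ)
  simp only [sh] at v1 v2
  have e : ∀ z, -f (yb, sb) - -f (yb + z, sb) = f (yb + z, sb) - f (yb, sb) := fun z => by ring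
  simp only [e] at v2
  have g1 := (abs_lt.1 htb).1
  have g2 : M' * (-ω) ≤ M' * (tb - t0) := mul_le_mul_of_nonneg_left g1.le hM'
  have g3 : 0 ≤ H * max (tb - t0) 0 := by positivity
  linarith

/-- uniform interior spatial Hölder estimate with exponent `κ` for all good functions -/
def SS (N : ℕ) (p s lam Lam κ : ℝ) : Prop :=
  ∀ R : ℝ, R < 2 → ∀ T : ℝ, T < 2 → ∃ L : ℝ, 0 ≤ L ∧ ∀ K : Euc N → ℝ, IsKernel N p s lam Lam K →
    ∀ f : Euc N × ℝ → ℝ, Good N p s K f → ∀ t : ℝ, -T < t → t < 0 → ∀ x y : Euc N, ‖x‖ < R → ‖y‖ < R →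
      f (x, t) - f (y, t) ≤ L * ‖x - y‖ ^ κ

theorem SS_zero (N : ℕ) (p s lam Lam : ℝ) : SS N p s lam Lam 0 := by
  intro R hR T hT
  refine ⟨2, by norm_num, fun K hK f hf t ht1 ht2 x y hx hy => ?_⟩
  have h1 := abs_le.1 (hf.bd x t (by linarith) (by linarith) ht2)
  have h2 := abs_le.1 (hf.bd y t (by linarith) (by linarith) ht2)
  rw [Real.rpow_zero]
  linarith

theorem exists_small {c C e : ℝ} (hc : 0 < c) (hC : 0 < C) (he : 0 < e) :
    ∃ δ : ℝ, 0 < δ ∧ δ ≤ 1 / 8 ∧ 2 * C * δ ^ e ≤ c / 2 := by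
  refine ⟨min (1 / 8) ((c / (4 * C)) ^ (1 / e)), by positivity, min_le_left _ _, ?_⟩
  have h : (min (1 / 8) ((c / (4 * C)) ^ (1 / e))) ^ e ≤ ((c / (4 * C)) ^ (1 / e)) ^ e :=
    Real.rpow_le_rpow (by positivity) (min_le_right _ _) he.le
  rw [← Real.rpow_mul (by positivity), one_div_mul_cancel he.ne', Real.rpow_one] at h
  calc 2 * C * _ ≤ 2 * C * (c / (4 * C)) := by gcongr
    _ = c / 2 := by field_simp; norm_num

theorem fin_arith {c0 X σ CC m C3 NN I J : ℝ} (hσ1 : 1 ≤ σ) (hm : 0 ≤ m) (hC3 : 0 ≤ C3)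
    (f1 : 2 * NN ≤ c0 / 2 * X * σ) (f2 : CC + m + 2 * C3 + 1 ≤ c0 / 2 * X)
    (hm2 : (c0 * X - CC) * σ ≤ I + J) (hp : -m + I + J - NN - NN - 2 * C3 ≤ 0) : False := by
  have f3 : (c0 / 2 * X - CC) * 1 ≤ (c0 / 2 * X - CC) * σ :=
    mul_le_mul_of_nonneg_left hσ1 (by linarith)
  linarith

theorem q3_arith {A B C d : ℝ} (hA : 0 ≤ A) (hB : 0 ≤ B) (hC : 0 ≤ C) (h : C ≤ A + B) (hAd : A < d) (hBd : B < d) :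
    C ^ 2 ≤ A ^ 2 + 3 * d * B := by
  have : C ^ 2 ≤ (A + B) ^ 2 := by gcongr
  nlinarith

set_option maxHeartbeats 1000000 in
theorem core_step (N : ℕ) (hN : 1 ≤ N) {p s lam Lam κ γ : ℝ} (hp : 1 < p) (hs : s ∈ Ioo (0:ℝ) 1)
    (hsp : p - 1 < s * p) (hlam : 0 < lam) (hlL : lam ≤ Lam) (h0 : 0 < γ) (h1 : γ < 1)
    (hc : (2 ≤ p ∧ γ * (p - 1) ≤ κ * (p - 2) + 1) ∨ p ≤ 2) (hSS : SS N p s lam Lam κ) :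
    SS N p s lam Lam γ := by
  have hLam : 0 < Lam := hlam.trans_le hlL
  obtain ⟨c0, hc0, hmid⟩ := mid_bound N hp hsp hlam hlL h0 h1
  obtain ⟨Ct, hCt, htiny⟩ := tiny_test N hN (lam := lam) hp hs hLam h0 h1
  have hpsp : 0 < p - s * p := by nlinarith [hs.2]
  obtain ⟨δ, hδ, hδ8, hδc⟩ := exists_small hc0 hCt hpsp
  obtain ⟨Cδ, hCδ, hmid⟩ := hmid δ hδ hδ8
  have hexp : γ * (p - 1) - s * p ≤ 0 := by nlinarith
  intro R0 hR0 T0 hT0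
  obtain ⟨R1, hR1⟩ : ∃ R1, R1 = max R0 0 := ⟨_, rfl⟩
  obtain ⟨T1, hT1⟩ : ∃ T1, T1 = max T0 0 := ⟨_, rfl⟩
  have hR10 : 0 ≤ R1 := hR1 ▸ le_max_right _ _
  have hT10 : 0 ≤ T1 := hT1 ▸ le_max_right _ _
  have hR1a : R0 ≤ R1 := hR1 ▸ le_max_left _ _
  have hT1a : T0 ≤ T1 := hT1 ▸ le_max_left _ _
  have hR12 : R1 < 2 := hR1 ▸ max_lt hR0 (by norm_num)
  have hT12 : T1 < 2 := hT1 ▸ max_lt hT0 (by norm_num)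
  obtain ⟨d, hd⟩ : ∃ d, d = (2 - R1) / 8 := ⟨_, rfl⟩
  obtain ⟨ω, hω⟩ : ∃ ω, ω = (2 - T1) / 4 := ⟨_, rfl⟩
  have hd0 : 0 < d := by rw [hd]; linarith
  have hd4 : d ≤ 1 / 4 := by rw [hd]; linarith
  have hω0 : 0 < ω := by rw [hω]; linarith
  obtain ⟨R2, hR2⟩ : ∃ R2, R2 = R1 + 3 * d := ⟨_, rfl⟩
  obtain ⟨T2, hT2⟩ : ∃ T2, T2 = T1 + 2 * ω := ⟨_, rfl⟩
  have hR22 : R2 < 2 := by rw [hR2, hd]; linarith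
  have hT22 : T2 < 2 := by rw [hT2, hω]; linarith
  obtain ⟨M, hM⟩ : ∃ M, M = 3 / d ^ 2 := ⟨_, rfl⟩
  obtain ⟨M', hM'⟩ : ∃ M', M' = 3 / ω ^ 2 := ⟨_, rfl⟩
  have hM0 : 0 ≤ M := by rw [hM]; positivity
  have hM'0 : 0 ≤ M' := by rw [hM']; positivity
  obtain ⟨C3, hC3, hfar⟩ := far_bound N (lam := lam) hp hs.1 hLam R2 d hR22 hd0
  obtain ⟨Lk, hLk, hHol⟩ := hSS R2 hR22 T2 hT22
  obtain ⟨C2, hC2, hloss⟩ := jp_loss hp h0 h1 hc Lk (3 * M * d) hLk (by positivity)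
  obtain ⟨L0, hL0, hmid⟩ := hmid M (2 * M * d) hM0 (by positivity)
  obtain ⟨La, hLa, htinya⟩ := htiny M hM0
  obtain ⟨Lb, hLb, htinyb⟩ := htiny 0 le_rfl
  obtain ⟨Q, hQ⟩ : ∃ Q, Q = Cδ * C2 + 2 * M' * ω + 2 * C3 + 1 := ⟨_, rfl⟩
  have hQ0 : 0 < Q := by rw [hQ]; positivity
  obtain ⟨L, hLL0, hLLa, hLLb, hLd, hLQ⟩ : ∃ L, L0 ≤ L ∧ La ≤ L ∧ Lb ≤ L ∧ 3 ≤ L * d ^ γ ∧ 2 * Q / c0 ≤ L ^ (p - 1) := by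
    refine ⟨max (max L0 (max La Lb)) (max (3 / d ^ γ) ((2 * Q / c0) ^ (1 / (p - 1)))), ?_, ?_, ?_, ?_, ?_⟩
    · exact (le_max_left _ _).trans (le_max_left _ _)
    · exact ((le_max_left _ _).trans (le_max_right _ _)).trans (le_max_left _ _)
    · exact ((le_max_right _ _).trans (le_max_right _ _)).trans (le_max_left _ _)
    · rw [← div_le_iff₀ (by positivity)]
      exact (le_max_left _ _).trans (le_max_right _ _)
    · have h := Real.rpow_le_rpow (z := p - 1) (by positivity)
        ((le_max_right (3 / d ^ γ) ((2 * Q / c0) ^ (1 / (p - 1)))).trans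
          (le_max_right (max L0 (max La Lb)) _)) (by linarith)
      rwa [← Real.rpow_mul (by positivity), one_div_mul_cancel (by linarith), Real.rpow_one] at h
  have hLpos : 0 < L := hL0.trans_le hLL0
  refine ⟨L, hLpos.le, fun K hK f hf t0 ht1 ht0 x0 y0 hx0 hy0 => ?_⟩
  by_contra hcon
  push Not at hcon
  obtain ⟨U, hU⟩ : ∃ U : Euc N × ℝ → ℝ, U = fun ξ => max (-1) (min 1 (f ξ)) := ⟨_, rfl⟩
  have hUc : Continuous U := by rw [hU]; exact continuous_const.max (continuous_const.min hf.cont)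
  have hU1 : ∀ ξ, |U ξ| ≤ 1 := by
    intro ξ; rw [hU, abs_le]
    exact ⟨le_max_left _ _, max_le (by norm_num) (min_le_left _ _)⟩
  have hUf : ∀ ξ : Euc N × ℝ, ‖ξ.1‖ < 2 → -2 < ξ.2 → ξ.2 < 0 → U ξ = f ξ := by
    intro ξ a b c
    have := abs_le.1 (hf.bd ξ.1 ξ.2 a b c)
    rw [hU]; simp only
    rw [min_eq_right this.2, max_eq_right this.1]
  have hx02 : ‖x0‖ < R1 := hx0.trans_le hR1a
  have hm : 0 < U (x0, t0) - U (y0, t0) - L * ‖x0 - y0‖ ^ γ := by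
    rw [hUf (x0, t0) (by simp only; linarith) (by simp only; linarith) ht0,
      hUf (y0, t0) (by simp only; linarith) (by simp only; linarith) ht0]
    linarith
  obtain ⟨H, B, hH, hB, xb, yb, tb, sb, e1, e2, hne, e3, e4, htb, hsb, hmax⟩ :=
    dbl_max U hUc hU1 x0 y0 h0 hLpos.le hd0 hω0 ht0 hLd hm
  rw [← hM, ← hM'] at hmax
  obtain ⟨a, ha⟩ : ∃ a, a = xb - yb := ⟨_, rfl⟩
  have haR : ‖yb - xb‖ = ‖a‖ := by rw [ha, norm_sub_rev]
  have ha0 : a ≠ 0 := ha ▸ hne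
  have hap : 0 < ‖a‖ := norm_pos_iff.2 ha0
  have had : ‖a‖ < d := ha ▸ e2
  have e3' := abs_lt.1 e3
  have e4' := abs_lt.1 e4
  have htb2 : -T2 < tb := by rw [hT2]; linarith
  have hsb2 : -T2 < sb := by rw [hT2]; linarith
  have hxb : ‖xb‖ < R1 + d := by
    have : xb = x0 + (xb - x0) := by abel
    rw [this]; exact (norm_add_le _ _).trans_lt (by linarith)
  have hyb : ‖yb‖ < R1 + 2 * d := by
    have : yb = xb - a := by rw [ha]; abel
    rw [this]; exact (norm_sub_le _ _).trans_lt (by linarith)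
  have hxz : ∀ z : Euc N, ‖z‖ < d → ‖xb + z‖ < R2 := fun z hz => by
    rw [hR2]; exact (norm_add_le _ _).trans_lt (by linarith)
  have hyz : ∀ z : Euc N, ‖z‖ < d → ‖yb + z‖ < R2 := fun z hz => by
    rw [hR2]; exact (norm_add_le _ _).trans_lt (by linarith)
  have hUx : ∀ z : Euc N, ‖z‖ < d → U (xb + z, tb) = f (xb + z, tb) := fun z hz =>
    hUf _ ((hxz z hz).trans hR22) (by simp only; linarith) htb
  have hUy : ∀ z : Euc N, ‖z‖ < d → U (yb + z, sb) = f (yb + z, sb) := fun z hz =>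
    hUf _ ((hyz z hz).trans hR22) (by simp only; linarith) hsb
  have hUx0 : U (xb, tb) = f (xb, tb) := by simpa using hUx 0 (by simpa using hd0)
  have hUy0 : U (yb, sb) = f (yb, sb) := by simpa using hUy 0 (by simpa using hd0)
  obtain ⟨NN, hNN⟩ : ∃ NN, NN = Ct * δ ^ (p - s * p) * L ^ (p - 1) * ‖a‖ ^ (γ * (p - 1) - s * p) := ⟨_, rfl⟩
  have hθ0 : 0 < δ * ‖a‖ := by positivity
  have hθa : δ * ‖a‖ ≤ ‖a‖ := mul_le_of_le_one_left hap.le (hδ8.trans (by norm_num))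
  have hfar1 := hfar K hK f hf
  have hfar2 := hfar K hK _ hf.neg
  have hNx : ∀ x, dist x xb < ‖a‖ / 2 → ∀ θ, 0 < θ → -NN ≤ ∫ z in ann N θ (δ * ‖a‖),
      Jp p ((L * ‖x - yb‖ ^ γ + M * ‖x - x0‖ ^ 2 + ‖x - xb‖ ^ 2)
            - (L * ‖x + z - yb‖ ^ γ + M * ‖x + z - x0‖ ^ 2 + ‖x + z - xb‖ ^ 2)) * K z := by
    intro x hx θ hθ
    rw [dist_eq_norm] at hx
    have hx1 : ‖x - x0‖ ≤ 1 := by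
      have : x - x0 = (x - xb) + (xb - x0) := by abel
      rw [this]; exact (norm_add_le _ _).trans (by linarith)
    rw [hNN, ha]
    exact htinya L hLLa K hK yb x0 xb x δ hne (by rw [← ha]; linarith) (by rw [← ha]; linarith) hx1 hδ hδ8 θ hθ
  have hNy : ∀ x, dist x yb < ‖a‖ / 2 → ∀ θ, 0 < θ → -NN ≤ ∫ z in ann N θ (δ * ‖a‖),
      Jp p ((L * ‖x - xb‖ ^ γ + 0 * ‖x - yb‖ ^ 2 + ‖x - yb‖ ^ 2)
            - (L * ‖x + z - xb‖ ^ γ + 0 * ‖x + z - yb‖ ^ 2 + ‖x + z - yb‖ ^ 2)) * K z := by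
    intro x hx θ hθ
    rw [dist_eq_norm] at hx
    rw [hNN, ← haR]
    exact htinyb L hLLb K hK xb yb yb x δ (norm_pos_iff.1 (by rw [haR]; exact hap)) (by rw [haR]; linarith)
        (by rw [haR]; linarith) (by linarith) hδ hδ8 θ hθ
  have hpair := visc_pair hN hp hs hLam hK hf U hUc hU1 hUf h0 hH hM'0 hne e3 (by linarith) htb (by linarith) hsb
    hmax hθ0 (hθa.trans had.le) R2 (by rw [hR2]; linarith) (by rw [hR2]; linarith) hR22 C3 hC3.le
    hfar1 hfar2 NN NN (‖a‖ / 2) (by positivity) hNx hNy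
  have hbdx : ∀ z ∈ ann N (δ * ‖a‖) d, |Jp p (f (xb, tb) - f (xb + z, tb))| ≤ 2 ^ (p - 1) := by
    intro z hz
    rw [Jp_abs hp]
    apply Real.rpow_le_rpow (abs_nonneg _) _ (by linarith)
    rw [← hUx z hz.2, ← hUx0]
    have b1 := abs_le.1 (hU1 (xb, tb))
    have b2 := abs_le.1 (hU1 (xb + z, tb))
    rw [abs_le]; constructor <;> linarith
  have hbdy : ∀ z ∈ ann N (δ * ‖a‖) d, |Jp p (f (yb + z, sb) - f (yb, sb))| ≤ 2 ^ (p - 1) := by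
    intro z hz
    rw [Jp_abs hp]
    apply Real.rpow_le_rpow (abs_nonneg _) _ (by linarith)
    rw [← hUy z hz.2, ← hUy0]
    have b1 := abs_le.1 (hU1 (yb, sb))
    have b2 := abs_le.1 (hU1 (yb + z, sb))
    rw [abs_le]; constructor <;> linarith
  have hfc := hf.cont
  have hsp0 : 0 ≤ s * p := by linarith
  have hix : IntegrableOn (fun z => Jp p (f (xb, tb) - f (xb + z, tb)) * K z) (ann N (δ * ‖a‖) d) := by
    refine integrableOn_ann hK hsp0 hLam.le hθ0 ?_ hbdx
    exact (Jp_measurable p).comp (by fun_prop : Continuous fun z => f (xb, tb) - f (xb + z, tb)).measurable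
  have hiy : IntegrableOn (fun z => Jp p (f (yb + z, sb) - f (yb, sb)) * K z) (ann N (δ * ‖a‖) d) := by
    refine integrableOn_ann hK hsp0 hLam.le hθ0 ?_ hbdy
    exact (Jp_measurable p).comp (by fun_prop : Continuous fun z => f (yb + z, sb) - f (yb, sb)).measurable
  have hm2 := hmid L hLL0 K hK a ((2 * M) • (xb - x0)) ha0 (by linarith)
    (by rw [norm_smul, Real.norm_of_nonneg (by positivity)]; gcongr) d C2 had.le hC2
    (fun z => Jp p (f (xb, tb) - f (xb + z, tb))) (fun z => Jp p (f (yb + z, sb) - f (yb, sb)))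
    (by
      have := hix.add hiy
      refine this.congr (Eventually.of_forall fun z => ?_)
      simp only [Pi.add_apply]; ring)
    (by
      intro z hz
      apply Jp_mono hp
      have hzd : ‖z‖ < d := by linarith
      have hW := hmax (xb + z) yb tb sb
      unfold WW at hW
      rw [hUx z hzd, hUx0] at hW
      have q1 : xb + z - yb = a + z := by rw [ha]; abel
      have q2 : xb + z - x0 = (xb - x0) + z := by abel
      rw [q1, q2, ← ha, norm_add_sq_real] at hW
      rw [inner_smul_left]
      simp only [conj_trivial]
      linarith)
    (by
      intro z hz
      apply Jp_mono hp
      have hzd : ‖z‖ < d := by linarith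
      have hW := hmax xb (yb + z) tb sb
      unfold WW at hW
      rw [hUy z hzd, hUy0] at hW
      have q1 : xb - (yb + z) = a - z := by rw [ha]; abel
      rw [q1, ← ha] at hW
      linarith)
    (by
      intro z hz
      have hzp : 0 < ‖z‖ := hθ0.trans_le hz.1
      have hzd : ‖z‖ < d := hz.2
      have hW := hmax (xb + z) (yb + z) tb sb
      unfold WW at hW
      rw [hUx z hzd, hUx0, hUy z hzd, hUy0] at hW
      have q1 : xb + z - (yb + z) = xb - yb := by abel
      have q2 : xb + z - x0 = (xb - x0) + z := by abel
      rw [q1, q2] at hW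
      have q3 : ‖xb - x0 + z‖ ^ 2 ≤ ‖xb - x0‖ ^ 2 + 3 * d * ‖z‖ := by exact q3_arith (norm_nonneg _) (norm_nonneg _) (norm_nonneg _) (norm_add_le _ _) e1 hzd
      have q4 := mul_le_mul_of_nonneg_left q3 hM0
      have hA : |f (xb, tb) - f (xb + z, tb)| ≤ Lk * ‖z‖ ^ κ := by
        have r1 := hHol K hK f hf tb htb2 htb xb (xb + z) (by rw [hR2]; linarith) (hxz z hzd)
        have r2 := hHol K hK f hf tb htb2 htb (xb + z) xb (hxz z hzd) (by rw [hR2]; linarith)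
        rw [sub_add_cancel_left, norm_neg] at r1
        rw [add_sub_cancel_left] at r2
        rw [abs_le]; constructor <;> linarith
      have hB : |f (yb, sb) - f (yb + z, sb)| ≤ Lk * ‖z‖ ^ κ := by
        have r1 := hHol K hK f hf sb hsb2 hsb yb (yb + z) (by rw [hR2]; linarith) (hyz z hzd)
        have r2 := hHol K hK f hf sb hsb2 hsb (yb + z) yb (hyz z hzd) (by rw [hR2]; linarith)
        rw [sub_add_cancel_left, norm_neg] at r1
        rw [add_sub_cancel_left] at r2
        rw [abs_le]; constructor <;> linarith
      have := hloss ‖z‖ hzp (by linarith) _ _ hA hB (by linarith)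
      have q5 : Jp p (f (yb + z, sb) - f (yb, sb)) = -Jp p (f (yb, sb) - f (yb + z, sb)) := by
        rw [← Jp_neg]; congr 1; ring
      rw [q5]; linarith)
  have hsum : ∫ z in ann N (δ * ‖a‖) d, (Jp p (f (xb, tb) - f (xb + z, tb)) + Jp p (f (yb + z, sb) - f (yb, sb))) * K z =
      (∫ z in ann N (δ * ‖a‖) d, Jp p (f (xb, tb) - f (xb + z, tb)) * K z)
      + ∫ z in ann N (δ * ‖a‖) d, Jp p (f (yb + z, sb) - f (yb, sb)) * K z := by
    rw [← integral_add hix hiy]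
    congr 1; ext z; ring
  rw [hsum] at hm2
  obtain ⟨σ, hσ⟩ : ∃ σ, σ = ‖a‖ ^ (γ * (p - 1) - s * p) := ⟨_, rfl⟩
  have hσ1 : 1 ≤ σ := by
    rw [hσ]
    exact Real.one_le_rpow_of_pos_of_le_one_of_nonpos hap (had.le.trans (hd4.trans (by norm_num))) hexp
  rw [← hσ] at hm2 hNN
  have hLp : 0 < L ^ (p - 1) := by positivity
  have f1 : 2 * NN ≤ c0 / 2 * L ^ (p - 1) * σ := by
    rw [hNN]
    calc 2 * (Ct * δ ^ (p - s * p) * L ^ (p - 1) * σ) = (2 * Ct * δ ^ (p - s * p)) * L ^ (p - 1) * σ := by ring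
      _ ≤ _ := by gcongr
  have f2 : Q ≤ c0 / 2 * L ^ (p - 1) := by
    rw [div_le_iff₀ hc0] at hLQ
    linarith
  rw [hQ] at f2
  exact fin_arith (m := 2 * M' * ω) hσ1 (by positivity) hC3.le f1 f2 hm2 hpair

theorem SS_anti {N : ℕ} {p s lam Lam κ γ : ℝ} (h : γ ≤ κ) (hSS : SS N p s lam Lam κ) :
    SS N p s lam Lam γ := by
  intro R hR T hT
  obtain ⟨L, hL, hH⟩ := hSS R hR T hT
  refine ⟨L * 4 ^ (κ - γ), by positivity, fun K hK f hf t ht1 ht2 x y hx hy => ?_⟩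
  rcases eq_or_ne x y with rfl | hxy
  · rw [sub_self]; positivity
  have hn : 0 < ‖x - y‖ := norm_pos_iff.2 (sub_ne_zero.2 hxy)
  have h4 : ‖x - y‖ ≤ 4 := (norm_sub_le _ _).trans (by linarith)
  refine (hH K hK f hf t ht1 ht2 x y hx hy).trans ?_
  rw [mul_assoc]
  apply mul_le_mul_of_nonneg_left _ hL
  have : ‖x - y‖ ^ κ = ‖x - y‖ ^ (κ - γ) * ‖x - y‖ ^ γ := by
    rw [← Real.rpow_add hn]; congr 1; ring
  rw [this]
  apply mul_le_mul_of_nonneg_right _ (by positivity)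
  exact Real.rpow_le_rpow hn.le h4 (by linarith)

theorem SS_all (N : ℕ) (hN : 1 ≤ N) {p s lam Lam γ : ℝ} (hp : 1 < p) (hs : s ∈ Ioo (0:ℝ) 1)
    (hsp : p - 1 < s * p) (hlam : 0 < lam) (hlL : lam ≤ Lam) (h0 : 0 < γ) (h1 : γ < 1) :
    SS N p s lam Lam γ := by
  rcases le_or_gt p 2 with hp2 | hp2
  · exact core_step N hN hp hs hsp hlam hlL h0 h1 (Or.inr hp2) (SS_zero N p s lam Lam)
  obtain ⟨q, hq⟩ : ∃ q, q = (p - 2) / (p - 1) := ⟨_, rfl⟩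
  have hq0 : 0 < q := by rw [hq]; exact div_pos (by linarith) (by linarith)
  have hq1 : q < 1 := by rw [hq, div_lt_one (by linarith)]; linarith
  have hqe : q * (p - 1) = p - 2 := by rw [hq]; exact div_mul_cancel₀ _ (by linarith)
  have hall : ∀ n : ℕ, SS N p s lam Lam (1 - q ^ n) := by
    intro n
    induction n with
    | zero => simpa using SS_zero N p s lam Lam
    | succ n ih =>
      have hlt : q ^ (n + 1) < 1 := pow_lt_one₀ hq0.le hq1 (by omega)
      have hpos : 0 < q ^ (n + 1) := by positivity
      refine core_step N hN hp hs hsp hlam hlL (by linarith) (by linarith) (Or.inl ⟨hp2.le, le_of_eq ?_⟩) ih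
      rw [pow_succ]
      linear_combination (-q ^ n) * hqe
  obtain ⟨n, hn⟩ := exists_pow_lt_of_lt_one (by linarith : 0 < 1 - γ) hq1
  exact SS_anti (by linarith) (hall n)

theorem good_of {N : ℕ} {p s : ℝ} (hp : 1 < p) (hs : s ∈ Ioo (0:ℝ) 1) {K : Euc N → ℝ} {u : Euc N → ℝ → ℝ}
    (hu : Continuous fun q : Euc N × ℝ => u q.1 q.2)
    (hw : IsLocalWeakSolution N p s K (ball 0 2) (Ioc (-2) 0) u)
    (hb : (⨆ x ∈ ball (0 : Euc N) 2, ⨆ t ∈ Ioc (-2 : ℝ) 0, ENNReal.ofReal |u x t|)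
          + tailSup N p s u 0 2 (Ioc (-2) 0) ≤ 1) : Good N p s K (fun ξ => u ξ.1 ξ.2) := by
  obtain ⟨hw1, hw2⟩ := hw
  rw [interior_Ioc] at hw1 hw2
  have hsp0 : 0 < s * p := mul_pos hs.1 (by linarith)
  refine ⟨hu, ?_, ?_, ?_, hw2⟩
  · intro x t hx ht1 ht2
    have h1 := le_self_add.trans hb
    have h2 : ENNReal.ofReal |u x t| ≤ 1 := by
      refine le_trans ?_ h1
      refine le_trans ?_ (le_iSup₂ (f := fun x (_ : x ∈ ball (0 : Euc N) 2) =>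
        ⨆ t ∈ Ioc (-2 : ℝ) 0, ENNReal.ofReal |u x t|) x (by simpa using hx))
      exact le_iSup₂ (f := fun t (_ : t ∈ Ioc (-2 : ℝ) 0) => ENNReal.ofReal |u x t|) t ⟨ht1, ht2.le⟩
    exact ENNReal.ofReal_le_one.1 h2
  · have h1 : tailSup N p s u 0 2 (Ioc (-2) 0) ≤ 1 := le_add_self.trans hb
    unfold tailSup at h1
    have h2 : ∀ᵐ t : ℝ, t ∈ Ioc (-2 : ℝ) 0 → tailFn N p s (fun x => u x t) 0 2 ≤ 1 := by
      rw [← ae_restrict_iff' measurableSet_Ioc]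
      filter_upwards [ENNReal.ae_le_essSup (fun t => ENNReal.ofReal (tailFn N p s (fun x => u x t) 0 2))
        (μ := volume.restrict (Ioc (-2 : ℝ) 0))] with t ht
      exact ENNReal.ofReal_le_one.1 (ht.trans h1)
    have h3 : ∀ n : ℕ, ∀ᵐ t : ℝ, t ∈ Icc (-2 + 1 / ((n : ℝ) + 1)) (-(1 / ((n : ℝ) + 1))) →
        ∫⁻ x, ENNReal.ofReal (|u x t| ^ (p - 1) / (1 + ‖x‖ ^ ((N : ℝ) + s * p))) < ⊤ := by
      intro n
      have hn : 0 < 1 / ((n : ℝ) + 1) := by positivity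
      have h4 := (hw1 (Icc (-2 + 1 / ((n : ℝ) + 1)) (-(1 / ((n : ℝ) + 1)))) isCompact_Icc
        (fun t ht => ⟨by linarith [ht.1], by linarith [ht.2]⟩) (ball 0 1) isOpen_ball
        ((isCompact_closedBall (0 : Euc N) 1).of_isClosed_subset isClosed_closure closure_ball_subset_closedBall)
        (closure_ball_subset_closedBall.trans (closedBall_subset_ball (by norm_num)))).2.2.1
      rw [← ae_restrict_iff' measurableSet_Icc]
      filter_upwards [ENNReal.ae_le_essSup (fun t => ∫⁻ x, ENNReal.ofReal (|u x t| ^ (p - 1) / (1 + ‖x‖ ^ ((N : ℝ) + s * p))))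
        (μ := volume.restrict (Icc (-2 + 1 / ((n : ℝ) + 1)) (-(1 / ((n : ℝ) + 1)))))] with t ht
      exact ht.trans_lt h4
    filter_upwards [h2, ae_all_iff.2 h3] with t ht2 ht3 hta htb
    specialize ht2 ⟨hta, htb.le⟩
    obtain ⟨n, hn⟩ := exists_nat_one_div_lt (show 0 < min (t + 2) (-t) from lt_min (by linarith) (by linarith))
    have hn1 := hn.trans_le (min_le_left _ _)
    have hn2 := hn.trans_le (min_le_right _ _)
    specialize ht3 n ⟨by linarith, by linarith⟩
    have huc : Continuous fun x : Euc N => u x t := hu.comp (by fun_prop : Continuous fun x : Euc N => (x, t))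
    have hmeas : Measurable fun x : Euc N => |u x t| ^ (p - 1) * ‖x‖ ^ (-((N : ℝ) + s * p)) := by
      have := huc.measurable
      fun_prop
    have hnn : ∀ x : Euc N, 0 ≤ |u x t| ^ (p - 1) * ‖x‖ ^ (-((N : ℝ) + s * p)) := fun x => by positivity
    have hfin : ∫⁻ x in (ball (0 : Euc N) 2)ᶜ, ENNReal.ofReal (|u x t| ^ (p - 1) * ‖x‖ ^ (-((N : ℝ) + s * p))) < ⊤ := by
      calc _ ≤ ∫⁻ x in (ball (0 : Euc N) 2)ᶜ, ENNReal.ofReal 2 * ENNReal.ofReal (|u x t| ^ (p - 1) / (1 + ‖x‖ ^ ((N : ℝ) + s * p))) := by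
            apply setLIntegral_mono' measurableSet_ball.compl
            intro x hx
            have hx2 : 2 ≤ ‖x‖ := by simpa using hx
            have hx1 : 1 ≤ ‖x‖ ^ ((N : ℝ) + s * p) := Real.one_le_rpow (by linarith) (by positivity)
            rw [← ENNReal.ofReal_mul (by norm_num)]
            apply ENNReal.ofReal_le_ofReal
            rw [Real.rpow_neg (norm_nonneg _), ← mul_div_assoc, ← div_eq_mul_inv,
              div_le_div_iff₀ (by positivity) (by positivity)]
            have : 0 ≤ |u x t| ^ (p - 1) := by positivity
            nlinarith
        _ ≤ ∫⁻ x, ENNReal.ofReal 2 * ENNReal.ofReal (|u x t| ^ (p - 1) / (1 + ‖x‖ ^ ((N : ℝ) + s * p))) := setLIntegral_le_lintegral _ _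
        _ = ENNReal.ofReal 2 * ∫⁻ x, ENNReal.ofReal (|u x t| ^ (p - 1) / (1 + ‖x‖ ^ ((N : ℝ) + s * p))) := by
            apply lintegral_const_mul' _ _ ENNReal.ofReal_ne_top
        _ < ⊤ := ENNReal.mul_lt_top ENNReal.ofReal_lt_top ht3
    have hIntg : IntegrableOn (fun x : Euc N => |u x t| ^ (p - 1) * ‖x‖ ^ (-((N : ℝ) + s * p))) (ball (0 : Euc N) 2)ᶜ := by
      refine ⟨hmeas.aestronglyMeasurable, ?_⟩
      rw [hasFiniteIntegral_iff_ofReal (Eventually.of_forall hnn)]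
      exact hfin
    rw [← ofReal_integral_eq_lintegral_ofReal hIntg (Eventually.of_forall hnn)]
    rw [ENNReal.ofReal_le_one]
    unfold tailFn at ht2
    simp only [sub_zero] at ht2
    set I := ∫ x in (ball (0 : Euc N) 2)ᶜ, |u x t| ^ (p - 1) * ‖x‖ ^ (-((N : ℝ) + s * p)) with hI
    have hI0 : 0 ≤ I := integral_nonneg hnn
    have h2sp : (1:ℝ) ≤ 2 ^ (s * p) := Real.one_le_rpow (by norm_num) hsp0.le
    by_contra hcon
    push Not at hcon
    have : 1 < (2 ^ (s * p) * I) ^ (1 / (p - 1)) :=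
      Real.one_lt_rpow (by nlinarith) (div_pos one_pos (by linarith))
    linarith
  · intro R a b hR ha hb'
    refine (hw1 (Icc a b) isCompact_Icc (fun t ht => ⟨by linarith [ht.1], by linarith [ht.2]⟩) (ball 0 R) isOpen_ball
        ((isCompact_closedBall (0 : Euc N) R).of_isClosed_subset isClosed_closure closure_ball_subset_closedBall)
        (closure_ball_subset_closedBall.trans (closedBall_subset_ball hR))).1

/-- spatial Hölder bootstrap at the normalised scale. -/
theorem spatial_holder_bootstrap
    (N : ℕ) (hN : 1 ≤ N) (p s lam Lam κ γ ϱ₁ ϱ₂ A : ℝ)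
    (hp : 1 < p) (hs : s ∈ Ioo (0 : ℝ) 1) (hsp : p - 1 < s * p)
    (hlam : 0 < lam) (hlamLam : lam ≤ Lam)
    (hϱ₁ : 1 ≤ ϱ₁) (hϱ₁₂ : ϱ₁ < ϱ₂) (hϱ₂ : ϱ₂ ≤ 3 / 2)
    (hκ : κ ∈ Ico (0 : ℝ) 1) (hA : 0 ≤ A)
    (hγ0 : 0 < γ) (hγ : γ < min 1 (κ + 1 / (p - 1))) :
    ∃ L : ℝ, 0 < L ∧
      ∀ (K : Euc N → ℝ) (u : Euc N → ℝ → ℝ),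
        IsKernel N p s lam Lam K →
        (Continuous fun q : Euc N × ℝ => u q.1 q.2) →
        IsLocalWeakSolution N p s K (ball 0 2) (Ioc (-2) 0) u →
        (⨆ x ∈ ball (0 : Euc N) 2, ⨆ t ∈ Ioc (-2 : ℝ) 0, ENNReal.ofReal |u x t|)
          + tailSup N p s u 0 2 (Ioc (-2) 0) ≤ 1 →
        (∀ t ∈ Ioc (-1 : ℝ) 0, ∀ x ∈ ball (0 : Euc N) ϱ₂, ∀ y ∈ ball (0 : Euc N) ϱ₂,
          |u x t - u y t| ≤ A * dist x y ^ κ) →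
        ∀ t ∈ Ioc (-1 : ℝ) 0, ∀ x ∈ ball (0 : Euc N) ϱ₁, ∀ y ∈ ball (0 : Euc N) ϱ₁,
          |u x t - u y t| ≤ L * dist x y ^ γ := by
  have hγ1 : γ < 1 := hγ.trans_le (min_le_left _ _)
  obtain ⟨L, hL, hH⟩ := SS_all N hN hp hs hsp hlam hlamLam hγ0 hγ1 (3 / 2) (by norm_num) 1 (by norm_num)
  refine ⟨L + 1, by positivity, fun K u hK hu hw hb _ => ?_⟩
  have hg := good_of hp hs hu hw hb
  have key : ∀ t : ℝ, -1 < t → t < 0 → ∀ x ∈ ball (0 : Euc N) ϱ₁, ∀ y ∈ ball (0 : Euc N) ϱ₁,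
      |u x t - u y t| ≤ (L + 1) * dist x y ^ γ := by
    intro t ht1 ht2 x hx y hy
    have hx' : ‖x‖ < 3 / 2 := by
      have : ‖x‖ < ϱ₁ := by simpa using hx
      linarith
    have hy' : ‖y‖ < 3 / 2 := by
      have : ‖y‖ < ϱ₁ := by simpa using hy
      linarith
    have r1 := hH K hK _ hg t ht1 ht2 x y hx' hy'
    have r2 := hH K hK _ hg t ht1 ht2 y x hy' hx'
    rw [norm_sub_rev] at r2
    simp only at r1 r2
    rw [dist_eq_norm]
    have : 0 ≤ ‖x - y‖ ^ γ := by positivity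
    rw [abs_le]
    constructor <;> linarith
  intro t ht x hx y hy
  rcases ht.2.lt_or_eq with h | h
  · exact key t ht.1 h x hx y hy
  · subst h
    have hcx : Continuous fun t => |u x t - u y t| := by
      have h1 : Continuous fun t => u x t := hu.comp (by fun_prop : Continuous fun t : ℝ => (x, t))
      have h2 : Continuous fun t => u y t := hu.comp (by fun_prop : Continuous fun t : ℝ => (y, t))
      fun_prop
    have ht : Tendsto (fun t => |u x t - u y t|) (𝓝[<] (0:ℝ)) (𝓝 |u x 0 - u y 0|) :=
      (hcx.tendsto 0).mono_left nhdsWithin_le_nhds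
    refine le_of_tendsto ht ?_
    filter_upwards [Ioo_mem_nhdsLT (show (-1:ℝ) < 0 by norm_num)] with r hr
    exact key r hr.1 hr.2 x hx y hy
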